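/- Let n ≥ 2, let F be a finite field of odd order q and characteristic p, and let π be a set of primes with 2 ∈ π, 3 ∈ π, and p ∉ π. If H is a π-Hall subgroup of SL_n(F), then there exists a subgroup K of SL_n(F) whose order is a π-number such that no conjugate of K in SL_n(F) is contained in H. In particular, SL_n(F) does not satisfy D_π. -/

import Mathlib

/-- `n` is a `π`-number: every prime dividing `n` lies in `π`. -/
def IsPiNumber (π : Set ℕ) (n : ℕ) : Prop :=
  ∀ p : ℕ, p.Prime → p ∣ n → p ∈ π

/-- `H` is a `π`-Hall subgroup of `G`: its order is a `π`-number and no prime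
in `π` divides its index. -/
def IsHallPi (π : Set ℕ) {G : Type*} [Group G] (H : Subgroup G) : Prop :=
  IsPiNumber π (Nat.card H) ∧ ∀ p ∈ π, p.Prime → ¬ p ∣ H.index

/-- The conjugate `g K g⁻¹` of a subgroup `K`. -/
def conjSub {G : Type*} [Group G] (g : G) (K : Subgroup G) : Subgroup G :=
  K.map (MulAut.conj g).toMonoidHom

/-- `G` satisfies `E_π`: it possesses a `π`-Hall subgroup. -/
def EPi (π : Set ℕ) (G : Type*) [Group G] : Prop :=
  ∃ H : Subgroup G, IsHallPi π H

/-- `G` satisfies `C_π`: it satisfies `E_π` and any two `π`-Hall subgroups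
of `G` are conjugate in `G`. -/
def CPi (π : Set ℕ) (G : Type*) [Group G] : Prop :=
  EPi π G ∧ ∀ H K : Subgroup G, IsHallPi π H → IsHallPi π K → ∃ g : G, conjSub g H = K

/-- `G` satisfies `D_π`: it satisfies `C_π` and every `π`-subgroup of `G` is
contained in some `π`-Hall subgroup of `G`. -/
def DPi (π : Set ℕ) (G : Type*) [Group G] : Prop :=
  CPi π G ∧ ∀ K : Subgroup G, IsPiNumber π (Nat.card K) →
    ∃ H : Subgroup G, IsHallPi π H ∧ K ≤ H



section JD
open Module

variable {K V ι : Type*} [Field K] [IsAlgClosed K] [AddCommGroup V] [Module K V]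
  [FiniteDimensional K V]

lemma jd_semisimple (N : ℕ) (hN : (N : K) ≠ 0) (f : End K V) (hf : f ^ N = 1) :
    f.IsSemisimple := by
  apply Module.End.isSemisimple_of_squarefree_aeval_eq_zero (p := (Polynomial.X ^ N - 1 : Polynomial K))
  · apply Polynomial.Separable.squarefree
    simpa using Polynomial.separable_X_pow_sub_C (1:K) hN one_ne_zero
  · simp [hf]

lemma jd_top (N : ℕ) (hN : (N : K) ≠ 0) (f : ι → End K V) (hf : ∀ i, f i ^ N = 1)
    (hc : ∀ i j, Commute (f i) (f j)) :
    ⨆ χ : ι → K, ⨅ i, (f i).eigenspace (χ i) = ⊤ := by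
  have h1 := End.iSup_iInf_maxGenEigenspace_eq_top_of_iSup_maxGenEigenspace_eq_top_of_commute f
    (fun i j _ => hc i j) (fun i => End.iSup_maxGenEigenspace_eq_top (f i))
  have h2 : ∀ i μ, (f i).maxGenEigenspace μ = (f i).eigenspace μ := fun i μ =>
    (jd_semisimple N hN (f i) (hf i)).isFinitelySemisimple.maxGenEigenspace_eq_eigenspace μ
  simpa [h2] using h1

lemma jd_indep (N : ℕ) (hN : (N : K) ≠ 0) (f : ι → End K V) (hf : ∀ i, f i ^ N = 1)
    (hc : ∀ i j, Commute (f i) (f j)) :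
    iSupIndep fun χ : ι → K => ⨅ i, (f i).eigenspace (χ i) := by
  have h1 := End.independent_iInf_maxGenEigenspace_of_forall_mapsTo f
    (fun i j => End.mapsTo_maxGenEigenspace_of_comm (hc j i))
  have h2 : ∀ i μ, (f i).maxGenEigenspace μ = (f i).eigenspace μ := fun i μ =>
    (jd_semisimple N hN (f i) (hf i)).isFinitelySemisimple.maxGenEigenspace_eq_eigenspace μ
  simpa [h2] using h1

/-- Two linear maps agreeing on joint eigenvectors agree. -/
lemma jd_ext (N : ℕ) (hN : (N : K) ≠ 0) (f : ι → End K V) (hf : ∀ i, f i ^ N = 1)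
    (hc : ∀ i j, Commute (f i) (f j)) (A B : End K V)
    (h : ∀ (χ : ι → K) (v : V), (∀ i, f i v = χ i • v) → A v = B v) : A = B := by
  have h1 : ⨆ χ : ι → K, ⨅ i, (f i).eigenspace (χ i) ≤ LinearMap.eqLocus A B := by
    refine iSup_le fun χ v hv => ?_
    simp only [Submodule.mem_iInf, End.mem_eigenspace_iff] at hv
    exact h χ v hv
  rw [jd_top N hN f hf hc] at h1
  ext v
  exact h1 (Submodule.mem_top (x := v))

end JD

section Frob
open Matrix
open scoped Matrix.Norms.L2Operator ComplexOrder
set_option linter.unusedSectionVars false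

variable {n : Type*} [Fintype n] [DecidableEq n]

/-- Hilbert–Schmidt norm squared. -/
noncomputable def hsN (A : Matrix n n ℂ) : ℝ := (Aᴴ * A).trace.re

lemma hsN_eq_sum (A : Matrix n n ℂ) : hsN A = ∑ j, ∑ i, ‖A i j‖ ^ 2 := by
  simp only [hsN, Matrix.trace, Matrix.diag, Matrix.mul_apply, Matrix.conjTranspose_apply, Complex.re_sum]
  refine Finset.sum_congr rfl fun j _ => Finset.sum_congr rfl fun i _ => ?_
  have := Complex.conj_mul' (A i j)
  rw [Complex.star_def, this]; norm_cast

lemma hsN_nonneg (A : Matrix n n ℂ) : 0 ≤ hsN A := by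
  rw [hsN_eq_sum]; positivity

lemma hsN_eq_zero {A : Matrix n n ℂ} (h : hsN A = 0) : A = 0 := by
  rw [hsN_eq_sum] at h
  ext i j
  have h1 := (Finset.sum_eq_zero_iff_of_nonneg (fun j _ => by positivity)).1 h j (Finset.mem_univ _)
  have h2 := (Finset.sum_eq_zero_iff_of_nonneg (fun j _ => by positivity)).1 h1 i (Finset.mem_univ _)
  simpa using h2

lemma hsN_conjTranspose (A : Matrix n n ℂ) : hsN Aᴴ = hsN A := by
  rw [hsN, hsN, conjTranspose_conjTranspose, Matrix.trace_mul_comm]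

lemma hsN_mul_le (M A : Matrix n n ℂ) (hM : ‖M‖ ≤ 1) : hsN (M * A) ≤ hsN A := by
  rw [hsN_eq_sum, hsN_eq_sum]
  refine Finset.sum_le_sum fun j _ => ?_
  have h := Matrix.l2_opNorm_mulVec M (WithLp.toLp 2 (fun i => A i j))
  have h2 : ‖(EuclideanSpace.equiv n ℂ).symm (M *ᵥ (fun i => A i j))‖ ≤
      ‖(WithLp.toLp 2 (fun i => A i j) : EuclideanSpace ℂ n)‖ := by
    refine h.trans ?_
    have := norm_nonneg (WithLp.toLp 2 (fun i => A i j) : EuclideanSpace ℂ n)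
    nlinarith
  have h3 := pow_le_pow_left₀ (norm_nonneg _) h2 2
  rw [EuclideanSpace.norm_sq_eq, EuclideanSpace.norm_sq_eq] at h3
  simpa [Matrix.mulVec, dotProduct, Matrix.mul_apply] using h3

lemma hsN_mul_le' (M A : Matrix n n ℂ) (hM : ‖M‖ ≤ 1) : hsN (A * M) ≤ hsN A := by
  rw [← hsN_conjTranspose (A * M), ← hsN_conjTranspose A, conjTranspose_mul]
  exact hsN_mul_le _ _ (by rwa [Matrix.l2_opNorm_conjTranspose])

lemma hsN_par (A B : Matrix n n ℂ) : hsN (A - B) + hsN (A + B) = 2 * hsN A + 2 * hsN B := by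
  simp only [hsN, conjTranspose_sub, conjTranspose_add, sub_mul, mul_sub, add_mul, mul_add,
    Matrix.trace_sub, Matrix.trace_add, Complex.sub_re, Complex.add_re]
  ring

lemma hsN_fix (M D : Matrix n n ℂ) (hM : ‖M‖ ≤ 1) (h : hsN D ≤ hsN (M * D)) : Mᴴ * (M * D) = D := by
  have h1 : hsN (Mᴴ * (M * D)) ≤ hsN (M * D) :=
    hsN_mul_le _ _ (by rwa [Matrix.l2_opNorm_conjTranspose])
  have h2 : hsN (M * D) ≤ hsN D := hsN_mul_le _ _ hM
  have h3 : hsN (Mᴴ * (M * D) - D) = hsN (Mᴴ * (M * D)) - 2 * hsN (M * D) + hsN D := by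
    simp only [hsN, conjTranspose_sub, sub_mul, mul_sub, Matrix.trace_sub, Complex.sub_re,
      conjTranspose_mul, conjTranspose_conjTranspose, Matrix.mul_assoc]
    ring
  have h4 : hsN (Mᴴ * (M * D) - D) = 0 := le_antisymm (by linarith) (hsN_nonneg _)
  exact sub_eq_zero.1 (hsN_eq_zero h4)

lemma hsN_strict (M D : Matrix n n ℂ) (hM : ‖M‖ ≤ 1)
    (hD : (1 + D) * (1 + D)ᴴ = 1) (h : 4 * hsN D ≤ hsN (M * D - D * M)) : D = 0 := by
  have h1 := hsN_mul_le M D hM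
  have h2 := hsN_mul_le' M D hM
  have h3 := hsN_par (M * D) (D * M)
  have h4 := hsN_nonneg (M * D + D * M)
  have h5 : M * D + D * M = 0 := hsN_eq_zero (by linarith)
  have h6 := hsN_fix M D hM (by linarith)
  have hM' : ‖Mᴴ‖ ≤ 1 := by rwa [Matrix.l2_opNorm_conjTranspose]
  have h7 := hsN_fix Mᴴ Dᴴ hM' (by
    rw [← conjTranspose_mul, hsN_conjTranspose, hsN_conjTranspose]; linarith)
  have h8 : D * M * Mᴴ = D := by
    have := congrArg conjTranspose h7
    simpa using this
  have h9 : Mᴴ * D = - (D * Mᴴ) := by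
    have : M * D = - (D * M) := eq_neg_of_add_eq_zero_left h5
    calc Mᴴ * D = Mᴴ * (D * M * Mᴴ) := by rw [h8]
      _ = Mᴴ * (-(M * D) * Mᴴ) := by rw [this, neg_neg]
      _ = - ((Mᴴ * (M * D)) * Mᴴ) := by noncomm_ring
      _ = _ := by rw [h6]
  have h10 : M * Dᴴ = - (Dᴴ * M) := by
    have := congrArg conjTranspose h9
    simp only [conjTranspose_mul, conjTranspose_neg, conjTranspose_conjTranspose] at this
    rw [this, neg_neg]
  have h11 : D + Dᴴ = - (D * Dᴴ) := by
    simp only [conjTranspose_add, conjTranspose_one] at hD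
    have : (1 + D) * (1 + Dᴴ) = 1 + (D + Dᴴ + D * Dᴴ) := by noncomm_ring
    rw [this] at hD
    have := add_eq_left.1 hD
    exact eq_neg_of_add_eq_zero_left this
  have h12 : M * D = - (D * M) := eq_neg_of_add_eq_zero_left h5
  have h13 : M * (D * Dᴴ) = D * Dᴴ * M := by
    rw [← mul_assoc, h12, neg_mul, mul_assoc, h10]; noncomm_ring
  have h14 : M * (D * Dᴴ) = - (D * Dᴴ * M) := by
    have : D * Dᴴ = - (D + Dᴴ) := by rw [h11, neg_neg]
    rw [this, mul_neg, mul_add, h12, h10]; noncomm_ring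
  have h15 : M * (D * Dᴴ) = 0 := by
    rw [h13] at h14 ⊢
    have : (2:ℂ) • (D * Dᴴ * M) = 0 := by rw [two_smul]; nth_rewrite 1 [h14]; simp
    simpa using this
  have h16 : M * D = 0 := by
    rw [← Matrix.self_mul_conjTranspose_eq_zero (A := M * D)]
    rw [conjTranspose_mul]
    calc M * D * (Dᴴ * Mᴴ) = (M * (D * Dᴴ)) * Mᴴ := by noncomm_ring
      _ = 0 := by rw [h15, zero_mul]
  rw [← h6, h16, mul_zero]

lemma frob_back (N : ℕ) (hN : N ≠ 0) (X Y T : Matrix n n ℂ) (c : ℂ) (hT : Tᴴ * T = 1)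
    (hXN : X ^ N = 1) (hTN : T ^ N = 1) (hTY : T * Y = Y * X) (hXT : X * T = T * X)
    (hY : ‖Y - c • (1 : Matrix n n ℂ)‖ < ‖c‖) : T = X := by
  apply Matrix.toLin'.injective
  let f : Bool → Module.End ℂ (n → ℂ) := fun b => if b then Matrix.toLin' X else Matrix.toLin' T
  refine jd_ext N (by exact_mod_cast hN) f ?_ ?_ _ _ ?_
  · intro i; cases i <;> simp [f, ← Matrix.toLin'_pow, hXN, hTN] <;> rfl
  · intro i j
    cases i <;> cases j <;> simp [f, Commute, SemiconjBy, ← Matrix.toLin'_mul, hXT, Module.End.mul_eq_comp]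
  · intro χ v hv
    have hX : X *ᵥ v = χ true • v := by simpa [f] using hv true
    have hT' : T *ᵥ v = χ false • v := by simpa [f] using hv false
    rw [Matrix.toLin'_apply, Matrix.toLin'_apply, hX, hT']
    by_cases hv0 : v = 0
    · simp [hv0]
    by_contra hne
    have hne' : χ false ≠ χ true := fun h => hne (by rw [h])
    set w := Y *ᵥ v with hw
    have hTw : T *ᵥ w = χ true • w := by
      rw [hw, Matrix.mulVec_mulVec, hTY, ← Matrix.mulVec_mulVec, hX, Matrix.mulVec_smul]
    have hpres : ∀ a b : n → ℂ, star (T *ᵥ a) ⬝ᵥ (T *ᵥ b) = star a ⬝ᵥ b := by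
      intro a b
      rw [Matrix.star_mulVec, ← Matrix.dotProduct_mulVec, Matrix.mulVec_mulVec, hT, Matrix.one_mulVec]
    have hvv : star v ⬝ᵥ v ≠ 0 := by simpa using hv0
    have h1 : star (χ false) * χ false = 1 := by
      have := hpres v v
      rw [hT'] at this
      simp only [star_smul, smul_dotProduct, dotProduct_smul, smul_eq_mul, ← mul_assoc] at this
      exact mul_right_cancel₀ hvv (by rw [mul_comm (star _), this, one_mul])
    have h2 : star v ⬝ᵥ w = 0 := by
      have := hpres v w
      rw [hT', hTw] at this
      simp only [star_smul, smul_dotProduct, dotProduct_smul, smul_eq_mul, ← mul_assoc] at this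
      by_contra h0
      have h3 : star (χ false) * χ true = 1 := mul_right_cancel₀ h0 (by rw [mul_comm (star _), this, one_mul])
      apply hne'
      have h4 : star (χ false) ≠ 0 := left_ne_zero_of_mul_eq_one h1
      exact mul_left_cancel₀ h4 (h1.trans h3.symm)
    have h5 := Matrix.l2_opNorm_mulVec (Y - c • (1 : Matrix n n ℂ)) (WithLp.toLp 2 v)
    have h6 : (EuclideanSpace.equiv n ℂ).symm ((Y - c • (1 : Matrix n n ℂ)) *ᵥ v) =
       (WithLp.toLp 2 w : EuclideanSpace ℂ n) - c • (WithLp.toLp 2 v : EuclideanSpace ℂ n) := by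
      ext i
      simp [Matrix.sub_mulVec, hw, Matrix.smul_mulVec]
    have h7 : inner ℂ (WithLp.toLp 2 w : EuclideanSpace ℂ n) (c • (WithLp.toLp 2 v : EuclideanSpace ℂ n)) = 0 := by
      rw [inner_smul_right, ← inner_conj_symm, EuclideanSpace.inner_eq_star_dotProduct]
      simp [dotProduct_comm w, h2]
    have hvpos : 0 < ‖(WithLp.toLp 2 v : EuclideanSpace ℂ n)‖ := by
      rw [norm_pos_iff]; simpa using hv0
    have h8 : ‖c‖ * ‖(WithLp.toLp 2 v : EuclideanSpace ℂ n)‖ ≤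
        ‖(WithLp.toLp 2 w : EuclideanSpace ℂ n) - c • (WithLp.toLp 2 v : EuclideanSpace ℂ n)‖ := by
      have h9 := @norm_sub_sq ℂ _ _ _ _ (WithLp.toLp 2 w : EuclideanSpace ℂ n) (c • (WithLp.toLp 2 v : EuclideanSpace ℂ n))
      rw [h7, norm_smul] at h9
      simp at h9
      apply le_of_sq_le_sq _ (norm_nonneg _)
      rw [h9]
      nlinarith [sq_nonneg ‖(WithLp.toLp 2 w : EuclideanSpace ℂ n)‖]
    have h10 := (h8.trans (h6 ▸ h5))
    simp only [] at h10
    have := mul_lt_mul_of_pos_right hY hvpos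
    linarith

lemma frob_commutator {Γ : Type*} [Group Γ] (ρ : Γ →* Matrix n n ℂ)
    (hu : ∀ g, (ρ g)ᴴ * ρ g = 1) (x y : Γ) (c e : ℂ) (M : Matrix n n ℂ)
    (hM : ρ x - c • (1 : Matrix n n ℂ) = (1/2 : ℂ) • M) :
    ∃ U : Matrix n n ℂ, U * Uᴴ = 1 ∧ ‖U‖ ≤ 1 ∧
    ρ (x * y * x⁻¹ * y⁻¹) - 1 = (1/2 : ℂ) • ((M * (ρ y - e • 1) - (ρ y - e • 1) * M) * U) := by
  have hu' : ∀ g, ρ g * (ρ g)ᴴ = 1 := fun g => mul_eq_one_comm.1 (hu g)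
  refine ⟨ρ (x⁻¹ * y⁻¹), hu' _, ?_, ?_⟩
  · have := Matrix.l2_opNorm_conjTranspose_mul_self (ρ (x⁻¹ * y⁻¹))
    rw [hu] at this
    have h1 : ‖(1 : Matrix n n ℂ)‖ ≤ 1 := by
      rcases subsingleton_or_nontrivial (Matrix n n ℂ) with h | h
      · rw [Subsingleton.elim (1 : Matrix n n ℂ) 0]; simp
      · simp
    nlinarith [norm_nonneg (ρ (x⁻¹ * y⁻¹))]
  · have e1 : (1/2 : ℂ) • ((M * (ρ y - e • 1) - (ρ y - e • 1) * M)) = ρ (x * y) - ρ (y * x) := by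
      rw [smul_sub, ← smul_mul_assoc, ← mul_smul_comm, ← hM, map_mul, map_mul]
      simp only [sub_mul, mul_sub, smul_mul_assoc, mul_smul_comm, one_mul, mul_one, smul_sub]
      rw [smul_comm e c]
      abel
    rw [← smul_mul_assoc, e1, sub_mul, ← map_mul, ← map_mul]
    congr 1
    · congr 1; group
    · rw [← map_one ρ]; congr 1; group

lemma frob_near_one {Γ : Type*} [Group Γ] [Finite Γ] (ρ : Γ →* Matrix n n ℂ)
    (hinj : Function.Injective ρ)
    (hu : ∀ g, (ρ g)ᴴ * ρ g = 1) (x : Γ) (c : ℂ)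
    (hx : ‖ρ x - c • (1 : Matrix n n ℂ)‖ ≤ 1 / 2)
    (y : Γ) (hy : ‖ρ y - 1‖ ≤ 1 / 2) : Commute x y := by
  have hwf : WellFounded (InvImage (· < · : ℝ → ℝ → Prop) (fun y : Γ => hsN (ρ y - 1))) := by
    have : Std.Irrefl (InvImage (· < · : ℝ → ℝ → Prop) (fun y : Γ => hsN (ρ y - 1))) := ⟨fun a => lt_irrefl (hsN (ρ a - 1))⟩
    have : IsTrans Γ (InvImage (· < · : ℝ → ℝ → Prop) (fun y : Γ => hsN (ρ y - 1))) := ⟨fun a b c h1 h2 => lt_trans (α := ℝ) h1 h2⟩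
    exact Finite.wellFounded_of_trans_of_irrefl _
  have hu' : ∀ g, ρ g * (ρ g)ᴴ = 1 := fun g => mul_eq_one_comm.1 (hu g)
  induction y using hwf.induction with
  | _ y ih =>
  set M : Matrix n n ℂ := (2 : ℂ) • (ρ x - c • 1) with hMdef
  have hM : ρ x - c • (1 : Matrix n n ℂ) = (1/2 : ℂ) • M := by
    rw [hMdef, smul_smul]; norm_num
  have hM1 : ‖M‖ ≤ 1 := by
    rw [hMdef, norm_smul]; simp; linarith
  obtain ⟨U, hU, hU1, hcomm⟩ := frob_commutator ρ hu x y c 1 M hM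
  rw [one_smul] at hcomm
  set D := ρ y - 1 with hD
  by_cases hD0 : D = 0
  · have : ρ y = ρ 1 := by rw [map_one]; exact sub_eq_zero.1 hD0
    rw [hinj this]; exact Commute.one_right x
  have hlt : hsN (M * D - D * M) < 4 * hsN D := by
    by_contra hcon
    apply hD0
    refine hsN_strict M D hM1 ?_ (not_lt.1 hcon)
    rw [hD]; simpa using hu' y
  have hhs : hsN (ρ (x * y * x⁻¹ * y⁻¹) - 1) < hsN D := by
    have e1 : hsN (ρ (x * y * x⁻¹ * y⁻¹) - 1) ≤ hsN ((1/2 : ℂ) • (M * D - D * M)) := by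
      rw [hcomm, ← smul_mul_assoc]
      exact hsN_mul_le' _ _ hU1
    have e2 : hsN ((1/2 : ℂ) • (M * D - D * M)) = (1/4) * hsN (M * D - D * M) := by
      rw [hsN_eq_sum, hsN_eq_sum, Finset.mul_sum]
      refine Finset.sum_congr rfl fun j _ => ?_
      rw [Finset.mul_sum]
      refine Finset.sum_congr rfl fun i _ => ?_
      rw [Matrix.smul_apply, norm_smul, mul_pow]; norm_num
    linarith
  have hnorm : ‖ρ (x * y * x⁻¹ * y⁻¹) - 1‖ ≤ 1 / 2 := by
    rw [hcomm, norm_smul]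
    have e1 : ‖(M * D - D * M) * U‖ ≤ ‖M * D - D * M‖ * ‖U‖ := norm_mul_le _ _
    have e2 : ‖M * D - D * M‖ ≤ ‖M‖ * ‖D‖ + ‖D‖ * ‖M‖ :=
      (norm_sub_le _ _).trans (add_le_add (norm_mul_le _ _) (norm_mul_le _ _))
    have e3 : ‖M‖ * ‖D‖ ≤ ‖D‖ := by nlinarith [norm_nonneg D]
    have e4 : ‖M * D - D * M‖ * ‖U‖ ≤ ‖M * D - D * M‖ := by
      nlinarith [norm_nonneg (M * D - D * M)]
    have e5 : ‖(1/2 : ℂ)‖ = 1/2 := by simp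
    rw [e5]
    nlinarith
  have h1 := ih _ hhs hnorm
  -- x commutes with y x y⁻¹
  have h2 : Commute x (y * x * y⁻¹) := by
    have h3 : Commute x (x⁻¹ * (x * y * x⁻¹ * y⁻¹)) :=
      ((Commute.refl x).inv_right).mul_right h1
    have h4 : (x⁻¹ * (x * y * x⁻¹ * y⁻¹))⁻¹ = y * x * y⁻¹ := by group
    rw [← h4]; exact h3.inv_right
  have hcard : Nat.card Γ ≠ 0 := Nat.card_pos.ne'
  have h5 := frob_back (Nat.card Γ) hcard (ρ x) (ρ y) (ρ (y * x * y⁻¹)) 1 (hu _)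
    (by rw [← map_pow, pow_card_eq_one', map_one]) (by rw [← map_pow, pow_card_eq_one', map_one])
    (by rw [← map_mul, ← map_mul]; congr 1; group)
    (by rw [← map_mul, ← map_mul, h2.eq]) (by rw [one_smul]; simp; linarith)
  have h6 := hinj h5
  rw [mul_inv_eq_iff_eq_mul] at h6
  exact h6.symm

lemma frob_main {Γ : Type*} [Group Γ] [Finite Γ] (ρ : Γ →* Matrix n n ℂ)
    (hinj : Function.Injective ρ)
    (hu : ∀ g, (ρ g)ᴴ * ρ g = 1) (x : Γ) (c : ℂ) (hc : 1 / 2 < ‖c‖)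
    (hx : ‖ρ x - c • (1 : Matrix n n ℂ)‖ ≤ 1 / 2) (h : Γ) :
    Commute x (h * x * h⁻¹) := by
  set y := h * x * h⁻¹ with hy
  have hU : ∀ g : Γ, ‖ρ g‖ ≤ 1 := by
    intro g
    have := Matrix.l2_opNorm_conjTranspose_mul_self (ρ g)
    rw [hu] at this
    have h1 : ‖(1 : Matrix n n ℂ)‖ ≤ 1 := by
      rcases subsingleton_or_nontrivial (Matrix n n ℂ) with h | h
      · rw [Subsingleton.elim (1 : Matrix n n ℂ) 0]; simp
      · simp
    nlinarith [norm_nonneg (ρ g)]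
  have hynorm : ‖ρ y - c • (1 : Matrix n n ℂ)‖ ≤ 1 / 2 := by
    have e1 : ρ y - c • (1 : Matrix n n ℂ) = ρ h * (ρ x - c • 1) * ρ h⁻¹ := by
      rw [mul_sub, sub_mul, mul_smul_comm, smul_mul_assoc, mul_one, ← map_mul, ← map_mul, ← map_mul,
        mul_inv_cancel, map_one]
    rw [e1]
    calc _ ≤ ‖ρ h * (ρ x - c • 1)‖ * ‖ρ h⁻¹‖ := norm_mul_le _ _
      _ ≤ (‖ρ h‖ * ‖ρ x - c • (1 : Matrix n n ℂ)‖) * ‖ρ h⁻¹‖ := by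
        gcongr; exact norm_mul_le _ _
      _ ≤ (1 * ‖ρ x - c • (1 : Matrix n n ℂ)‖) * 1 := by gcongr <;> exact hU _
      _ ≤ _ := by linarith
  set M : Matrix n n ℂ := (2 : ℂ) • (ρ x - c • 1) with hMdef
  have hM : ρ x - c • (1 : Matrix n n ℂ) = (1/2 : ℂ) • M := by
    rw [hMdef, smul_smul]; norm_num
  have hM1 : ‖M‖ ≤ 1 := by
    rw [hMdef, norm_smul]; simp; linarith
  obtain ⟨U, -, hU1, hcomm⟩ := frob_commutator ρ hu x y c c M hM
  have hnorm : ‖ρ (x * y * x⁻¹ * y⁻¹) - 1‖ ≤ 1 / 2 := by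
    rw [hcomm, norm_smul]
    set D := ρ y - c • (1 : Matrix n n ℂ)
    have e1 : ‖(M * D - D * M) * U‖ ≤ ‖M * D - D * M‖ * ‖U‖ := norm_mul_le _ _
    have e2 : ‖M * D - D * M‖ ≤ ‖M‖ * ‖D‖ + ‖D‖ * ‖M‖ :=
      (norm_sub_le _ _).trans (add_le_add (norm_mul_le _ _) (norm_mul_le _ _))
    have e3 : ‖M‖ * ‖D‖ ≤ ‖D‖ := by nlinarith [norm_nonneg D]
    have e4 : ‖M * D - D * M‖ * ‖U‖ ≤ ‖M * D - D * M‖ := by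
      nlinarith [norm_nonneg (M * D - D * M)]
    have e5 : ‖(1/2 : ℂ)‖ = 1/2 := by simp
    rw [e5]
    nlinarith
  have h1 := frob_near_one ρ hinj hu x c hx _ hnorm
  have h2 : Commute x (y * x * y⁻¹) := by
    have h3 : Commute x (x⁻¹ * (x * y * x⁻¹ * y⁻¹)) :=
      ((Commute.refl x).inv_right).mul_right h1
    have h4 : (x⁻¹ * (x * y * x⁻¹ * y⁻¹))⁻¹ = y * x * y⁻¹ := by group
    rw [← h4]; exact h3.inv_right
  have hcard : Nat.card Γ ≠ 0 := Nat.card_pos.ne'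
  have h5 := frob_back (Nat.card Γ) hcard (ρ x) (ρ y) (ρ (y * x * y⁻¹)) c (hu _)
    (by rw [← map_pow, pow_card_eq_one', map_one]) (by rw [← map_pow, pow_card_eq_one', map_one])
    (by rw [← map_mul, ← map_mul]; congr 1; group)
    (by rw [← map_mul, ← map_mul, h2.eq]) (by linarith)
  have h6 := hinj h5
  rw [mul_inv_eq_iff_eq_mul] at h6
  exact h6.symm

end Frob

section Unitarize
open Matrix
open scoped Matrix.Norms.L2Operator ComplexOrder MatrixOrder

variable {n : Type*} [Fintype n] [DecidableEq n]

lemma unitarize {Γ : Type*} [Group Γ] [Finite Γ] (ρ : Γ →* Matrix n n ℂ) :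
    ∃ B : Matrix n n ℂ, IsUnit B.det ∧
      ∀ g, (B * ρ g * B⁻¹)ᴴ * (B * ρ g * B⁻¹) = 1 := by
  have := Fintype.ofFinite Γ
  set P : Matrix n n ℂ := ∑ g, (ρ g)ᴴ * ρ g with hP
  have hinvar : ∀ h, (ρ h)ᴴ * P * ρ h = P := by
    intro h
    rw [hP, Finset.mul_sum, Finset.sum_mul]
    refine Fintype.sum_equiv (Equiv.mulRight h) _ _ fun g => ?_
    simp only [Equiv.coe_mulRight, map_mul, conjTranspose_mul]
    noncomm_ring
  have hpd : P.PosDef := by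
    rw [hP]
    apply Matrix.posDef_sum ⟨1, Finset.mem_univ _⟩
    intro g _
    apply Matrix.PosDef.conjTranspose_mul_self
    apply Matrix.mulVec_injective_of_isUnit
    exact (Group.isUnit g).map ρ
  obtain ⟨B, hB⟩ := CStarAlgebra.nonneg_iff_eq_star_mul_self.mp hpd.posSemidef.nonneg
  rw [star_eq_conjTranspose] at hB
  have hBd : IsUnit B.det := by
    have h1 := (Matrix.isUnit_iff_isUnit_det _).1 hpd.isUnit
    rw [hB, det_mul] at h1
    exact isUnit_of_mul_isUnit_right h1
  refine ⟨B, hBd, fun g => ?_⟩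
  have e1 : B * B⁻¹ = 1 := Matrix.mul_nonsing_inv _ hBd
  calc (B * ρ g * B⁻¹)ᴴ * (B * ρ g * B⁻¹) = (B⁻¹)ᴴ * ((ρ g)ᴴ * (Bᴴ * B) * ρ g) * B⁻¹ := by
        simp only [conjTranspose_mul]; noncomm_ring
    _ = (B⁻¹)ᴴ * (Bᴴ * B) * B⁻¹ := by rw [← hB, hinvar]
    _ = (B * B⁻¹)ᴴ * (B * B⁻¹) := by simp only [conjTranspose_mul]; noncomm_ring
    _ = 1 := by rw [e1]; simp

lemma norm_le_of_spectrum (A : Matrix n n ℂ) (hA : Aᴴ * A = A * Aᴴ) (r : NNReal)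
    (h : ∀ μ ∈ spectrum ℂ A, ‖μ‖₊ ≤ r) : ‖A‖ ≤ r := by
  have : IsStarNormal A := ⟨hA⟩
  have h1 := IsStarNormal.spectralRadius_eq_nnnorm A
  have h2 : spectralRadius ℂ A ≤ r := by
    refine iSup₂_le fun μ hμ => ?_
    exact_mod_cast h μ hμ
  rw [h1] at h2
  exact_mod_cast h2

lemma arc_bound (N a b j : ℕ) (hN : 0 < N) (h6 : 6 * (b - a) ≤ N) (haj : a ≤ j) (hjb : j ≤ b) :
    ‖Complex.exp (2 * Real.pi * Complex.I / N) ^ j -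
      (Real.sqrt 3 / 2 : ℝ) * Complex.exp ((Real.pi * (a + b) / N : ℝ) * Complex.I)‖ ≤ 1 / 2 := by
  have hN' : (0:ℝ) < N := by exact_mod_cast hN
  set θ : ℝ := Real.pi * (a + b) / N with hθ
  set δ : ℝ := Real.pi * (2 * j - a - b) / N with hδ
  have e1 : Complex.exp (2 * Real.pi * Complex.I / N) ^ j =
     Complex.exp (θ * Complex.I) * Complex.exp (δ * Complex.I) := by
    rw [← Complex.exp_nat_mul, ← Complex.exp_add]
    congr 1
    rw [hθ, hδ]; push_cast; field_simp; ring
  rw [e1, mul_comm ((Real.sqrt 3 / 2 : ℝ) : ℂ), ← mul_sub, norm_mul, Complex.norm_exp_ofReal_mul_I, one_mul]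
  have hδb : |δ| ≤ Real.pi / 6 := by
    have h6' : (6:ℝ) * (b - a) ≤ N := by
      have : a ≤ b := haj.trans hjb
      have h7 : ((6 * (b - a) : ℕ) : ℝ) ≤ N := by exact_mod_cast h6
      push_cast [Nat.cast_sub this] at h7; exact h7
    have h8 : (a:ℝ) ≤ j := by exact_mod_cast haj
    have h9 : (j:ℝ) ≤ b := by exact_mod_cast hjb
    rw [hδ, abs_div, abs_mul, abs_of_pos Real.pi_pos, abs_of_pos hN', div_le_div_iff₀ hN' (by norm_num)]
    have : |2 * (j:ℝ) - a - b| ≤ b - a := by rw [abs_le]; constructor <;> linarith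
    nlinarith [Real.pi_pos]
  have hcos : Real.sqrt 3 / 2 ≤ Real.cos δ := by
    rw [← Real.cos_pi_div_six, ← Real.cos_abs δ]
    exact Real.cos_le_cos_of_nonneg_of_le_pi (abs_nonneg _) (by linarith [Real.pi_pos]) hδb
  have hs : Real.sqrt 3 * Real.sqrt 3 = 3 := Real.mul_self_sqrt (by norm_num)
  have hs0 : 0 ≤ Real.sqrt 3 := Real.sqrt_nonneg _
  have hsq : ‖Complex.exp (δ * Complex.I) - ((Real.sqrt 3 / 2 : ℝ) : ℂ)‖ ^ 2 ≤ (1/2)^2 := by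
    rw [← Complex.normSq_eq_norm_sq, Complex.normSq_apply]
    simp only [Complex.sub_re, Complex.sub_im, Complex.exp_ofReal_mul_I_re, Complex.exp_ofReal_mul_I_im,
      Complex.ofReal_re, Complex.ofReal_im]
    nlinarith [Real.sin_sq_add_cos_sq δ]
  exact le_of_sq_le_sq hsq (by norm_num)

lemma frob_complex {Γ : Type*} [Group Γ] [Finite Γ] (ρ : Γ →* Matrix n n ℂ)
    (hinj : Function.Injective ρ) (x : Γ) (N a b : ℕ) (hN : 0 < N) (h6 : 6 * (b - a) ≤ N)
    (hx : ∀ μ : ℂ, (ρ x - μ • (1 : Matrix n n ℂ)).det = 0 →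
      ∃ j, a ≤ j ∧ j ≤ b ∧ μ = Complex.exp (2 * Real.pi * Complex.I / N) ^ j) (h : Γ) :
    Commute x (h * x * h⁻¹) := by
  obtain ⟨B, hBd, hB⟩ := unitarize ρ
  have e1 : B * B⁻¹ = 1 := Matrix.mul_nonsing_inv _ hBd
  have e2 : B⁻¹ * B = 1 := Matrix.nonsing_inv_mul _ hBd
  let ρ' : Γ →* Matrix n n ℂ :=
    { toFun := fun g => B * ρ g * B⁻¹
      map_one' := by rw [map_one, mul_one, e1]
      map_mul' := fun g h => by
        rw [map_mul]
        calc B * (ρ g * ρ h) * B⁻¹ = B * ρ g * 1 * ρ h * B⁻¹ := by noncomm_ring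
          _ = _ := by rw [← e2]; noncomm_ring }
  have hρ' : ∀ g, ρ' g = B * ρ g * B⁻¹ := fun g => rfl
  set c : ℂ := (Real.sqrt 3 / 2 : ℝ) * Complex.exp ((Real.pi * (a + b) / N : ℝ) * Complex.I) with hc
  refine frob_main ρ' ?_ hB x c ?_ ?_ h
  · intro g g' hg
    apply hinj
    have : B⁻¹ * (B * ρ g * B⁻¹) * B = B⁻¹ * (B * ρ g' * B⁻¹) * B := by rw [← hρ', hg, hρ']
    calc ρ g = (B⁻¹ * B) * ρ g * (B⁻¹ * B) := by rw [e2]; simp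
      _ = (B⁻¹ * B) * ρ g' * (B⁻¹ * B) := by simpa only [Matrix.mul_assoc] using this
      _ = ρ g' := by rw [e2]; simp
  · rw [hc, norm_mul, Complex.norm_exp_ofReal_mul_I, mul_one, Complex.norm_real, Real.norm_of_nonneg (by positivity)]
    have : (1:ℝ) < Real.sqrt 3 := by
      rw [Real.lt_sqrt] <;> norm_num
    linarith
  · have hu : (ρ' x)ᴴ * ρ' x = 1 := hB x
    have hu' : ρ' x * (ρ' x)ᴴ = 1 := mul_eq_one_comm.1 hu
    have := norm_le_of_spectrum (ρ' x - c • 1) ?_ (1/2) ?_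
    · simpa using this
    · simp only [conjTranspose_sub, conjTranspose_smul, conjTranspose_one, sub_mul, mul_sub, hu, hu',
        smul_mul_assoc, mul_smul_comm, one_mul, mul_one, smul_sub]
      rw [smul_comm c (star c)]
      abel
    · intro μ hμ
      rw [spectrum.mem_iff, Matrix.isUnit_iff_isUnit_det, isUnit_iff_ne_zero, not_not,
        Algebra.algebraMap_eq_smul_one] at hμ
      have e3 : (ρ x - (μ + c) • (1 : Matrix n n ℂ)).det = 0 := by
        have e4 : ρ' x - (μ + c) • (1 : Matrix n n ℂ) = B * (ρ x - (μ + c) • (1 : Matrix n n ℂ)) * B⁻¹ := by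
          rw [hρ', mul_sub, sub_mul, mul_smul_comm, smul_mul_assoc, mul_one, e1]
        have e5 : (ρ' x - (μ + c) • (1 : Matrix n n ℂ)).det = 0 := by
          have : ρ' x - (μ + c) • (1 : Matrix n n ℂ) = - (μ • (1 : Matrix n n ℂ) - (ρ' x - c • 1)) := by
            rw [add_smul]; abel
          rw [this, Matrix.det_neg, hμ, mul_zero]
        rw [e4, det_mul, det_mul, mul_right_comm, ← det_mul, e1, det_one, one_mul] at e5
        exact e5
      obtain ⟨j, haj, hjb, hj⟩ := hx _ e3
      have := arc_bound N a b j hN h6 haj hjb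
      rw [← hj, ← hc, add_sub_cancel_right] at this
      exact_mod_cast this

end Unitarize

section Lift
open Matrix

variable {n : Type*} [Fintype n] [DecidableEq n] {R : Type*} [CommRing R] [IsDomain R]
  {Γ : Type*} [Group Γ] [Fintype Γ]

lemma lift_step (ϖ u : R) (h0 : ϖ ≠ 0) (hu : u * (Fintype.card Γ : R) = 1) (j : ℕ) (hj : 1 ≤ j)
    (f : Γ → Matrix n n R)
    (hf : ∀ g h, ∃ C, f g * f h = f (g * h) + ϖ ^ j • C) (h1 : ∃ C, f 1 = 1 + ϖ • C) :
    ∃ f' : Γ → Matrix n n R, (∀ g, ∃ C, f' g = f g + ϖ ^ j • C) ∧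
      (∀ g h, ∃ C, f' g * f' h = f' (g * h) + ϖ ^ (j + 1) • C) ∧ (∃ C, f' 1 = 1 + ϖ • C) := by
  choose c hc using hf
  obtain ⟨C1, hC1⟩ := h1
  obtain ⟨i, rfl⟩ : ∃ i, j = i + 1 := ⟨j - 1, by omega⟩
  have hcoc : ∀ g h k, f g * c h k - c (g * h) k + c g (h * k) - c g h * f k = 0 := by
    intro g h k
    have e : ϖ ^ (i+1) • (f g * c h k - c (g * h) k + c g (h * k) - c g h * f k) = 0 := by
      have e1 : ∀ a b, ϖ ^ (i+1) • c a b = f a * f b - f (a * b) := fun a b => by rw [hc]; abel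
      rw [smul_sub, smul_add, smul_sub, ← mul_smul_comm, ← smul_mul_assoc, e1, e1, e1, e1,
        mul_assoc g h k]
      noncomm_ring
    exact (smul_eq_zero.1 e).resolve_left (pow_ne_zero _ h0)
  let A : Γ → Matrix n n R := fun g => u • ∑ k, c g k * f k⁻¹
  have hA : ∀ g h, ∃ C, f g * A h - A (g * h) + A g * f h = c g h + ϖ • C := by
    intro g h
    refine ⟨u • ∑ k, (c g (h * k) * (ϖ ^ i • c (h * k)⁻¹ h)) + u • ∑ k, c g h * (C1 + ϖ ^ i • c k k⁻¹), ?_⟩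
    have s0 : ∀ k, f g * (c h k * f k⁻¹) - c (g * h) k * f k⁻¹ + c g (h * k) * f k⁻¹ - c g h * (f k * f k⁻¹) = 0 := by
      intro k
      have := congrArg (· * f k⁻¹) (hcoc g h k)
      simp only [zero_mul] at this
      rw [← this]; noncomm_ring
    have s1 : ∀ k, c g (h * k) * f k⁻¹ = c g (h * k) * f (h * k)⁻¹ * f h - ϖ • (c g (h * k) * (ϖ ^ i • c (h * k)⁻¹ h)) := by
      intro k
      have := hc (h * k)⁻¹ h
      rw [show (h * k)⁻¹ * h = k⁻¹ by group] at this
      rw [mul_assoc, this, mul_add, mul_smul_comm, mul_smul_comm, smul_smul, pow_succ']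
      abel
    have s2 : ∀ k, c g h * (f k * f k⁻¹) = c g h + ϖ • (c g h * (C1 + ϖ ^ i • c k k⁻¹)) := by
      intro k
      rw [hc, mul_inv_cancel, hC1]
      simp only [mul_add, mul_one, mul_smul_comm, smul_add, smul_smul, pow_succ', add_assoc]
    have s3 : ∑ k, c g (h * k) * f (h * k)⁻¹ * f h = (∑ k, c g k * f k⁻¹) * f h := by
      rw [Finset.sum_mul]
      exact Fintype.sum_equiv (Equiv.mulLeft h) _ _ fun k => rfl
    have s4 : ∑ k : Γ, c g h = (Fintype.card Γ : R) • c g h := by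
      rw [Finset.sum_const, Finset.card_univ, Nat.cast_smul_eq_nsmul]
    have S := Finset.sum_congr (rfl : (Finset.univ : Finset Γ) = Finset.univ) fun k _ => s0 k
    simp only [s1, s2, Finset.sum_sub_distrib, Finset.sum_add_distrib, Finset.sum_const_zero, s3, s4,
      ← Finset.smul_sum, ← Finset.mul_sum] at S
    have S' := congrArg (u • ·) S
    simp only [smul_sub, smul_add, smul_zero, smul_smul, hu, one_smul] at S'
    simp only [A]
    rw [← sub_eq_zero, ← S']
    simp only [mul_smul_comm, smul_mul_assoc, smul_add, smul_smul, Finset.mul_sum, Finset.smul_sum,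
      Finset.sum_mul, mul_add, Finset.sum_add_distrib, mul_comm u ϖ, mul_assoc, mul_left_comm u ϖ]
    abel
  choose E hE using hA
  refine ⟨fun g => f g - ϖ ^ (i+1) • A g, fun g => ⟨- A g, by rw [smul_neg]; abel⟩, fun g h => ?_,
    ⟨C1 - ϖ ^ i • A 1, ?_⟩⟩
  · refine ⟨ϖ ^ i • (A g * A h) - E g h, ?_⟩
    have e2 : c g h = f g * A h - A (g * h) + A g * f h - ϖ • E g h := by rw [hE]; abel
    have e3 : (f g - ϖ ^ (i+1) • A g) * (f h - ϖ ^ (i+1) • A h) =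
        f g * f h - ϖ ^ (i+1) • (f g * A h) - ϖ ^ (i+1) • (A g * f h) + (ϖ ^ (i+1) * ϖ ^ (i+1)) • (A g * A h) := by
      simp only [sub_mul, mul_sub, smul_mul_assoc, mul_smul_comm, smul_smul, smul_sub]
      abel
    rw [e3, hc, e2]
    simp only [smul_sub, smul_add, smul_smul]
    rw [show ϖ ^ (i + 1) * ϖ = ϖ ^ (i + 1 + 1) by ring, show ϖ ^ (i + 1) * ϖ ^ (i + 1) = ϖ ^ (i + 1 + 1) * ϖ ^ i by ring]
    abel
  · simp only [hC1, smul_sub, smul_smul, pow_succ']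
    abel

lemma lift_hom (ϖ u : R) (h0 : ϖ ≠ 0) (hu : u * (Fintype.card Γ : R) = 1)
    [IsAdicComplete (Ideal.span {ϖ}) R]
    {k : Type*} [Field k] (φ : R →+* k) (hφ : Function.Surjective φ)
    (hker : RingHom.ker φ = Ideal.span {ϖ}) (ρ : Γ →* Matrix n n k) :
    ∃ σ : Γ →* Matrix n n R, ∀ g, (σ g).map φ = ρ g := by
  have hdvd : ∀ (j : ℕ) (A B : Matrix n n R), (∀ a b, ϖ ^ j ∣ A a b - B a b) → ∃ C, A = B + ϖ ^ j • C := by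
    intro j A B h
    choose C hC using h
    refine ⟨Matrix.of C, ?_⟩
    ext a b
    simp only [Matrix.add_apply, Matrix.smul_apply, Matrix.of_apply, smul_eq_mul, ← hC]; ring
  have hzero : ∀ x, φ x = 0 → ϖ ∣ x := fun x hx => by
    rw [← Ideal.mem_span_singleton, ← hker]; exact hx
  have hϖ : φ ϖ = 0 := by
    have : ϖ ∈ RingHom.ker φ := by rw [hker]; exact Ideal.mem_span_singleton_self _
    exact this
  -- initial lift
  choose s hs using hφ
  let f0 : Γ → Matrix n n R := fun g => (ρ g).map s
  have hf0 : ∀ g, (f0 g).map φ = ρ g := fun g => by ext a b; simp [f0, hs]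
  let P : ℕ → (Γ → Matrix n n R) → Prop := fun j f =>
    (∀ g h, ∃ C, f g * f h = f (g * h) + ϖ ^ (j+1) • C) ∧ (∃ C, f 1 = 1 + ϖ • C)
  have hP0 : P 0 f0 := by
    constructor
    · intro g h
      refine hdvd 1 _ _ fun a b => ?_
      rw [pow_one]
      apply hzero
      have e1 : (f0 g * f0 h).map φ = (f0 (g * h)).map φ := by
        rw [Matrix.map_mul, hf0, hf0, hf0, map_mul]
      have := congrFun (congrFun e1 a) b
      simp only [Matrix.map_apply] at this
      rw [map_sub, this, sub_self]
    · have := hdvd 1 (f0 1) 1 fun a b => by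
        rw [pow_one]; apply hzero
        have e1 : (f0 1).map φ = (1 : Matrix n n R).map φ := by
          rw [hf0, map_one]; ext a b; simp [Matrix.one_apply, apply_ite φ]
        have := congrFun (congrFun e1 a) b
        simp only [Matrix.map_apply] at this
        rw [map_sub, this, sub_self]
      simpa using this
  have hstep : ∀ j (f : {f // P j f}), ∃ f' : {f // P (j+1) f}, ∀ g, ∃ C, f'.1 g = f.1 g + ϖ ^ (j+1) • C := by
    rintro j ⟨f, hf, hf1⟩
    obtain ⟨f', ha, hb, hc⟩ := lift_step ϖ u h0 hu (j+1) (by omega) f hf hf1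
    exact ⟨⟨f', hb, hc⟩, ha⟩
  choose nxt hnxt using hstep
  let seq : ∀ j, {f // P j f} := fun j => Nat.rec ⟨f0, hP0⟩ (fun j f => nxt j f) j
  have hseq : ∀ j g, ∃ C, (seq (j+1)).1 g = (seq j).1 g + ϖ ^ (j+1) • C := fun j g => hnxt j (seq j) g
  have hcauchy : ∀ i j g, ∃ C, (seq (i + j)).1 g = (seq i).1 g + ϖ ^ (i+1) • C := by
    intro i j g
    induction j with
    | zero => exact ⟨0, by simp⟩
    | succ j ih =>
      obtain ⟨C, hC⟩ := ih
      obtain ⟨C', hC'⟩ := hseq (i + j) g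
      refine ⟨C + ϖ ^ j • C', ?_⟩
      rw [← add_assoc, hC', hC, smul_add, smul_smul, ← pow_add, add_assoc]
      congr 4; omega
  have hlim : ∀ g a b, ∃ L : R, ∀ j, ϖ ^ j ∣ (seq j).1 g a b - L := by
    intro g a b
    obtain ⟨L, hL⟩ := IsPrecomplete.prec (I := Ideal.span {ϖ}) (M := R) inferInstance (f := fun j => (seq j).1 g a b) (by
      intro i j hij
      obtain ⟨l, rfl⟩ := Nat.exists_eq_add_of_le hij
      obtain ⟨C, hC⟩ := hcauchy i l g
      rw [SModEq.sub_mem, smul_eq_mul, Ideal.mul_top, Ideal.span_singleton_pow, Ideal.mem_span_singleton, hC]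
      simp only [Matrix.add_apply, Matrix.smul_apply, smul_eq_mul, sub_add_cancel_left]
      exact (dvd_neg).2 (Dvd.dvd.mul_right (pow_dvd_pow _ (by omega)) _))
    refine ⟨L, fun j => ?_⟩
    have := hL j
    rwa [SModEq.sub_mem, smul_eq_mul, Ideal.mul_top, Ideal.span_singleton_pow, Ideal.mem_span_singleton] at this
  choose L hL using hlim
  let σ : Γ → Matrix n n R := fun g => Matrix.of (L g)
  have hσ : ∀ j g, ∃ C, σ g = (seq j).1 g + ϖ ^ j • C := fun j g => hdvd j _ _ fun a b => by
    rw [← dvd_neg, neg_sub]; exact hL g a b j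
  have hext : ∀ A B : Matrix n n R, (∀ j, ∃ C, A = B + ϖ ^ j • C) → A = B := by
    intro A B h
    ext a b
    rw [← sub_eq_zero]
    refine IsHausdorff.haus (I := Ideal.span {ϖ}) (M := R) inferInstance _ fun j => ?_
    obtain ⟨C, hC⟩ := h j
    rw [SModEq.zero, smul_eq_mul, Ideal.mul_top, Ideal.span_singleton_pow, Ideal.mem_span_singleton, hC]
    simp
  have hmul : ∀ g h, σ g * σ h = σ (g * h) := by
    intro g h
    refine hext _ _ fun j => ?_
    obtain ⟨C1, h1⟩ := hσ j g
    obtain ⟨C2, h2⟩ := hσ j h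
    obtain ⟨C3, h3⟩ := hσ j (g * h)
    obtain ⟨C4, h4⟩ := (seq j).2.1 g h
    refine ⟨(seq j).1 g * C2 + C1 * (seq j).1 h + ϖ ^ j • (C1 * C2) + ϖ • C4 - C3, ?_⟩
    rw [h1, h2, h3]
    have e : ((seq j).1 g + ϖ ^ j • C1) * ((seq j).1 h + ϖ ^ j • C2) = (seq j).1 g * (seq j).1 h
      + ϖ ^ j • ((seq j).1 g * C2 + C1 * (seq j).1 h + ϖ ^ j • (C1 * C2)) := by
      simp only [add_mul, mul_add, smul_mul_assoc, mul_smul_comm, smul_add]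
      abel
    rw [e, h4]
    simp only [smul_sub, smul_add, smul_smul, pow_succ]
    abel
  have hred : ∀ g, (σ g).map φ = ρ g := by
    intro g
    have e0 : ∀ j, ((seq j).1 g).map φ = ρ g := by
      intro j
      induction j with
      | zero => exact hf0 g
      | succ j ih =>
        obtain ⟨C, hC⟩ := hseq j g
        rw [hC, ← ih]; ext a b; simp [hϖ]
    obtain ⟨C, hC⟩ := hσ 1 g
    rw [hC, ← e0 1]; ext a b; simp [hϖ]
  have hone : σ 1 = 1 := by
    have hE : σ 1 * σ 1 = σ 1 := by rw [hmul, mul_one]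
    have hd : IsUnit (σ 1).det := by
      have e1 : φ (σ 1).det = 1 := by
        have := RingHom.map_det φ (σ 1)
        rw [this, RingHom.mapMatrix_apply, hred, map_one, det_one]
      have e2 : ϖ ∣ (σ 1).det - 1 := hzero _ (by rw [map_sub, e1, map_one, sub_self])
      have e3 : (σ 1).det - 1 ∈ Ideal.jacobson (⊥ : Ideal R) :=
        IsAdicComplete.le_jacobson_bot (Ideal.span {ϖ}) (Ideal.mem_span_singleton.2 e2)
      have e4 := Ideal.mem_jacobson_bot.1 e3 1
      simpa using e4
    have hU : IsUnit (σ 1) := (Matrix.isUnit_iff_isUnit_det _).2 hd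
    exact hU.mul_left_cancel (by rw [hE, mul_one])
  exact ⟨{ toFun := σ, map_one' := hone, map_mul' := fun g h => (hmul g h).symm }, hred⟩

end Lift

section Emb
open Matrix Cardinal

variable (p : ℕ) [hp : Fact p.Prime]

local notation "kk" => AlgebraicClosure (ZMod p)

lemma map_sub_smul_one {R S ι : Type*} [CommRing R] [CommRing S] [Fintype ι] [DecidableEq ι] (f : R →+* S) (A : Matrix ι ι R) (m : R) :
    f.mapMatrix (A - m • (1 : Matrix ι ι R)) = A.map f - f m • (1 : Matrix ι ι S) := by
  rw [map_sub]
  congr 1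
  ext a b
  simp [Matrix.one_apply, apply_ite f]

lemma witt_p_ne_zero : ((p : ℕ) : WittVector p kk) ≠ 0 := by
  intro h
  have := WittVector.eq_zero_of_p_mul_eq_zero (p := p) (k := kk) 1 (by rw [one_mul, h])
  exact one_ne_zero this

lemma witt_charZero : CharZero (WittVector p kk) := by
  rcases CharP.exists (WittVector p kk) with ⟨ℓ, hℓ⟩
  rcases CharP.char_is_prime_or_zero (WittVector p kk) ℓ with h | h
  · exfalso
    have h1 : ((ℓ : ℕ) : WittVector p kk) = 0 := CharP.cast_eq_zero _ _
    have h2 : ((ℓ : ℕ) : kk) = 0 := by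
      have := congrArg (WittVector.constantCoeff (p := p) (R := kk)) h1
      rw [map_natCast, map_zero] at this
      exact this
    rw [CharP.cast_eq_zero_iff kk p] at h2
    have h3 := (Nat.prime_dvd_prime_iff_eq hp.out h).1 h2
    rw [← h3] at h1
    exact witt_p_ne_zero p h1
  · subst h
    exact CharP.charP_to_charZero _

lemma witt_card : #(WittVector p kk) = 𝔠 := by
  have hk : #kk = ℵ₀ := by
    apply le_antisymm
    · have := Algebra.IsAlgebraic.cardinalMk_le_max (ZMod p) kk
      refine this.trans ?_
      simp
    · have : Infinite kk := IsAlgClosed.instInfinite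
      exact Cardinal.aleph0_le_mk _
  have e : WittVector p kk ≃ (ℕ → kk) :=
    ⟨fun x => x.coeff, fun f => WittVector.mk p f, fun x => by ext; simp, fun f => by ext; simp⟩
  rw [Cardinal.mk_congr e]
  simp [hk]

lemma witt_emb : ∃ σ : WittVector p kk →+* ℂ, Function.Injective σ := by
  have := witt_charZero p
  let Q := FractionRing (WittVector p kk)
  have : CharZero Q := charZero_of_injective_algebraMap (IsFractionRing.injective (WittVector p kk) Q)
  let A := AlgebraicClosure Q
  have : CharZero A := charZero_of_injective_algebraMap (algebraMap Q A).injective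
  have hinj : Function.Injective (algebraMap Q A |>.comp (algebraMap (WittVector p kk) Q)) :=
    (algebraMap Q A).injective.comp (IsFractionRing.injective _ _)
  have hA : #A = 𝔠 := by
    apply le_antisymm
    · have h1 := Algebra.IsAlgebraic.cardinalMk_le_max Q A
      have h2 : #Q ≤ 𝔠 := by
        rw [← witt_card p]
        exact (IsLocalization.cardinalMk_le (L := Q) (nonZeroDivisors (WittVector p kk)))
      exact h1.trans (max_le h2 aleph0_le_continuum)
    · rw [← witt_card p]
      exact Cardinal.mk_le_of_injective hinj
  have hc : #ℂ = 𝔠 := by simp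
  obtain ⟨e⟩ := IsAlgClosed.ringEquiv_of_equiv_of_charZero (K := A) (L := ℂ)
    (by rw [hA]; exact aleph0_lt_continuum) (Cardinal.eq.1 (hA.trans hc.symm))
  exact ⟨(e : A →+* ℂ).comp ((algebraMap Q A).comp (algebraMap (WittVector p kk) Q)),
    e.injective.comp hinj⟩

theorem thmT (N : ℕ) (hN : 0 < N) (hpN : ¬ p ∣ N) :
    ∃ ζ : kk, IsPrimitiveRoot ζ N ∧
    ∀ (ι : Type*) [Fintype ι] [DecidableEq ι] (F : Type*) [Field F] [Finite F] (φ : F →+* kk)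
      (S : Subgroup (GL ι F)) (_ : ¬ p ∣ Nat.card S) (x : GL ι F) (_ : x ∈ S) (a b : ℕ)
      (_ : 6 * (b - a) ≤ N) (_ : x ^ N = 1)
      (_ : ∀ μ : kk, ((x : Matrix ι ι F).map φ - μ • (1 : Matrix ι ι kk)).det = 0 →
        ∃ j, a ≤ j ∧ j ≤ b ∧ μ = ζ ^ j) (h : GL ι F) (_ : h ∈ S),
      Commute x (h * x * h⁻¹) := by
  obtain ⟨σ, hσ⟩ := witt_emb p
  have hNk : (N : kk) ≠ 0 := by rwa [Ne, CharP.cast_eq_zero_iff kk p]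
  have : NeZero (N : kk) := ⟨hNk⟩
  obtain ⟨η, hη⟩ := HasEnoughRootsOfUnity.exists_primitiveRoot kk N
  set τ : WittVector p kk := WittVector.teichmuller p η with hτ
  have hτ0 : WittVector.constantCoeff τ = η := by
    simp [hτ, WittVector.constantCoeff]
  have hτp : IsPrimitiveRoot τ N := by
    refine ⟨by rw [hτ, ← map_pow, hη.pow_eq_one, map_one], fun l hl => ?_⟩
    apply hη.dvd_of_pow_eq_one
    rw [← hτ0, ← map_pow, hl, map_one]
  have hστ : IsPrimitiveRoot (σ τ) N := hτp.map_of_injective hσ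
  set e := Complex.exp (2 * Real.pi * Complex.I / N) with he
  have hep : IsPrimitiveRoot e N := Complex.isPrimitiveRoot_exp N hN.ne'
  have : NeZero N := ⟨hN.ne'⟩
  obtain ⟨i, -, hi⟩ := hστ.eq_pow_of_pow_eq_one hep.pow_eq_one
  have hζ : IsPrimitiveRoot (η ^ i) N := by
    refine ⟨by rw [← pow_mul, mul_comm, pow_mul, hη.pow_eq_one, one_pow], fun l hl => ?_⟩
    apply hep.dvd_of_pow_eq_one
    rw [← pow_mul] at hl
    rw [← hi, ← pow_mul, ← map_pow]
    obtain ⟨m, hm⟩ := hη.dvd_of_pow_eq_one _ hl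
    rw [hm, pow_mul, hτp.pow_eq_one, one_pow, map_one]
  refine ⟨η ^ i, hζ, ?_⟩
  intro ι _ _ F _ _ φ S hS x hxS a b h6 hxN hx h hhS
  have : Fintype S := Fintype.ofFinite S
  -- lift
  let ρ : S →* Matrix ι ι kk := (RingHom.toMonoidHom (φ.mapMatrix : Matrix ι ι F →+* Matrix ι ι kk)).comp ((Units.coeHom _).comp S.subtype)
  have hρ : ∀ g : S, ρ g = ((g : GL ι F) : Matrix ι ι F).map φ := fun g => rfl
  have hcard : ¬ p ∣ Fintype.card S := by rwa [← Nat.card_eq_fintype_card]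
  have hcu : ∃ u : WittVector p kk, u * (Fintype.card S : WittVector p kk) = 1 := by
    have h1 : IsUnit ((Fintype.card S : ℕ) : WittVector p kk) := by
      apply WittVector.isUnit_of_coeff_zero_ne_zero
      have h0 : (WittVector.constantCoeff (p := p) (R := kk)) ((Fintype.card S : ℕ) : WittVector p kk) = ((Fintype.card S : ℕ) : kk) := map_natCast _ _
      change (WittVector.constantCoeff (p := p) (R := kk)) ((Fintype.card S : ℕ) : WittVector p kk) ≠ 0
      rwa [h0, Ne, CharP.cast_eq_zero_iff kk p]
    obtain ⟨u, hu⟩ := h1.exists_left_inv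
    exact ⟨u, hu⟩
  obtain ⟨u, hu⟩ := hcu
  obtain ⟨ρ', hρ'⟩ := lift_hom (Γ := S) ((p : ℕ) : WittVector p kk) u (witt_p_ne_zero p) hu
    (WittVector.constantCoeff (p := p) (R := kk)) (WittVector.constantCoeff_surjective p)
    WittVector.ker_constantCoeff ρ
  let ρ'' : S →* Matrix ι ι ℂ := (RingHom.toMonoidHom (σ.mapMatrix : Matrix ι ι (WittVector p kk) →+* Matrix ι ι ℂ)).comp ρ'
  have hρ'' : ∀ g, ρ'' g = (ρ' g).map σ := fun g => rfl
  have hinj : Function.Injective ρ'' := by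
    intro g g' hg
    have h1 : ρ' g = ρ' g' := by
      rw [hρ'', hρ''] at hg
      ext a b
      exact congrArg WittVector.coeff (hσ (congrFun (congrFun hg a) b)) |> fun h => congrFun h _
    have h2 : ρ g = ρ g' := by rw [← hρ', ← hρ', h1]
    rw [hρ, hρ] at h2
    apply Subtype.ext
    apply Units.ext
    ext a b
    exact φ.injective (congrFun (congrFun h2 a) b)
  have key := frob_complex ρ'' hinj ⟨x, hxS⟩ N a b hN h6 ?_ ⟨h, hhS⟩
  · have := congrArg Subtype.val key.eq
    exact this
  · intro μ hμ
    have hxN' : ρ'' ⟨x, hxS⟩ ^ N = 1 := by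
      rw [← map_pow]
      have : (⟨x, hxS⟩ : S) ^ N = 1 := Subtype.ext hxN
      rw [this, map_one]
    have hμN : μ ^ N = 1 := by
      obtain ⟨v, hv0, hv⟩ := Matrix.exists_mulVec_eq_zero_iff.2 hμ
      rw [Matrix.sub_mulVec, Matrix.smul_mulVec, Matrix.one_mulVec, sub_eq_zero] at hv
      have h1 : ∀ m : ℕ, (ρ'' ⟨x, hxS⟩ ^ m) *ᵥ v = μ ^ m • v := by
        intro m
        induction m with
        | zero => simp
        | succ m ih => rw [pow_succ, ← Matrix.mulVec_mulVec, hv, Matrix.mulVec_smul, ih, smul_smul, pow_succ']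
      have h2 := h1 N
      rw [hxN', Matrix.one_mulVec] at h2
      have h3 : (μ ^ N - 1) • v = 0 := by rw [sub_smul, ← h2, one_smul, sub_self]
      exact sub_eq_zero.1 ((smul_eq_zero.1 h3).resolve_right hv0)
    obtain ⟨l, -, hl⟩ := hep.eq_pow_of_pow_eq_one hμN
    have h4 : (ρ' ⟨x, hxS⟩ - (τ ^ i) ^ l • (1 : Matrix ι ι (WittVector p kk))).det = 0 := by
      apply hσ
      rw [RingHom.map_det, map_zero, ← hμ, ← hl, ← hi]
      congr 1
      ext a b
      simp [hρ'', Matrix.one_apply, apply_ite σ]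
    have h5 := congrArg (WittVector.constantCoeff (p := p) (R := kk)) h4
    rw [RingHom.map_det, map_zero] at h5
    obtain ⟨j, haj, hjb, hj⟩ := hx ((η ^ i) ^ l) (by
      rw [← h5]
      congr 1
      have := hρ' ⟨x, hxS⟩
      rw [hρ] at this
      rw [← this, ← hτ0, ← map_pow, ← map_pow]
      exact (map_sub_smul_one _ _ _).symm)
    refine ⟨j, haj, hjb, ?_⟩
    rw [← hl]
    have prim_mod : ∀ {R : Type _} [CommRing R] [IsDomain R] (y : R), IsPrimitiveRoot y N → ∀ a b : ℕ, y ^ a = y ^ b ↔ a ≡ b [MOD N] := by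
      intro R _ _ y hy a b
      rw [hy.eq_orderOf]
      exact IsOfFinOrder.pow_eq_pow_iff_modEq (isOfFinOrder_iff_pow_eq_one.2 ⟨N, hN, hy.pow_eq_one⟩)
    rw [prim_mod _ hep]
    exact (prim_mod _ hζ _ _).1 hj
end Emb

section LemZ
set_option linter.unusedSectionVars false
open Module Matrix

variable {K V G : Type*} [Field K] [IsAlgClosed K] [AddCommGroup V] [Module K V]
  [FiniteDimensional K V] [Group G]

/-- `v` is a joint eigenvector for the conjugates of `x` with eigenvalue function `χ`. -/
def JE (ρ : G →* End K V) (x : G) (χ : G → K) (v : V) : Prop :=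
  ∀ l, ρ (l * x * l⁻¹) v = χ l • v

lemma JE.act {ρ : G →* End K V} {x : G} {χ : G → K} {v : V} (h : JE ρ x χ v) (m : G) :
    JE ρ x (fun l => χ (m⁻¹ * l)) (ρ m v) := by
  intro l
  have h1 := h (m⁻¹ * l)
  have h2 : l * x * l⁻¹ * m = m * (m⁻¹ * l * x * (m⁻¹ * l)⁻¹) := by group
  rw [← Module.End.mul_apply, ← map_mul, h2, map_mul, Module.End.mul_apply, h1, map_smul]

lemma lemZ_core (ρ : G →* End K V) (x : G) (N : ℕ) (hN : (N : K) ≠ 0) (hx : x ^ N = 1)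
    (hc : ∀ s : G, Commute x (s * x * s⁻¹)) (I J W z : G)
    (hI : I * I = z) (hzz : z * z = 1) (hW : W * W * W = 1) (hWz : W * z = z * W)
    (hWI : W * I = J * W) (hWJ : W * J = I * J * W)
    (hlin : ∀ v, v + ρ z v = ρ I v + ρ I (ρ z v))
    (e₁ e₂ : V) (hU : ∀ v, ρ z v = -v → ∃ a b : K, v = a • e₁ + b • e₂) :
    ρ x * ρ I = ρ I * ρ x ∧ ρ x * ρ J = ρ J * ρ x := by
  set f : G → End K V := fun l => ρ (l * x * l⁻¹) with hf
  have hfN : ∀ l, f l ^ N = 1 := by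
    intro l
    rw [hf]
    simp only
    rw [← map_pow, conj_pow, hx, mul_one, mul_inv_cancel, map_one]
  have hfc : ∀ i j, Commute (f i) (f j) := by
    intro i j
    have h1 := hc (i⁻¹ * j)
    have h2 : Commute (i * x * i⁻¹) (j * x * j⁻¹) := by
      have h3 := h1.map (MulAut.conj i).toMonoidHom
      have h4 : i * (i⁻¹ * j * x * (i⁻¹ * j)⁻¹) * i⁻¹ = j * x * j⁻¹ := by group
      simp only [MulEquiv.toMonoidHom_eq_coe, MonoidHom.coe_coe, MulAut.conj_apply] at h3
      rwa [h4] at h3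
    exact h2.map ρ
  have hind := jd_indep N hN f hfN hfc
  have hdis : ∀ χ v, JE ρ x χ v → (v ∈ ⨆ (j : G → K) (_ : j ≠ χ), ⨅ i, (f i).eigenspace (j i)) →
      v = 0 := by
    intro χ v h1 h2
    have h3 : v ∈ ⨅ i, (f i).eigenspace (χ i) := by
      rw [Submodule.mem_iInf]
      intro i
      rw [End.mem_eigenspace_iff]
      exact h1 i
    exact (Submodule.disjoint_def.1 (hind χ)) v h3 h2
  have hmem : ∀ χ χ' v, JE ρ x χ' v → χ' ≠ χ →
      v ∈ ⨆ (j : G → K) (_ : j ≠ χ), ⨅ i, (f i).eigenspace (j i) := by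
    intro χ χ' v h1 h2
    have h3 : v ∈ ⨅ i, (f i).eigenspace (χ' i) := by
      rw [Submodule.mem_iInf]
      intro i
      rw [End.mem_eigenspace_iff]
      exact h1 i
    exact Submodule.mem_iSup_of_mem χ' (Submodule.mem_iSup_of_mem h2 h3)
  let sh : G → (G → K) → (G → K) := fun m χ l => χ (m⁻¹ * l)
  have sh_mul : ∀ m m' χ, sh (m * m') χ = sh m (sh m' χ) := by
    intro m m' χ
    funext l
    simp [sh, mul_assoc]
  have sh_one : ∀ χ, sh 1 χ = χ := by
    intro χ
    funext l
    simp [sh]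
  have act : ∀ m χ v, JE ρ x χ v → JE ρ x (sh m χ) (ρ m v) := fun m χ v h => h.act m
  have hne : ∀ m v, v ≠ 0 → ρ m v ≠ 0 := by
    intro m v hv h
    apply hv
    have : ρ m⁻¹ (ρ m v) = v := by
      rw [← Module.End.mul_apply, ← map_mul, inv_mul_cancel, map_one, Module.End.one_apply]
    rw [← this, h, map_zero]
  have hI4 : I * (I * (I * I)) = 1 := by
    rw [← mul_assoc, hI, hzz]
  -- main claim
  have hIχ : ∀ χ v, v ≠ 0 → JE ρ x χ v → sh I χ = χ := by
    intro χ v hv hχ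
    by_contra hIne
    have hzχ : sh z χ = χ := by
      by_contra hz
      apply hv
      apply hdis χ v hχ
      have h1 : v = -ρ z v + ρ I v + ρ I (ρ z v) := by
        have := hlin v
        rw [add_assoc, ← this]; abel
      rw [h1]
      refine Submodule.add_mem _ (Submodule.add_mem _ (Submodule.neg_mem _ ?_) ?_) ?_
      · exact hmem _ _ _ (act z _ _ hχ) hz
      · exact hmem _ _ _ (act I _ _ hχ) hIne
      · refine hmem _ _ _ (act I _ _ (act z _ _ hχ)) ?_
        intro h
        rw [← hI, ← sh_mul] at h
        apply hIne
        calc sh I χ = sh I (sh (I * (I * I)) χ) := by rw [h]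
          _ = χ := by rw [← sh_mul, hI4, sh_one]
    have hIIχ : sh I (sh I χ) = χ := by rw [← sh_mul, hI, hzχ]
    have h0 : v + ρ z v = 0 := by
      refine hdis χ _ ?_ ?_
      · intro l
        have h1 := hχ l
        have h2 := (act z _ _ hχ) l
        rw [hzχ] at h2
        rw [map_add, h1, h2, smul_add]
      · rw [hlin v]
        refine Submodule.add_mem _ ?_ ?_
        · exact hmem _ _ _ (act I _ _ hχ) hIne
        · refine hmem _ _ _ (act I _ _ (act z _ _ hχ)) ?_
          rwa [hzχ]
    have hzv : ρ z v = -v := by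
      rw [add_comm] at h0; exact eq_neg_of_add_eq_zero_left h0
    have zI : z * I = I * z := by rw [← hI, mul_assoc]
    have hzIv : ρ z (ρ I v) = -(ρ I v) := by
      rw [← Module.End.mul_apply, ← map_mul, zI, map_mul, Module.End.mul_apply, hzv, map_neg]
    -- span
    obtain ⟨a, b, hab⟩ := hU v hzv
    obtain ⟨c, d, hcd⟩ := hU _ hzIv
    have hdet : a * d - b * c ≠ 0 := by
      intro h
      have h1 : d • v = b • ρ I v := by
        rw [hcd, hab]
        simp only [smul_add, smul_smul]
        congr 1
        · congr 1; linear_combination h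
        · congr 1; ring
      have h2 : c • v = a • ρ I v := by
        rw [hcd, hab]
        simp only [smul_add, smul_smul]
        congr 1
        · congr 1; ring
        · congr 1; linear_combination -h
      have h3 : d • v = 0 := by
        refine hdis χ _ (fun l => by rw [map_smul, hχ l, smul_comm]) ?_
        rw [h1]
        exact Submodule.smul_mem _ _ (hmem _ _ _ (act I _ _ hχ) hIne)
      have h4 : c • v = 0 := by
        refine hdis χ _ (fun l => by rw [map_smul, hχ l, smul_comm]) ?_
        rw [h2]
        exact Submodule.smul_mem _ _ (hmem _ _ _ (act I _ _ hχ) hIne)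
      have h5 : d = 0 := (smul_eq_zero.1 h3).resolve_right hv
      have h6 : c = 0 := (smul_eq_zero.1 h4).resolve_right hv
      apply hne I v hv
      rw [hcd, h5, h6, zero_smul, zero_smul, add_zero]
    have hspan : ∀ w, ρ z w = -w → ∃ s t : K, w = s • v + t • ρ I v := by
      intro w hw
      obtain ⟨s, t, hst⟩ := hU w hw
      refine ⟨(s * d - t * c) / (a * d - b * c), (t * a - s * b) / (a * d - b * c), ?_⟩
      have e1 : s = (s * d - t * c) / (a * d - b * c) * a + (t * a - s * b) / (a * d - b * c) * c := by
        rw [div_mul_eq_mul_div, div_mul_eq_mul_div, ← add_div, eq_div_iff hdet]; ring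
      have e2 : t = (s * d - t * c) / (a * d - b * c) * b + (t * a - s * b) / (a * d - b * c) * d := by
        rw [div_mul_eq_mul_div, div_mul_eq_mul_div, ← add_div, eq_div_iff hdet]; ring
      generalize (s * d - t * c) / (a * d - b * c) = X at *
      generalize (t * a - s * b) / (a * d - b * c) = Y at *
      rw [hcd, hst, e1, e2]
      conv_rhs => rw [hab]
      module
    have htwo : ∀ χ' w, w ≠ 0 → ρ z w = -w → JE ρ x χ' w → χ' = χ ∨ χ' = sh I χ := by
      intro χ' w hw hzw hχ'
      by_contra hcon
      push Not at hcon
      apply hw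
      apply hdis χ' w hχ'
      obtain ⟨s, t, hst⟩ := hspan w hzw
      rw [hst]
      exact Submodule.add_mem _ (Submodule.smul_mem _ _ (hmem _ _ _ hχ hcon.1.symm))
        (Submodule.smul_mem _ _ (hmem _ _ _ (act I _ _ hχ) hcon.2.symm))
    have hWneg : ∀ w, ρ z w = -w → ρ z (ρ W w) = -(ρ W w) := by
      intro w hw
      rw [← Module.End.mul_apply, ← map_mul, ← hWz, map_mul, Module.End.mul_apply, hw, map_neg]
    have sh_inj : ∀ m χ₁ χ₂, sh m χ₁ = sh m χ₂ → χ₁ = χ₂ := by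
      intro m χ₁ χ₂ h
      have := congrArg (sh m⁻¹) h
      rwa [← sh_mul, ← sh_mul, inv_mul_cancel, sh_one, sh_one] at this
    have hA := htwo _ _ (hne W v hv) (hWneg v hzv) (act W _ _ hχ)
    have hB := htwo _ _ (hne W _ (hne I v hv)) (hWneg _ hzIv) (act W _ _ (act I _ _ hχ))
    have hWW : sh W (sh W (sh W χ)) = χ := by rw [← sh_mul, ← sh_mul, ← mul_assoc, hW, sh_one]
    have hWχ : sh W χ = χ := by
      rcases hA with h | h
      · exact h
      · exfalso
        rcases hB with h' | h'
        · rw [h, h', h] at hWW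
          exact hIne hWW
        · rw [← h] at h'
          exact hIne (by rw [← h]; exact sh_inj W _ _ (by rw [h]; rw [h] at h'; exact h'))
    have hWIχ : sh W (sh I χ) = sh I χ := by
      rcases hB with h | h
      · exfalso
        rw [← hWχ] at h
        exact hIne (by rw [hWχ] at h; exact sh_inj W _ _ (h.trans hWχ.symm))
      · exact h
    have hJχ : sh J χ = sh I χ := by
      rw [← hWIχ, ← sh_mul, hWI, sh_mul, hWχ]
    have hIJ : sh (I * J) χ = sh I χ := by
      rw [← hWχ, ← sh_mul, ← hWJ, sh_mul, hJχ, hWIχ, hWχ]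
    rw [sh_mul, hJχ, hIIχ] at hIJ
    exact hIne hIJ.symm
  have hJχ : ∀ χ v, v ≠ 0 → JE ρ x χ v → sh J χ = χ := by
    intro χ v hv hχ
    have h1 := hIχ _ _ (hne W⁻¹ v hv) (act W⁻¹ _ _ hχ)
    have h2 : J = W * I * W⁻¹ := by rw [hWI, mul_inv_cancel_right]
    rw [h2, mul_assoc, sh_mul, sh_mul, h1, ← sh_mul, mul_inv_cancel, sh_one]
  have hcomm : ∀ m, (∀ χ v, v ≠ 0 → JE ρ x χ v → sh m χ = χ) → ρ x * ρ m = ρ m * ρ x := by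
    intro m hm
    apply jd_ext N hN f hfN hfc
    intro χ v hχ
    by_cases hv : v = 0
    · subst hv; simp
    have hχ' : JE ρ x χ v := hχ
    have h1 := act m _ _ hχ' 1
    rw [hm χ v hv hχ'] at h1
    have h2 := hχ' 1
    simp only [one_mul, inv_one, mul_one] at h1 h2
    rw [Module.End.mul_apply, Module.End.mul_apply, h1, h2, map_smul]
  exact ⟨hcomm I hIχ, hcomm J hJχ⟩
end LemZ

section PiGroup
open Matrix

variable {π : Set ℕ}

lemma IsPiNumber.mul {a b : ℕ} (ha : IsPiNumber π a) (hb : IsPiNumber π b) :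
    IsPiNumber π (a * b) := by
  intro p hp h
  rcases (Nat.Prime.dvd_mul hp).1 h with h | h
  · exact ha p hp h
  · exact hb p hp h

lemma IsPiNumber.of_dvd {a b : ℕ} (hb : IsPiNumber π b) (h : a ∣ b) : IsPiNumber π a :=
  fun p hp hpa => hb p hp (hpa.trans h)

lemma IsPiNumber.one : IsPiNumber π 1 := by
  intro p hp h
  exact absurd (Nat.dvd_one.1 h) hp.ne_one

lemma IsPiNumber.prime {p : ℕ} (hp : p.Prime) (h : p ∈ π) : IsPiNumber π p := by
  intro r hr h'
  rwa [(Nat.prime_dvd_prime_iff_eq hr hp).1 h']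

lemma IsPiNumber.pow {a : ℕ} (h : IsPiNumber π a) (k : ℕ) : IsPiNumber π (a ^ k) := by
  intro p hp h'
  exact h p hp (hp.dvd_of_dvd_pow h')

lemma piN_of_elts {G : Type*} [Group G] [Finite G] (K : Subgroup G)
    (h : ∀ x ∈ K, ∃ m, IsPiNumber π m ∧ x ^ m = 1) : IsPiNumber π (Nat.card K) := by
  intro r hr hd
  have : Fact r.Prime := ⟨hr⟩
  obtain ⟨x, hx⟩ := exists_prime_orderOf_dvd_card' (G := K) r hd
  obtain ⟨m, hm, hxm⟩ := h x x.2
  apply hm r hr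
  rw [← hx]
  exact orderOf_dvd_of_pow_eq_one (Subtype.ext hxm)

lemma piN_sup {G : Type*} [Group G] [Finite G] (A B : Subgroup G)
    (hAB : ∀ b ∈ B, ∀ a ∈ A, b * a * b⁻¹ ∈ A)
    (hA : IsPiNumber π (Nat.card A)) (hB : IsPiNumber π (Nat.card B)) :
    IsPiNumber π (Nat.card (A ⊔ B : Subgroup G)) := by
  have hle : B ≤ Subgroup.normalizer (A : Set G) := by
    intro b hb
    rw [Subgroup.mem_normalizer_iff]
    intro a
    refine ⟨hAB b hb a, fun h => ?_⟩
    have := hAB b⁻¹ (inv_mem hb) _ h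
    simpa [mul_assoc] using this
  apply piN_of_elts
  intro x hx
  have h1 : x ∈ ((A ⊔ B : Subgroup G) : Set G) := hx
  rw [Subgroup.coe_mul_of_right_le_normalizer_left _ _ hle] at h1
  obtain ⟨a, ha, b, hb, rfl⟩ := h1
  refine ⟨Nat.card B * Nat.card A, hB.mul hA, ?_⟩
  have key : ∀ k : ℕ, ∃ c ∈ A, (a * b) ^ k = c * b ^ k := by
    intro k
    induction k with
    | zero => exact ⟨1, one_mem _, by simp⟩
    | succ k ih =>
      obtain ⟨c, hc, h⟩ := ih
      refine ⟨c * (b ^ k * a * (b ^ k)⁻¹), mul_mem hc (hAB _ (pow_mem hb k) _ ha), ?_⟩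
      rw [pow_succ, h, pow_succ]
      group
  obtain ⟨c, hc, h⟩ := key (Nat.card B)
  have hbB : b ^ Nat.card B = 1 := by
    have := pow_card_eq_one' (x := (⟨b, hb⟩ : B))
    exact congrArg Subtype.val this
  have hcA : c ^ Nat.card A = 1 := by
    have := pow_card_eq_one' (x := (⟨c, hc⟩ : A))
    exact congrArg Subtype.val this
  show (a * b) ^ _ = 1
  rw [pow_mul, h, hbB, mul_one, hcA]

lemma piN_zpowers {G : Type*} [Group G] [Finite G] (x : G) (m : ℕ) (hm : IsPiNumber π m)
    (hx : x ^ m = 1) : IsPiNumber π (Nat.card (Subgroup.zpowers x)) := by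
  rw [Nat.card_zpowers]
  exact hm.of_dvd (orderOf_dvd_of_pow_eq_one hx)

/-- The properties of the group `S` used in the argument. -/
def Core (π : Set ℕ) {ι F : Type*} [Fintype ι] [DecidableEq ι] [Field F]
    (S : Subgroup (GL ι F)) : Prop :=
  IsPiNumber π (Nat.card S) ∧
  (∀ K : Subgroup (GL ι F), IsPiNumber π (Nat.card K) →
    (∀ k ∈ K, (k : Matrix ι ι F).det = 1) → ∃ g : GL ι F, ∀ k ∈ K, g * k * g⁻¹ ∈ S) ∧
  (∀ r ∈ π, r.Prime → ∀ K : Subgroup (GL ι F), IsPGroup r K →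
    ∃ g : GL ι F, ∀ k ∈ K, g * k * g⁻¹ ∈ S)

lemma Core.conj {ι F : Type*} [Fintype ι] [DecidableEq ι] [Field F]
    {S : Subgroup (GL ι F)} (h : Core π S) (t : GL ι F) :
    Core π (S.comap (MulAut.conj t).toMonoidHom) := by
  obtain ⟨h1, h2, h3⟩ := h
  have hm : ∀ y, y ∈ S.comap (MulAut.conj t).toMonoidHom ↔ t * y * t⁻¹ ∈ S := by
    intro y; simp [Subgroup.mem_comap]
  have hh : ∀ K : Subgroup (GL ι F), (∃ g : GL ι F, ∀ k ∈ K, g * k * g⁻¹ ∈ S) →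
      ∃ g : GL ι F, ∀ k ∈ K, g * k * g⁻¹ ∈ S.comap (MulAut.conj t).toMonoidHom := by
    rintro K ⟨g, hg⟩
    refine ⟨t⁻¹ * g, fun k hk => ?_⟩
    rw [hm]
    have := hg k hk
    have e : t * (t⁻¹ * g * k * (t⁻¹ * g)⁻¹) * t⁻¹ = g * k * g⁻¹ := by group
    rwa [e]
  refine ⟨?_, fun K a b => hh K (h2 K a b), fun r a b K c => hh K (h3 r a b K c)⟩
  have : Nat.card (S.comap (MulAut.conj t).toMonoidHom) = Nat.card S :=
    Nat.card_congr ((MulAut.conj t).toEquiv.subtypeEquiv (fun _ => Iff.rfl))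
  rw [this]
  exact h1

lemma Core.std {ι F : Type*} [Fintype ι] [DecidableEq ι] [Field F]
    {S : Subgroup (GL ι F)} (h : Core π S) (K : Subgroup (GL ι F))
    (hK : IsPiNumber π (Nat.card K)) (hd : ∀ k ∈ K, (k : Matrix ι ι F).det = 1) :
    ∃ S' : Subgroup (GL ι F), Core π S' ∧ K ≤ S' := by
  obtain ⟨g, hg⟩ := h.2.1 K hK hd
  refine ⟨_, h.conj g, fun k hk => ?_⟩
  simpa [Subgroup.mem_comap] using hg k hk
end PiGroup

section Emb2
set_option linter.unusedSimpArgs false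
set_option linter.unusedSectionVars false
open Matrix

lemma norm_ext {G : Type*} [Group G] [Finite G] (A : Subgroup G) (g : G)
    (h : ∀ a ∈ A, g * a * g⁻¹ ∈ A) : ∀ b ∈ Subgroup.zpowers g, ∀ a ∈ A, b * a * b⁻¹ ∈ A := by
  intro b hb
  rw [← mem_powers_iff_mem_zpowers] at hb
  obtain ⟨k, rfl⟩ := hb
  induction k with
  | zero => intro a ha; simpa using ha
  | succ k ih =>
    intro a ha
    have := h _ (ih a ha)
    simp only at this ⊢
    have e : g ^ (k + 1) * a * (g ^ (k + 1))⁻¹ = g * (g ^ k * a * (g ^ k)⁻¹) * g⁻¹ := by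
      rw [pow_succ']; group
    rwa [e]

lemma grp_two {π : Set ℕ} {G : Type*} [Group G] [Finite G] (x y : G) (m m' : ℕ)
    (hm : IsPiNumber π m) (hm' : IsPiNumber π m') (hx : x ^ m = 1) (hy : y ^ m' = 1)
    (hxy : y * x = x⁻¹ * y) :
    ∃ K : Subgroup G, IsPiNumber π (Nat.card K) ∧ x ∈ K ∧ y ∈ K ∧
      ∀ D : Subgroup G, x ∈ D → y ∈ D → K ≤ D := by
  refine ⟨Subgroup.zpowers x ⊔ Subgroup.zpowers y, ?_,
    Subgroup.mem_sup_left (Subgroup.mem_zpowers x), Subgroup.mem_sup_right (Subgroup.mem_zpowers y), ?_⟩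
  · apply piN_sup
    · apply norm_ext
      have : Subgroup.zpowers x ≤ (Subgroup.zpowers x).comap (MulAut.conj y).toMonoidHom := by
        rw [Subgroup.zpowers_le]
        simp [Subgroup.mem_comap, hxy]
      intro a ha
      simpa [Subgroup.mem_comap] using this ha
    · exact piN_zpowers _ m hm hx
    · exact piN_zpowers _ m' hm' hy
  · intro D hx hy
    rw [sup_le_iff, Subgroup.zpowers_le, Subgroup.zpowers_le]
    exact ⟨hx, hy⟩

lemma grp_L {π : Set ℕ} {G : Type*} [Group G] [Finite G] (h2 : 2 ∈ π) (h3 : 3 ∈ π) (I J W : G)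
    (hI : I ^ 4 = 1) (hJ : J ^ 4 = 1) (hW : W ^ 3 = 1) (hJI : J * I = I⁻¹ * J)
    (hWI : W * I = J * W) (hWJ : W * J = I * J * W) :
    ∃ K : Subgroup G, IsPiNumber π (Nat.card K) ∧ I ∈ K ∧ J ∈ K ∧ W ∈ K ∧
      ∀ D : Subgroup G, I ∈ D → J ∈ D → W ∈ D → K ≤ D := by
  have p2 : IsPiNumber π 2 := IsPiNumber.prime Nat.prime_two h2
  have p3 : IsPiNumber π 3 := IsPiNumber.prime Nat.prime_three h3
  have p4 : IsPiNumber π 4 := p2.mul p2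
  obtain ⟨A, hA, hIA, hJA, hAD⟩ := grp_two (π := π) I J 4 4 p4 p4 hI hJ hJI
  refine ⟨A ⊔ Subgroup.zpowers W, ?_, Subgroup.mem_sup_left hIA, Subgroup.mem_sup_left hJA,
    Subgroup.mem_sup_right (Subgroup.mem_zpowers W), ?_⟩
  · apply piN_sup
    · apply norm_ext
      have : A ≤ A.comap (MulAut.conj W).toMonoidHom := by
        apply hAD
        · simp [Subgroup.mem_comap, hWI, hJA]
        · simp [Subgroup.mem_comap, hWJ, mul_mem hIA hJA]
      intro a ha
      simpa [Subgroup.mem_comap] using this ha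
    · exact hA
    · exact piN_zpowers _ 3 p3 hW
  · intro D hx hy hz
    rw [sup_le_iff, Subgroup.zpowers_le]
    exact ⟨hAD D hx hy, hz⟩

variable {F : Type*} [Field F] (κ : Type*) [Fintype κ] [DecidableEq κ]

/-- Block embedding of 2 by 2 matrices. -/
def emb2M : Matrix (Fin 2) (Fin 2) F →* Matrix (Fin 2 ⊕ κ) (Fin 2 ⊕ κ) F where
  toFun A := fromBlocks A 0 0 1
  map_one' := fromBlocks_one
  map_mul' A B := by simp [fromBlocks_multiply]

/-- Block embedding of the special linear group of degree 2. -/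
def emb2 : SpecialLinearGroup (Fin 2) F →* GL (Fin 2 ⊕ κ) F :=
  (Units.map (emb2M κ)).comp SpecialLinearGroup.toGL

lemma emb2_coe (A : SpecialLinearGroup (Fin 2) F) :
    ((emb2 κ A : GL (Fin 2 ⊕ κ) F) : Matrix (Fin 2 ⊕ κ) (Fin 2 ⊕ κ) F)
      = fromBlocks (A : Matrix (Fin 2) (Fin 2) F) 0 0 1 := rfl

lemma emb2_det (A : SpecialLinearGroup (Fin 2) F) :
    ((emb2 κ A : GL (Fin 2 ⊕ κ) F) : Matrix (Fin 2 ⊕ κ) (Fin 2 ⊕ κ) F).det = 1 := by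
  rw [emb2_coe, det_fromBlocks_zero₂₁, det_one, mul_one, A.2]

lemma emb2_inj : Function.Injective (emb2 κ : SpecialLinearGroup (Fin 2) F →* _) := by
  intro A B h
  have h1 := congrArg (fun g : GL (Fin 2 ⊕ κ) F => (g : Matrix (Fin 2 ⊕ κ) (Fin 2 ⊕ κ) F)) h
  simp only [emb2_coe] at h1
  exact Subtype.ext (fromBlocks_inj.1 h1).1

lemma sl_ext {ι : Type*} [Fintype ι] [DecidableEq ι] {A B : SpecialLinearGroup ι F}
    (h : (A : Matrix ι ι F) = (B : Matrix ι ι F)) : A = B := Subtype.ext h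

/-- The quaternion unit `i`. -/
def qI : SpecialLinearGroup (Fin 2) F := ⟨!![0, -1; 1, 0], by simp [det_fin_two]⟩

/-- The quaternion unit `j`. -/
def qJ (a b : F) (h : a ^ 2 + b ^ 2 = -1) : SpecialLinearGroup (Fin 2) F :=
  ⟨!![a, b; b, -a], by simp only [det_fin_two_of]; linear_combination -h⟩

lemma qI_coe : ((qI : SpecialLinearGroup (Fin 2) F) : Matrix (Fin 2) (Fin 2) F) = !![0, -1; 1, 0] := rfl

lemma qJ_coe (a b : F) (h : a ^ 2 + b ^ 2 = -1) : ((qJ a b h : SpecialLinearGroup (Fin 2) F) : Matrix (Fin 2) (Fin 2) F) = !![a, b; b, -a] := rfl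

lemma qJI (a b : F) (h : a ^ 2 + b ^ 2 = -1) : qJ a b h * qI = qI⁻¹ * qJ a b h := by
  apply sl_ext
  simp only [Matrix.SpecialLinearGroup.coe_mul, Matrix.SpecialLinearGroup.coe_inv, Matrix.SpecialLinearGroup.coe_neg, Matrix.SpecialLinearGroup.coe_one, qI_coe, qJ_coe]
  ext i j
  fin_cases i <;> fin_cases j <;>
    simp [qJ_coe, qI_coe, Matrix.SpecialLinearGroup.coe_mul, Matrix.SpecialLinearGroup.coe_inv, adjugate_fin_two]

lemma qI_sq : (qI : SpecialLinearGroup (Fin 2) F) * qI = -1 := by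
  apply sl_ext
  simp only [Matrix.SpecialLinearGroup.coe_mul, Matrix.SpecialLinearGroup.coe_inv, Matrix.SpecialLinearGroup.coe_neg, Matrix.SpecialLinearGroup.coe_one, qI_coe, qJ_coe]
  ext i j
  fin_cases i <;> fin_cases j <;>
    simp [qI_coe, Matrix.SpecialLinearGroup.coe_mul]

lemma qJ_sq (a b : F) (h : a ^ 2 + b ^ 2 = -1) : qJ a b h * qJ a b h = -1 := by
  apply sl_ext
  simp only [Matrix.SpecialLinearGroup.coe_mul, Matrix.SpecialLinearGroup.coe_inv, Matrix.SpecialLinearGroup.coe_neg, Matrix.SpecialLinearGroup.coe_one, qI_coe, qJ_coe]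
  ext i j
  fin_cases i <;> fin_cases j <;>
    simp [qJ_coe, Matrix.SpecialLinearGroup.coe_mul] <;>
    first | linear_combination h | linear_combination 0 * h

variable (h20 : (2 : F) ≠ 0)

/-- The element of order 3 normalizing the quaternion group. -/
def qW (h20 : (2 : F) ≠ 0) (a b : F) (h : a ^ 2 + b ^ 2 = -1) : SpecialLinearGroup (Fin 2) F :=
  ⟨!![-(1 + a - b) / 2, -(-1 + b + a) / 2; -(1 + b + a) / 2, -(1 - a + b) / 2], by
    simp only [det_fin_two_of]; field_simp; linear_combination -2 * h⟩

lemma qW_coe (a b : F) (h : a ^ 2 + b ^ 2 = -1) : ((qW h20 a b h : SpecialLinearGroup (Fin 2) F) : Matrix (Fin 2) (Fin 2) F) = !![-(1 + a - b) / 2, -(-1 + b + a) / 2; -(1 + b + a) / 2, -(1 - a + b) / 2] := rfl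

lemma qWI (a b : F) (h : a ^ 2 + b ^ 2 = -1) : qW h20 a b h * qI = qJ a b h * qW h20 a b h := by
  apply sl_ext
  simp only [Matrix.SpecialLinearGroup.coe_mul, Matrix.SpecialLinearGroup.coe_inv, Matrix.SpecialLinearGroup.coe_neg, Matrix.SpecialLinearGroup.coe_one, qI_coe, qJ_coe, qW_coe]
  ext i j
  fin_cases i <;> fin_cases j <;>
    simp [qJ_coe, qI_coe, qW_coe, Matrix.SpecialLinearGroup.coe_mul] <;>
    field_simp <;> first | linear_combination h | linear_combination -h

lemma qWJ (a b : F) (h : a ^ 2 + b ^ 2 = -1) :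
    qW h20 a b h * qJ a b h = qI * qJ a b h * qW h20 a b h := by
  apply sl_ext
  simp only [Matrix.SpecialLinearGroup.coe_mul, Matrix.SpecialLinearGroup.coe_inv, Matrix.SpecialLinearGroup.coe_neg, Matrix.SpecialLinearGroup.coe_one, qI_coe, qJ_coe, qW_coe]
  ext i j
  fin_cases i <;> fin_cases j <;>
    simp [qJ_coe, qI_coe, qW_coe, Matrix.SpecialLinearGroup.coe_mul] <;>
    field_simp <;> ring

lemma qW_cube (a b : F) (h : a ^ 2 + b ^ 2 = -1) :
    qW h20 a b h * qW h20 a b h * qW h20 a b h = 1 := by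
  have h4 : (4 : F) ≠ 0 := by
    have : (4 : F) = 2 * 2 := by norm_num
    rw [this]; exact mul_ne_zero h20 h20
  have hb : b ^ 2 = -1 - a ^ 2 := by linear_combination h
  have hsq : qW h20 a b h * qW h20 a b h = (qW h20 a b h)⁻¹ := by
    apply sl_ext
    simp only [Matrix.SpecialLinearGroup.coe_mul, Matrix.SpecialLinearGroup.coe_inv, Matrix.SpecialLinearGroup.coe_neg, Matrix.SpecialLinearGroup.coe_one, qI_coe, qJ_coe, qW_coe]
    ext i j
    fin_cases i <;> fin_cases j <;>
      simp [qW_coe, Matrix.SpecialLinearGroup.coe_mul, Matrix.SpecialLinearGroup.coe_inv, adjugate_fin_two] <;>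
      field_simp <;> ring_nf <;> simp only [hb] <;> ring
  rw [hsq, inv_mul_cancel]
end Emb2

section ZGL
set_option linter.unusedSimpArgs false
open Matrix

variable {F : Type*} [Field F] {κ : Type*} [Fintype κ] [DecidableEq κ]

lemma exists_phi (p : ℕ) [Fact p.Prime] [CharP F p] [Finite F] :
    Nonempty (F →+* AlgebraicClosure (ZMod p)) := by
  let : Algebra (ZMod p) F := ZMod.algebra F p
  have : Algebra.IsAlgebraic (ZMod p) F := Algebra.IsAlgebraic.of_finite _ _
  exact ⟨(IsAlgClosed.lift (R := ZMod p) (S := F) (M := AlgebraicClosure (ZMod p))).toRingHom⟩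

lemma exists_ab [Fintype F] : ∃ a b : F, a ^ 2 + b ^ 2 = -1 := by
  classical
  by_cases h : ringChar F = 2
  · have : CharP F 2 := by rw [← h]; infer_instance
    exact ⟨1, 0, by rw [one_pow, zero_pow two_ne_zero, add_zero, CharTwo.neg_eq]⟩
  · have := FiniteField.exists_root_sum_quadratic (f := (Polynomial.X ^ 2 : Polynomial F))
      (g := (Polynomial.X ^ 2 + Polynomial.C 1 : Polynomial F)) (by simp)
      (by rw [Polynomial.degree_X_pow_add_C (by norm_num)]; rfl)
      (by rcases FiniteField.even_card_iff_char_two.not.1 h |> fun h => Nat.mod_two_ne_zero.1 h with h; exact h)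
    obtain ⟨a, b, hab⟩ := this
    refine ⟨a, b, ?_⟩
    simp at hab
    linear_combination hab

lemma q_ne [NeZero (2 : F)] (a b : F) (h : a ^ 2 + b ^ 2 = -1) :
    ¬ Commute (emb2 κ qI) (emb2 κ (qJ a b h)) := by
  intro hc
  have h1 : (qI : SpecialLinearGroup (Fin 2) F) * qJ a b h = qJ a b h * qI := by
    apply emb2_inj κ
    rw [map_mul, map_mul]
    exact hc
  have h2 := congrArg (fun A : SpecialLinearGroup (Fin 2) F => (A : Matrix (Fin 2) (Fin 2) F)) h1
  simp only [Matrix.SpecialLinearGroup.coe_mul, qI_coe, qJ_coe] at h2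
  have e1 := congrFun (congrFun h2 0) 0
  have e2 := congrFun (congrFun h2 0) 1
  simp [Matrix.mul_apply] at e1 e2
  have h20 : (2 : F) ≠ 0 := NeZero.ne _
  have hb : b = 0 := by
    have : (2 : F) * b = 0 := by linear_combination -e1
    exact (mul_eq_zero.1 this).resolve_left h20
  have ha : a = 0 := by
    have : (2 : F) * a = 0 := by linear_combination e2
    exact (mul_eq_zero.1 this).resolve_left h20
  rw [ha, hb] at h
  norm_num at h

lemma lemZ_GL (p : ℕ) [Fact p.Prime] (φ : F →+* AlgebraicClosure (ZMod p)) (h20 : (2 : F) ≠ 0)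
    (N : ℕ) (hpN : ¬ p ∣ N) (S : Subgroup (GL (Fin 2 ⊕ κ) F)) (a b : F) (hab : a ^ 2 + b ^ 2 = -1)
    (hI : emb2 κ qI ∈ S) (hJ : emb2 κ (qJ a b hab) ∈ S) (hW : emb2 κ (qW h20 a b hab) ∈ S)
    (x : GL (Fin 2 ⊕ κ) F) (hxS : x ∈ S) (hx : x ^ N = 1)
    (hc : ∀ h ∈ S, Commute x (h * x * h⁻¹)) :
    Commute x (emb2 κ qI) ∧ Commute x (emb2 κ (qJ a b hab)) := by
  set kk := AlgebraicClosure (ZMod p) with hkk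
  have hNk : (N : kk) ≠ 0 := by rwa [Ne, CharP.cast_eq_zero_iff kk p]
  have hz : emb2 κ (-1 : SpecialLinearGroup (Fin 2) F) ∈ S := by
    rw [← qI_sq, map_mul]; exact mul_mem hI hI
  let ρ : S →* Module.End kk ((Fin 2 ⊕ κ) → kk) :=
    ((Matrix.toLinAlgEquiv' (R := kk) (n := Fin 2 ⊕ κ)).toMulEquiv.toMonoidHom.comp
      (RingHom.toMonoidHom (φ.mapMatrix : Matrix (Fin 2 ⊕ κ) (Fin 2 ⊕ κ) F →+* Matrix (Fin 2 ⊕ κ) (Fin 2 ⊕ κ) kk))).comp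
      ((Units.coeHom _).comp S.subtype)
  have hρ : ∀ (g : S) v, ρ g v = (((g : GL (Fin 2 ⊕ κ) F) : Matrix (Fin 2 ⊕ κ) (Fin 2 ⊕ κ) F).map φ) *ᵥ v :=
    fun g v => rfl
  have hinj : Function.Injective ρ := by
    intro g g' h
    apply Subtype.ext
    apply Units.ext
    have h1 : (((g : GL (Fin 2 ⊕ κ) F) : Matrix (Fin 2 ⊕ κ) (Fin 2 ⊕ κ) F).map φ)
      = (((g' : GL (Fin 2 ⊕ κ) F) : Matrix (Fin 2 ⊕ κ) (Fin 2 ⊕ κ) F).map φ) := by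
      apply Matrix.toLinAlgEquiv'.injective
      exact h
    ext i j
    exact φ.injective (congrFun (congrFun h1 i) j)
  have neg_coe : ((-1 : SpecialLinearGroup (Fin 2) F) : Matrix (Fin 2) (Fin 2) F) = -1 := by
    rw [Matrix.SpecialLinearGroup.coe_neg, Matrix.SpecialLinearGroup.coe_one]
  have key := lemZ_core ρ ⟨x, hxS⟩ N hNk (Subtype.ext hx)
    (fun s => Subtype.ext (hc s s.2).eq) ⟨_, hI⟩ ⟨_, hJ⟩ ⟨_, hW⟩ ⟨_, hz⟩
    (Subtype.ext (by
      show emb2 κ qI * emb2 κ qI = emb2 κ (-1)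
      rw [← map_mul, qI_sq]))
    (Subtype.ext (by
      show emb2 κ (-1) * emb2 κ (-1) = 1
      rw [← map_mul]; simp))
    (Subtype.ext (by
      show emb2 κ _ * emb2 κ _ * emb2 κ _ = 1
      rw [← map_mul, ← map_mul, qW_cube, map_one]))
    (Subtype.ext (by
      show emb2 κ _ * emb2 κ _ = emb2 κ _ * emb2 κ _
      rw [← map_mul, ← map_mul]; simp))
    (Subtype.ext (by
      show emb2 κ _ * emb2 κ _ = emb2 κ _ * emb2 κ _
      rw [← map_mul, ← map_mul, qWI]))
    (Subtype.ext (by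
      show emb2 κ _ * emb2 κ _ = emb2 κ _ * emb2 κ _ * emb2 κ _
      rw [← map_mul, ← map_mul, ← map_mul, qWJ]))
    ?_ (Pi.single (Sum.inl 0) 1) (Pi.single (Sum.inl 1) 1) ?_
  · constructor
    · have := hinj ((map_mul ρ _ _).trans (key.1.trans (map_mul ρ _ _).symm))
      exact congrArg Subtype.val this
    · have := hinj ((map_mul ρ _ _).trans (key.2.trans (map_mul ρ _ _).symm))
      exact congrArg Subtype.val this
  · intro v
    simp only [hρ, emb2_coe, neg_coe, qI_coe]
    ext i
    rcases i with i | i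
    · fin_cases i <;> simp [Matrix.mulVec, dotProduct, fromBlocks_map, fromBlocks_multiply, Matrix.one_apply, Matrix.mul_apply, Fin.sum_univ_two]
    · simp [Matrix.mulVec, dotProduct, fromBlocks_map, fromBlocks_multiply, Matrix.one_apply, Matrix.mul_apply, Fin.sum_univ_two]
  · intro v hv
    refine ⟨v (Sum.inl 0), v (Sum.inl 1), ?_⟩
    have h2k : (2 : kk) ≠ 0 := by
      intro h
      apply h20
      apply φ.injective
      rw [map_ofNat, map_zero, h]
    simp only [hρ, emb2_coe, neg_coe] at hv
    ext i
    rcases i with i | i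
    · fin_cases i <;> simp
    · have := congrFun hv (Sum.inr i)
      simp [Matrix.mulVec, dotProduct, fromBlocks_map, fromBlocks_multiply, Matrix.one_apply, Matrix.mul_apply, Fin.sum_univ_two] at this
      have h3 : (2 : kk) * v (Sum.inr i) = 0 := by linear_combination this
      simpa using (mul_eq_zero.1 h3).resolve_left h2k
end ZGL

section CaseDiag
open Matrix

theorem lemTZ {π : Set ℕ} (p : ℕ) [Fact p.Prime] (hp : p ∉ π) (N : ℕ) (hN : 0 < N)
    (hNπ : IsPiNumber π N) :
    ∃ ζ : AlgebraicClosure (ZMod p), IsPrimitiveRoot ζ N ∧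
    ∀ (κ : Type*) [Fintype κ] [DecidableEq κ] (F : Type*) [Field F] [Finite F]
      (φ : F →+* AlgebraicClosure (ZMod p)) (h20 : (2 : F) ≠ 0)
      (S : Subgroup (GL (Fin 2 ⊕ κ) F)) (_ : IsPiNumber π (Nat.card S))
      (a b : F) (hab : a ^ 2 + b ^ 2 = -1)
      (_ : emb2 κ qI ∈ S) (_ : emb2 κ (qJ a b hab) ∈ S) (_ : emb2 κ (qW h20 a b hab) ∈ S)
      (g x : GL (Fin 2 ⊕ κ) F) (_ : g * x * g⁻¹ ∈ S) (A B : ℕ)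
      (_ : 6 * (B - A) ≤ N) (_ : x ^ N = 1)
      (_ : ∀ μ : AlgebraicClosure (ZMod p),
        ((x : Matrix (Fin 2 ⊕ κ) (Fin 2 ⊕ κ) F).map φ
          - μ • (1 : Matrix (Fin 2 ⊕ κ) (Fin 2 ⊕ κ) (AlgebraicClosure (ZMod p)))).det = 0 →
        ∃ j, A ≤ j ∧ j ≤ B ∧ μ = ζ ^ j),
      Commute (g * x * g⁻¹) (emb2 κ qI) ∧ Commute (g * x * g⁻¹) (emb2 κ (qJ a b hab)) := by
  have hpN : ¬ p ∣ N := fun h => hp (hNπ p Fact.out h)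
  obtain ⟨ζ, hζ, hT⟩ := thmT p N hN hpN
  refine ⟨ζ, hζ, ?_⟩
  intro κ _ _ F _ _ φ h20 S hS a b hab hI hJ hW g x hgx A B h6 hxN hspec
  have hpS : ¬ p ∣ Nat.card S := fun h => hp (hS p Fact.out h)
  have hN' : (g * x * g⁻¹) ^ N = 1 := by
    rw [conj_pow, hxN, mul_one, mul_inv_cancel]
  apply lemZ_GL p φ h20 N hpN S a b hab hI hJ hW _ hgx hN'
  intro h hh
  refine hT (Fin 2 ⊕ κ) F φ S hpS _ hgx A B h6 hN' ?_ h hh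
  intro μ hμ
  apply hspec
  rw [← hμ]
  set G : Matrix (Fin 2 ⊕ κ) (Fin 2 ⊕ κ) (AlgebraicClosure (ZMod p)) :=
    φ.mapMatrix (g : Matrix (Fin 2 ⊕ κ) (Fin 2 ⊕ κ) F) with hG
  set G' : Matrix (Fin 2 ⊕ κ) (Fin 2 ⊕ κ) (AlgebraicClosure (ZMod p)) :=
    φ.mapMatrix ((g⁻¹ : GL (Fin 2 ⊕ κ) F) : Matrix (Fin 2 ⊕ κ) (Fin 2 ⊕ κ) F) with hG'
  have hGG : G * G' = 1 := by
    rw [hG, hG', ← map_mul, ← Units.val_mul, mul_inv_cancel, Units.val_one, map_one]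
  have hdd : G.det * G'.det = 1 := by rw [← det_mul, hGG, det_one]
  have e : ((g * x * g⁻¹ : GL (Fin 2 ⊕ κ) F) : Matrix (Fin 2 ⊕ κ) (Fin 2 ⊕ κ) F).map φ - μ • 1
      = G * ((x : Matrix (Fin 2 ⊕ κ) (Fin 2 ⊕ κ) F).map φ - μ • 1) * G' := by
    have : ((g * x * g⁻¹ : GL (Fin 2 ⊕ κ) F) : Matrix (Fin 2 ⊕ κ) (Fin 2 ⊕ κ) F).map φ =
        G * (x : Matrix (Fin 2 ⊕ κ) (Fin 2 ⊕ κ) F).map φ * G' := by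
      show φ.mapMatrix _ = G * φ.mapMatrix _ * G'
      rw [hG, hG', ← map_mul, ← map_mul, Units.val_mul, Units.val_mul]
    rw [this, mul_sub, sub_mul]
    simp [hGG]
  rw [e, det_mul, det_mul]
  linear_combination (-(((x : Matrix (Fin 2 ⊕ κ) (Fin 2 ⊕ κ) F).map φ - μ • 1).det)) * hdd

/-- Diagonal matrices as elements of the general linear group. -/
def dg (ι F : Type*) [Fintype ι] [DecidableEq ι] [Field F] : (ι → Fˣ) →* GL ι F where
  toFun d := ⟨diagonal fun i => (d i : F), diagonal fun i => ((d i)⁻¹ : Fˣ),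
    by rw [diagonal_mul_diagonal]; simp, by rw [diagonal_mul_diagonal]; simp⟩
  map_one' := by ext; simp
  map_mul' a b := Units.ext (by
    show diagonal (fun i => ((a * b) i : F)) = diagonal (fun i => (a i : F)) * diagonal (fun i => (b i : F))
    rw [diagonal_mul_diagonal]; simp)

lemma dg_coe {ι F : Type*} [Fintype ι] [DecidableEq ι] [Field F] (d : ι → Fˣ) :
    ((dg ι F d : GL ι F) : Matrix ι ι F) = diagonal fun i => (d i : F) := rfl

lemma dg_comm {ι F : Type*} [Fintype ι] [DecidableEq ι] [Field F] (X : Set (ι → Fˣ))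
    (hX : ∀ i j, i ≠ j → ∃ d ∈ X, d i ≠ d j) (g A B : GL ι F)
    (hA : ∀ d ∈ X, Commute (g * dg ι F d * g⁻¹) A)
    (hB : ∀ d ∈ X, Commute (g * dg ι F d * g⁻¹) B) : Commute A B := by
  have key : ∀ A : GL ι F, (∀ d ∈ X, Commute (g * dg ι F d * g⁻¹) A) →
      ∃ v : ι → F, ((g⁻¹ * A * g : GL ι F) : Matrix ι ι F) = diagonal v := by
    intro A hA
    refine ⟨fun i => ((g⁻¹ * A * g : GL ι F) : Matrix ι ι F) i i, ?_⟩
    ext i j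
    by_cases hij : i = j
    · subst hij; simp
    · rw [diagonal_apply_ne _ hij]
      obtain ⟨d, hd, hne⟩ := hX i j hij
      have h1 : dg ι F d * (g⁻¹ * A * g) = (g⁻¹ * A * g) * dg ι F d := by
        have := (hA d hd).eq
        calc dg ι F d * (g⁻¹ * A * g) = g⁻¹ * (g * dg ι F d * g⁻¹ * A) * g := by group
          _ = g⁻¹ * (A * (g * dg ι F d * g⁻¹)) * g := by rw [this]
          _ = _ := by group
      have h2 := congrArg (fun M : GL ι F => (M : Matrix ι ι F) i j) h1
      simp only [Units.val_mul _ (dg ι F d), Units.val_mul (dg ι F d), dg_coe, diagonal_mul, mul_diagonal] at h2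
      have h3 : ((d i : F) - d j) * ((g⁻¹ * A * g : GL ι F) : Matrix ι ι F) i j = 0 := by
        linear_combination h2
      refine (mul_eq_zero.1 h3).resolve_left ?_
      intro h
      exact hne (Units.ext (sub_eq_zero.1 h))
  obtain ⟨v, hv⟩ := key A hA
  obtain ⟨w, hw⟩ := key B hB
  have h1 : Commute (g⁻¹ * A * g) (g⁻¹ * B * g) := by
    apply Units.ext
    show ((g⁻¹ * A * g : GL ι F) : Matrix ι ι F) * ((g⁻¹ * B * g : GL ι F) : Matrix ι ι F)
      = ((g⁻¹ * B * g : GL ι F) : Matrix ι ι F) * ((g⁻¹ * A * g : GL ι F) : Matrix ι ι F)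
    rw [hv, hw, diagonal_mul_diagonal, diagonal_mul_diagonal]
    simp [mul_comm]
  have h2 := h1.eq
  have h3 : g⁻¹ * (A * B) * g = g⁻¹ * (B * A) * g := by
    calc g⁻¹ * (A * B) * g = (g⁻¹ * A * g) * (g⁻¹ * B * g) := by group
      _ = (g⁻¹ * B * g) * (g⁻¹ * A * g) := h2
      _ = _ := by group
  exact mul_left_cancel (mul_right_cancel h3)

lemma dg_spec {ι F k : Type*} [Fintype ι] [DecidableEq ι] [Field F] [Field k] (φ : F →+* k)
    (d : ι → Fˣ) (μ : k)
    (h : (((dg ι F d : GL ι F) : Matrix ι ι F).map φ - μ • (1 : Matrix ι ι k)).det = 0) :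
    ∃ i, μ = φ (d i) := by
  have : ((dg ι F d : GL ι F) : Matrix ι ι F).map φ - μ • (1 : Matrix ι ι k)
      = diagonal fun i => φ (d i) - μ := by
    rw [dg_coe]
    ext i j
    by_cases hij : i = j
    · subst hij; simp
    · simp [hij]
  rw [this, det_diagonal, Finset.prod_eq_zero_iff] at h
  obtain ⟨i, -, hi⟩ := h
  exact ⟨i, (sub_eq_zero.1 hi).symm⟩

lemma exists_prim_unit {F k : Type*} [Field F] [Finite F] [Field k] (φ : F →+* k) (N : ℕ)
    (hN : 0 < N) (hd : N ∣ Nat.card F - 1) (ζ : k) (hζ : IsPrimitiveRoot ζ N) :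
    ∃ s : Fˣ, φ s = ζ ∧ IsPrimitiveRoot s N := by
  have := Fintype.ofFinite F
  obtain ⟨g, hg⟩ := IsCyclic.exists_generator (α := Fˣ)
  have hord : orderOf g = Nat.card F - 1 := by
    rw [orderOf_eq_card_of_forall_mem_zpowers hg, Nat.card_units]
  obtain ⟨c, hc⟩ := hd
  have hpos : 0 < Nat.card F - 1 := by
    rw [← hord]; exact orderOf_pos g
  have hc0 : 0 < c := by
    rcases Nat.eq_zero_or_pos c with h | h
    · rw [h] at hc; omega
    · exact h
  have h1 : IsPrimitiveRoot (g ^ c) N := by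
    have h2 : IsPrimitiveRoot g (N * c) := by rw [← hc, ← hord]; exact IsPrimitiveRoot.orderOf g
    exact h2.pow (by rw [← hc]; exact hpos) (by rw [mul_comm])
  have h3 : IsPrimitiveRoot (φ ((g ^ c : Fˣ) : F)) N := by
    have := h1.map_of_injective (f := (φ : F →* k).comp (Units.coeHom F))
      (φ.injective.comp Units.val_injective)
    exact this
  have : NeZero N := ⟨hN.ne'⟩
  obtain ⟨i, -, hi⟩ := h3.eq_pow_of_pow_eq_one hζ.pow_eq_one
  refine ⟨(g ^ c) ^ i, by rw [← hi]; simp, ?_⟩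
  rw [← hi] at hζ
  refine ⟨by rw [← pow_mul, mul_comm, pow_mul, h1.pow_eq_one, one_pow], fun l hl => ?_⟩
  apply hζ.dvd_of_pow_eq_one
  have := congrArg (fun u : Fˣ => φ (u : F)) hl
  simpa using this
end CaseDiag

section CaseC13
open Matrix
set_option linter.unusedSimpArgs false
set_option linter.flexible false

lemma Core.stdL {π : Set ℕ} (h2 : 2 ∈ π) (h3 : 3 ∈ π) {κ F : Type*} [Fintype κ] [DecidableEq κ]
    [Field F] [Finite F] (h20 : (2 : F) ≠ 0) (a b : F) (hab : a ^ 2 + b ^ 2 = -1)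
    {S : Subgroup (GL (Fin 2 ⊕ κ) F)} (h : Core π S) :
    ∃ S' : Subgroup (GL (Fin 2 ⊕ κ) F), Core π S' ∧ emb2 κ qI ∈ S' ∧ emb2 κ (qJ a b hab) ∈ S' ∧
      emb2 κ (qW h20 a b hab) ∈ S' := by
  obtain ⟨K, hK, hI, hJ, hW, hD⟩ := grp_L (G := GL (Fin 2 ⊕ κ) F) h2 h3 (emb2 κ qI)
    (emb2 κ (qJ a b hab)) (emb2 κ (qW h20 a b hab))
    (by rw [← map_pow, show (4 : ℕ) = 2 * 2 from rfl, pow_mul, pow_two qI, qI_sq]; simp)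
    (by rw [← map_pow, show (4 : ℕ) = 2 * 2 from rfl, pow_mul, pow_two (qJ a b hab), qJ_sq]; simp)
    (by rw [← map_pow, pow_succ, pow_two, qW_cube, map_one])
    (by rw [← map_inv, ← map_mul, ← map_mul, qJI])
    (by rw [← map_mul, ← map_mul, qWI])
    (by rw [← map_mul, ← map_mul, ← map_mul, qWJ])
  obtain ⟨S', hS', hle⟩ := h.std K hK (by
    have : K ≤ (emb2 κ : SpecialLinearGroup (Fin 2) F →* _).range :=
      hD _ ⟨_, rfl⟩ ⟨_, rfl⟩ ⟨_, rfl⟩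
    intro k hk
    obtain ⟨A, rfl⟩ := this hk
    exact emb2_det κ A)
  exact ⟨S', hS', hle hI, hle hJ, hle hW⟩

lemma dg_det {ι F : Type*} [Fintype ι] [DecidableEq ι] [Field F] (d : ι → Fˣ) :
    ((dg ι F d : GL ι F) : Matrix ι ι F).det = ((∏ i, d i : Fˣ) : F) := by
  rw [dg_coe, det_diagonal]; simp

theorem caseC1 {π : Set ℕ} (h2 : 2 ∈ π) (h3 : 3 ∈ π) {κ F : Type*} [Fintype κ] [DecidableEq κ]
    [Field F] [Fintype F] (h20 : (2 : F) ≠ 0) (p : ℕ) [Fact p.Prime] [CharP F p] (hp : p ∉ π)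
    {S : Subgroup (GL (Fin 2 ⊕ κ) F)} (hS : Core π S) (N : ℕ) (hNπ : IsPiNumber π N) (hN : 12 ≤ N)
    (hd : N ∣ Nat.card F - 1) : False := by
  have : NeZero (2 : F) := ⟨h20⟩
  obtain ⟨a, b, hab⟩ := exists_ab (F := F)
  obtain ⟨φ⟩ := exists_phi (F := F) p
  obtain ⟨S, hS, hI, hJ, hW⟩ := hS.stdL h2 h3 h20 a b hab
  obtain ⟨ζ, hζ, hT⟩ := lemTZ p hp N (by omega) hNπ
  obtain ⟨s, hs, hs'⟩ := exists_prim_unit φ N (by omega) hd ζ hζ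
  let D : Subgroup ((Fin 2 ⊕ κ) → Fˣ) :=
    { carrier := {u | u ^ N = 1 ∧ ∏ i, u i = 1}
      mul_mem' := by
        rintro x y ⟨h1, h2⟩ ⟨h3, h4⟩
        exact ⟨by rw [mul_pow, h1, h3, one_mul], by simp [Finset.prod_mul_distrib, h2, h4]⟩
      one_mem' := by simp
      inv_mem' := by
        rintro x ⟨h1, h2⟩
        exact ⟨by rw [inv_pow, h1, inv_one], by simp [h2]⟩ }
  obtain ⟨g, hg⟩ := hS.2.1 (D.map (dg _ F)) (by
    apply piN_of_elts
    rintro _ ⟨u, hu, rfl⟩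
    exact ⟨N, hNπ, by rw [← map_pow, hu.1, map_one]⟩) (by
    rintro _ ⟨u, hu, rfl⟩
    rw [dg_det, hu.2]; simp)
  let X : Set ((Fin 2 ⊕ κ) → Fˣ) :=
    {u | ∃ i j, i ≠ j ∧ u = Pi.mulSingle i s * Pi.mulSingle j s⁻¹}
  have key : ∀ u ∈ X, Commute (g * dg _ F u * g⁻¹) (emb2 κ qI) ∧
      Commute (g * dg _ F u * g⁻¹) (emb2 κ (qJ a b hab)) := by
    rintro u ⟨i, j, hij, rfl⟩
    have hsN := hs'.pow_eq_one
    have hu : Pi.mulSingle i s * Pi.mulSingle j s⁻¹ ∈ D := by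
      refine ⟨?_, ?_⟩
      · rw [mul_pow, ← Pi.mulSingle_pow, ← Pi.mulSingle_pow, inv_pow, hsN]; simp
      · simp [Finset.prod_mul_distrib]
    refine hT κ F φ h20 S hS.1 a b hab hI hJ hW g _ (hg _ ⟨_, hu, rfl⟩) (N - 1) (N + 1)
      (by omega) (by rw [← map_pow, hu.1, map_one]) ?_
    intro μ hμ
    obtain ⟨l, hl⟩ := dg_spec φ _ μ hμ
    by_cases h1 : l = i
    · subst h1
      refine ⟨N + 1, by omega, by omega, ?_⟩
      rw [hl, pow_succ, hζ.pow_eq_one, one_mul]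
      simp [Pi.mulSingle_apply, hij, hs]
    · by_cases h2 : l = j
      · subst h2
        refine ⟨N - 1, by omega, by omega, ?_⟩
        rw [hl]
        simp [Pi.mulSingle_apply, h1, hs]
        have : ζ ^ (N - 1) * ζ = 1 := by
          rw [← pow_succ, Nat.sub_add_cancel (by omega), hζ.pow_eq_one]
        exact (eq_inv_of_mul_eq_one_left this).symm
      · refine ⟨N, by omega, by omega, ?_⟩
        rw [hl, hζ.pow_eq_one]
        simp [Pi.mulSingle_apply, h1, h2]
  apply q_ne (κ := κ) a b hab
  apply dg_comm X _ g _ _ (fun d hd => (key d hd).1) (fun d hd => (key d hd).2)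
  intro i j hij
  refine ⟨_, ⟨i, j, hij, rfl⟩, ?_⟩
  simp [Pi.mulSingle_apply, hij, hij.symm]
  intro h
  have h5 : s ^ 2 = 1 := by rw [pow_two]; nth_rewrite 1 [h]; simp
  have := Nat.le_of_dvd (by norm_num) (hs'.dvd_of_pow_eq_one _ h5)
  omega

theorem caseC3 {π : Set ℕ} (h2 : 2 ∈ π) (h3 : 3 ∈ π) {κ F : Type*} [Fintype κ] [DecidableEq κ]
    [Field F] [Fintype F] (h20 : (2 : F) ≠ 0) (p : ℕ) [Fact p.Prime] [CharP F p] (hp : p ∉ π)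
    {S : Subgroup (GL (Fin 2 ⊕ κ) F)} (hS : Core π S)
    (hd : 8 ∣ Nat.card F - 1) : False := by
  have : NeZero (2 : F) := ⟨h20⟩
  obtain ⟨a, b, hab⟩ := exists_ab (F := F)
  obtain ⟨φ⟩ := exists_phi (F := F) p
  obtain ⟨S, hS, hI, hJ, hW⟩ := hS.stdL h2 h3 h20 a b hab
  have hNπ : IsPiNumber π 8 := (IsPiNumber.prime Nat.prime_two h2).pow 3
  obtain ⟨ζ, hζ, hT⟩ := lemTZ p hp 8 (by omega) hNπ
  obtain ⟨s, hs, hs'⟩ := exists_prim_unit φ 8 (by omega) hd ζ hζ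
  let D : Subgroup ((Fin 2 ⊕ κ) → Fˣ) :=
    { carrier := {u | u ^ 8 = 1}
      mul_mem' := by
        intro x y h1 h3
        show (x * y) ^ 8 = 1
        rw [mul_pow, h1, h3, one_mul]
      one_mem' := by simp
      inv_mem' := by
        intro x h1
        show x⁻¹ ^ 8 = 1
        rw [inv_pow, h1, inv_one] }
  obtain ⟨g, hg⟩ := hS.2.2 2 h2 Nat.prime_two (D.map (dg _ F)) (by
    rintro ⟨_, ⟨u, hu, rfl⟩⟩
    refine ⟨3, Subtype.ext ?_⟩
    show (dg _ F u) ^ 8 = 1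
    rw [← map_pow, show u ^ 8 = 1 from hu, map_one])
  let X : Set ((Fin 2 ⊕ κ) → Fˣ) := {u | ∃ i, u = Pi.mulSingle i s}
  have key : ∀ u ∈ X, Commute (g * dg _ F u * g⁻¹) (emb2 κ qI) ∧
      Commute (g * dg _ F u * g⁻¹) (emb2 κ (qJ a b hab)) := by
    rintro u ⟨i, rfl⟩
    have hu : (Pi.mulSingle i s : (Fin 2 ⊕ κ) → Fˣ) ∈ D := by
      show _ ^ 8 = 1
      rw [← Pi.mulSingle_pow, hs'.pow_eq_one]; simp
    refine hT κ F φ h20 S hS.1 a b hab hI hJ hW g _ (hg _ ⟨_, hu, rfl⟩) 0 1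
      (by omega) (by rw [← map_pow, show (Pi.mulSingle i s : (Fin 2 ⊕ κ) → Fˣ) ^ 8 = 1 from hu, map_one]) ?_
    intro μ hμ
    obtain ⟨l, hl⟩ := dg_spec φ _ μ hμ
    by_cases h1 : l = i
    · subst h1
      refine ⟨1, by omega, by omega, ?_⟩
      rw [hl]
      simp [hs]
    · refine ⟨0, by omega, by omega, ?_⟩
      rw [hl]
      simp [Pi.mulSingle_apply, h1]
  apply q_ne (κ := κ) a b hab
  apply dg_comm X _ g _ _ (fun d hd => (key d hd).1) (fun d hd => (key d hd).2)
  intro i j hij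
  refine ⟨_, ⟨i, rfl⟩, ?_⟩
  simp [Pi.mulSingle_apply, hij.symm]
  intro h
  have h5 : s ^ 1 = 1 := by rw [pow_one, h]
  have := Nat.le_of_dvd (by norm_num) (hs'.dvd_of_pow_eq_one _ h5)
  omega
end CaseC13

section CaseCB
open Matrix
set_option linter.unusedSimpArgs false
set_option linter.flexible false

/-- Repeated block embedding. -/
def embB (m c : ℕ) (F : Type*) [Field F] : Matrix (Fin 2) (Fin 2) F →*
    Matrix (Fin 2 ⊕ ((Fin 2 × Fin m) ⊕ Fin c)) (Fin 2 ⊕ ((Fin 2 × Fin m) ⊕ Fin c)) F where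
  toFun B := fromBlocks B 0 0 (fromBlocks (blockDiagonal fun _ => B) 0 0 1)
  map_one' := by
    have : (blockDiagonal fun _ => 1 : Matrix (Fin 2 × Fin m) (Fin 2 × Fin m) F) = 1 :=
      blockDiagonal_one
    rw [this, fromBlocks_one, fromBlocks_one]
  map_mul' A B := by
    rw [fromBlocks_multiply, fromBlocks_multiply]
    simp [blockDiagonal_mul]

lemma embB_apply (m c : ℕ) {F : Type*} [Field F] (B : Matrix (Fin 2) (Fin 2) F) :
    embB m c F B = fromBlocks B 0 0 (fromBlocks (blockDiagonal fun _ => B) 0 0 1) := rfl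

lemma embB_det (m c : ℕ) {F : Type*} [Field F] (B : Matrix (Fin 2) (Fin 2) F) (h : B.det = 1) :
    (embB m c F B).det = 1 := by
  rw [embB_apply, det_fromBlocks_zero₂₁, det_fromBlocks_zero₂₁, det_blockDiagonal]
  simp [h]

lemma embB_spec (m c : ℕ) {F k : Type*} [Field F] [Field k] (φ : F →+* k) (t c0 : F) (α β : k)
    (ht : φ t = α + β) (hc0 : φ c0 = α * β) (μ : k)
    (h : ((embB m c F !![0, -c0; 1, t]).map φ - μ • 1).det = 0) :
    μ = α ∨ μ = β ∨ (c ≠ 0 ∧ μ = 1) := by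
  have e : (embB m c F !![0, -c0; 1, t]).map φ - μ • 1 =
      fromBlocks (!![-μ, -φ c0; 1, φ t - μ]) 0 0
        (fromBlocks (blockDiagonal fun _ => !![-μ, -φ c0; 1, φ t - μ]) 0 0 ((1 - μ) • 1)) := by
    rw [embB_apply]
    ext (i | (i | i)) (j | (j | j))
    · fin_cases i <;> fin_cases j <;> simp
    · simp
    · simp
    · simp
    · obtain ⟨i, i'⟩ := i
      obtain ⟨j, j'⟩ := j
      by_cases hh : i' = j'
      · subst hh
        fin_cases i <;> fin_cases j <;> simp [blockDiagonal_apply, Matrix.one_apply]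
      · simp [blockDiagonal_apply, Matrix.one_apply, hh]
    · simp
    · simp
    · simp
    · simp [Matrix.one_apply]
      split_ifs <;> simp
  rw [e, det_fromBlocks_zero₂₁, det_fromBlocks_zero₂₁, det_blockDiagonal] at h
  have hd : (!![-μ, -φ c0; 1, φ t - μ]).det = (μ - α) * (μ - β) := by
    rw [det_fin_two_of, ht, hc0]; ring
  rw [hd] at h
  rcases mul_eq_zero.1 h with h | h
  · rcases mul_eq_zero.1 h with h | h
    · exact Or.inl (sub_eq_zero.1 h)
    · exact Or.inr (Or.inl (sub_eq_zero.1 h))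
  · rcases mul_eq_zero.1 h with h | h
    · rw [Finset.prod_eq_zero_iff] at h
      obtain ⟨_, -, h⟩ := h
      rcases mul_eq_zero.1 h with h | h
      · exact Or.inl (sub_eq_zero.1 h)
      · exact Or.inr (Or.inl (sub_eq_zero.1 h))
    · rw [det_smul, det_one, mul_one, Fintype.card_fin] at h
      right; right
      refine ⟨fun h0 => by simp [h0] at h, ?_⟩
      exact (sub_eq_zero.1 (eq_zero_of_pow_eq_zero h)).symm

lemma B_pow {F k : Type*} [Field F] [Field k] (φ : F →+* k) (t c0 : F) (α β : k)
    (ht : φ t = α + β) (hc0 : φ c0 = α * β) (hne : α ≠ β) (N : ℕ) (hα : α ^ N = 1) (hβ : β ^ N = 1) :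
    (!![0, -c0; 1, t] : Matrix (Fin 2) (Fin 2) F) ^ N = 1 := by
  open Polynomial in
  have hdvd : ((X - C α) * (X - C β) : k[X]) ∣ X ^ N - 1 := by
    apply IsCoprime.mul_dvd
    · exact pairwise_coprime_X_sub_C (s := (id : k → k)) (fun _ _ h => h) hne
    · rw [dvd_iff_isRoot]; simp [hα]
    · rw [dvd_iff_isRoot]; simp [hβ]
  obtain ⟨Q, hQ⟩ := hdvd
  set M : Matrix (Fin 2) (Fin 2) k := φ.mapMatrix !![0, -c0; 1, t] with hM
  have hM' : M = !![0, -(α * β); 1, α + β] := by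
    rw [hM]
    ext i j; fin_cases i <;> fin_cases j <;> simp [ht, hc0]
  have h1 := congrArg (Polynomial.aeval M) hQ
  have h2 : (M - algebraMap k _ α) * (M - algebraMap k _ β) = 0 := by
    rw [hM', algebraMap_eq_diagonal, algebraMap_eq_diagonal]
    ext i j
    fin_cases i <;> fin_cases j <;> simp [Matrix.mul_apply, Fin.sum_univ_two] <;> ring
  simp only [map_sub, map_pow, map_mul, Polynomial.aeval_X, map_one, Polynomial.aeval_C] at h1
  rw [h2, zero_mul] at h1
  have h3 : φ.mapMatrix ((!![0, -c0; 1, t] : Matrix (Fin 2) (Fin 2) F) ^ N) = φ.mapMatrix 1 := by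
    rw [map_pow, map_one]; exact sub_eq_zero.1 h1
  ext i j
  have := congrFun (congrFun h3 i) j
  exact φ.injective this

lemma comm_scalar {κ F : Type*} [Fintype κ] [DecidableEq κ] [Field F] (h20 : (2 : F) ≠ 0) (a b : F)
    (hab : a ^ 2 + b ^ 2 = -1) (y : GL (Fin 2 ⊕ κ) F) (h1 : Commute y (emb2 κ qI))
    (h2 : Commute y (emb2 κ (qJ a b hab))) :
    ∃ l : F, ∀ u : Fin 2 → F, (y : Matrix (Fin 2 ⊕ κ) (Fin 2 ⊕ κ) F) *ᵥ (Sum.elim u 0) = l • Sum.elim u 0 := by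
  have h3 : Commute y (emb2 κ (-1)) := by
    rw [← qI_sq, map_mul]; exact h1.mul_right h1
  have e1 := congrArg (fun A : GL (Fin 2 ⊕ κ) F => (A : Matrix (Fin 2 ⊕ κ) (Fin 2 ⊕ κ) F)) h1.eq
  have e2 := congrArg (fun A : GL (Fin 2 ⊕ κ) F => (A : Matrix (Fin 2 ⊕ κ) (Fin 2 ⊕ κ) F)) h2.eq
  have e3 := congrArg (fun A : GL (Fin 2 ⊕ κ) F => (A : Matrix (Fin 2 ⊕ κ) (Fin 2 ⊕ κ) F)) h3.eq
  simp only [Units.val_mul, emb2_coe] at e1 e2 e3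
  set Y := (y : Matrix (Fin 2 ⊕ κ) (Fin 2 ⊕ κ) F) with hY
  rw [← fromBlocks_toBlocks Y, fromBlocks_multiply, fromBlocks_multiply] at e1 e2 e3
  have b1 := (fromBlocks_inj.1 e1).1
  have b2 := (fromBlocks_inj.1 e2).1
  have b3 := (fromBlocks_inj.1 e3).2.2.1
  rw [qI_coe, Matrix.zero_mul, Matrix.mul_zero, add_zero, add_zero] at b1
  rw [qJ_coe, Matrix.zero_mul, Matrix.mul_zero, add_zero, add_zero] at b2
  simp at b3
  have hz : Y.toBlocks₂₁ = 0 := by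
    have : (2 : F) • Y.toBlocks₂₁ = 0 := by
      rw [two_smul]; nth_rewrite 1 [← b3]; simp
    exact (smul_eq_zero.1 this).resolve_left h20
  set A := Y.toBlocks₁₁
  have f1 : ∀ i j : Fin 2, (A * (!![0, -1; 1, 0] : Matrix (Fin 2) (Fin 2) F)) i j
      = ((!![0, -1; 1, 0] : Matrix (Fin 2) (Fin 2) F) * A) i j := fun i j => by rw [b1]
  have f2 : ∀ i j : Fin 2, (A * (!![a, b; b, -a] : Matrix (Fin 2) (Fin 2) F)) i j
      = ((!![a, b; b, -a] : Matrix (Fin 2) (Fin 2) F) * A) i j := fun i j => by rw [b2]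
  have g1 := f1 0 0
  have g2 := f1 0 1
  have g3 := f2 0 0
  have g4 := f2 0 1
  simp [Matrix.mul_apply, Fin.sum_univ_two] at g1 g2 g3 g4
  have k1 : b * A 0 1 = 0 := by
    have : (2 : F) * (b * A 0 1) = 0 := by linear_combination g3 + b * g1
    exact (mul_eq_zero.1 this).resolve_left h20
  have k2 : a * A 0 1 = 0 := by
    have : (2 : F) * (a * A 0 1) = 0 := by linear_combination -g4 + b * g2
    exact (mul_eq_zero.1 this).resolve_left h20
  have k3 : A 0 1 = 0 := by
    linear_combination (A 0 1) * hab - a * k2 - b * k1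
  have k4 : A 1 0 = 0 := by rw [← neg_eq_zero]; rw [← g1, k3]
  refine ⟨A 0 0, fun u => ?_⟩
  rw [← fromBlocks_toBlocks Y, fromBlocks_mulVec, hz]
  ext (i | i)
  · fin_cases i
    · simp [mulVec, dotProduct, Fin.sum_univ_two]
      show A 0 0 * _ + A 0 1 * _ = A 0 0 * _
      rw [k3]; ring
    · simp [mulVec, dotProduct, Fin.sum_univ_two]
      show A 1 0 * _ + A 1 1 * _ = A 0 0 * _
      rw [k4]; linear_combination -u 1 * g2
  · simp

lemma embB_eig (m c : ℕ) (hc : c ≤ 1) {F : Type*} [Field F] (t c0 l : F) (hl : l ^ 2 - t * l + c0 ≠ 0)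
    (w0 w1 : (Fin 2 ⊕ ((Fin 2 × Fin m) ⊕ Fin c)) → F)
    (h0 : embB m c F !![0, -c0; 1, t] *ᵥ w0 = l • w0)
    (h1 : embB m c F !![0, -c0; 1, t] *ᵥ w1 = l • w1) :
    ∃ r s : F, (r ≠ 0 ∨ s ≠ 0) ∧ r • w0 + s • w1 = 0 := by
  have aux : ∀ u v : F, -c0 * v = l * u → u + t * v = l * v → u = 0 ∧ v = 0 := by
    intro u v e1 e2
    have hv : v = 0 := by
      have : (l ^ 2 - t * l + c0) * v = 0 := by linear_combination -e1 - l * e2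
      exact (mul_eq_zero.1 this).resolve_left hl
    exact ⟨by rw [hv] at e2; simpa using e2, hv⟩
  have key : ∀ w : (Fin 2 ⊕ ((Fin 2 × Fin m) ⊕ Fin c)) → F,
      embB m c F !![0, -c0; 1, t] *ᵥ w = l • w →
      (∀ i, w (Sum.inl i) = 0) ∧ ∀ i, w (Sum.inr (Sum.inl i)) = 0 := by
    intro w hw
    rw [embB_apply, fromBlocks_mulVec] at hw
    constructor
    · have e0 := congrFun hw (Sum.inl 0)
      have e1 := congrFun hw (Sum.inl 1)
      simp [mulVec, dotProduct, Fin.sum_univ_two] at e0 e1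
      obtain ⟨q0, q1⟩ := aux _ _ (by linear_combination e0) e1
      intro i; fin_cases i
      · exact q0
      · exact q1
    · rintro ⟨i, k⟩
      have e0 := congrFun hw (Sum.inr (Sum.inl (0, k)))
      have e1 := congrFun hw (Sum.inr (Sum.inl (1, k)))
      simp [mulVec, dotProduct, Fin.sum_univ_two, Fintype.sum_prod_type, blockDiagonal_apply] at e0 e1
      obtain ⟨q0, q1⟩ := aux _ _ (by linear_combination e0) e1
      fin_cases i
      · exact q0
      · exact q1
  obtain ⟨k0, k0'⟩ := key w0 h0
  obtain ⟨k1, k1'⟩ := key w1 h1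
  by_cases h : w0 = 0
  · exact ⟨1, 0, by simp, by simp [h]⟩
  have hcc : ∃ i : Fin c, w0 (Sum.inr (Sum.inr i)) ≠ 0 := by
    by_contra! hh
    apply h
    ext (i | (i | i))
    · exact k0 i
    · exact k0' i
    · exact hh i
  obtain ⟨i0, hi0⟩ := hcc
  refine ⟨w1 (Sum.inr (Sum.inr i0)), -w0 (Sum.inr (Sum.inr i0)), Or.inr (neg_ne_zero.2 hi0), ?_⟩
  ext (i | (i | i))
  · simp [k0, k1]
  · simp [k0', k1']
  · have : i = i0 := Fin.ext (by omega)
    subst this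
    simp; ring

theorem caseCB {π : Set ℕ} (h2 : 2 ∈ π) (h3 : 3 ∈ π) {F : Type*} (m c : ℕ) (hc : c ≤ 1)
    [Field F] [Fintype F] (h20 : (2 : F) ≠ 0) (p : ℕ) [Fact p.Prime] [CharP F p] (hp : p ∉ π)
    (φ : F →+* AlgebraicClosure (ZMod p))
    {S : Subgroup (GL (Fin 2 ⊕ ((Fin 2 × Fin m) ⊕ Fin c)) F)} (hS : Core π S) (N : ℕ)
    (hNπ : IsPiNumber π N) (hN : 0 < N)
    (hyp : ∀ ζ : AlgebraicClosure (ZMod p), IsPrimitiveRoot ζ N → ∃ t c0 : F, ∃ i j A A' : ℕ,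
      A ≤ i ∧ i ≤ A' ∧ A ≤ j ∧ j ≤ A' ∧ 6 * (A' - A) ≤ N ∧
      (c ≠ 0 → ∃ k, A ≤ k ∧ k ≤ A' ∧ ζ ^ k = 1) ∧ φ t = ζ ^ i + ζ ^ j ∧ φ c0 = ζ ^ i * ζ ^ j ∧
      ζ ^ i ≠ ζ ^ j ∧ ζ ^ i ∉ φ.range ∧ ζ ^ j ∉ φ.range ∧ (c0 = 1 ∨ ∃ k, N = 2 ^ k)) : False := by
  obtain ⟨a, b, hab⟩ := exists_ab (F := F)
  obtain ⟨S, hS, hI, hJ, hW⟩ := hS.stdL h2 h3 h20 a b hab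
  obtain ⟨ζ, hζ, hT⟩ := lemTZ p hp N hN hNπ
  obtain ⟨t, c0, i, j, A, A', hAi, hiA, hAj, hjA, h6, hk, ht, hc0, hne, hri, hrj, hor⟩ := hyp ζ hζ
  have hpw : ∀ i, (ζ ^ i) ^ N = 1 := fun i => by
    rw [← pow_mul, mul_comm, pow_mul, hζ.pow_eq_one, one_pow]
  have hB := B_pow φ t c0 _ _ ht hc0 hne N (hpw i) (hpw j)
  have hE : embB m c F !![0, -c0; 1, t] ^ N = 1 := by rw [← map_pow, hB, map_one]
  let x : GL (Fin 2 ⊕ ((Fin 2 × Fin m) ⊕ Fin c)) F := Units.ofPowEqOne _ N hE hN.ne'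
  have hxc : (x : Matrix _ _ F) = embB m c F !![0, -c0; 1, t] := rfl
  have hx : x ^ N = 1 := Units.pow_ofPowEqOne hE hN.ne'
  have hg : ∃ g, g * x * g⁻¹ ∈ S := by
    rcases hor with h | ⟨k, hk⟩
    · obtain ⟨g, hg⟩ := hS.2.1 (Subgroup.zpowers x) (piN_zpowers x N hNπ hx) (by
        have : Subgroup.zpowers x ≤ (Matrix.GeneralLinearGroup.det).ker := by
          rw [Subgroup.zpowers_le, MonoidHom.mem_ker]
          apply Units.ext
          rw [Matrix.GeneralLinearGroup.val_det_apply, hxc, embB_det]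
          · simp
          · simp [det_fin_two_of, h]
        intro k hk
        have h5 := this hk
        rw [MonoidHom.mem_ker] at h5
        have := congrArg Units.val h5
        simpa using this)
      exact ⟨g, hg x (Subgroup.mem_zpowers x)⟩
    · obtain ⟨g, hg⟩ := hS.2.2 2 h2 Nat.prime_two (Subgroup.zpowers x) (by
        rintro ⟨_, ⟨l, rfl⟩⟩
        refine ⟨k, Subtype.ext ?_⟩
        show (x ^ l) ^ 2 ^ k = 1
        rw [← hk, ← zpow_natCast, ← _root_.zpow_mul, mul_comm, _root_.zpow_mul, _root_.zpow_natCast, hx,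
          _root_.one_zpow])
      exact ⟨g, hg x (Subgroup.mem_zpowers x)⟩
  obtain ⟨g, hg⟩ := hg
  obtain ⟨c1, c2⟩ := hT _ F φ h20 S hS.1 a b hab hI hJ hW g x hg A A' h6 hx (by
    intro μ hμ
    rw [hxc] at hμ
    rcases embB_spec m c φ t c0 _ _ ht hc0 μ hμ with h | h | ⟨h, h'⟩
    · exact ⟨i, hAi, hiA, h⟩
    · exact ⟨j, hAj, hjA, h⟩
    · obtain ⟨k, h5, h6, h7⟩ := hk h
      exact ⟨k, h5, h6, by rw [h7, h']⟩)
  obtain ⟨l, hl⟩ := comm_scalar h20 a b hab _ c1 c2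
  have hlp : l ^ 2 - t * l + c0 ≠ 0 := by
    intro h0
    have := congrArg φ h0
    rw [map_add, map_sub, map_pow, map_mul, ht, hc0, map_zero] at this
    have h5 : (φ l - ζ ^ i) * (φ l - ζ ^ j) = 0 := by linear_combination this
    rcases mul_eq_zero.1 h5 with h | h
    · exact hri ⟨l, sub_eq_zero.1 h⟩
    · exact hrj ⟨l, sub_eq_zero.1 h⟩
  set G' : Matrix (Fin 2 ⊕ ((Fin 2 × Fin m) ⊕ Fin c)) (Fin 2 ⊕ ((Fin 2 × Fin m) ⊕ Fin c)) F :=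
    ((g⁻¹ : GL (Fin 2 ⊕ ((Fin 2 × Fin m) ⊕ Fin c)) F) :
      Matrix (Fin 2 ⊕ ((Fin 2 × Fin m) ⊕ Fin c)) (Fin 2 ⊕ ((Fin 2 × Fin m) ⊕ Fin c)) F) with hG'
  have hw : ∀ u : Fin 2 → F, embB m c F !![0, -c0; 1, t] *ᵥ
      (G' *ᵥ (Sum.elim u 0)) =
        l • (G' *ᵥ (Sum.elim u 0)) := by
    intro u
    rw [← mulVec_smul, ← hl u, mulVec_mulVec, mulVec_mulVec, ← hxc, hG', ← Units.val_mul, ← Units.val_mul]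
    congr 2
    group
  obtain ⟨r, s, hrs, h0⟩ := embB_eig m c hc t c0 l hlp _ _ (hw ![1, 0]) (hw ![0, 1])
  rw [← mulVec_smul, ← mulVec_smul, ← mulVec_add] at h0
  have h5 := congrArg (fun v => (g : Matrix (Fin 2 ⊕ ((Fin 2 × Fin m) ⊕ Fin c)) (Fin 2 ⊕ ((Fin 2 × Fin m) ⊕ Fin c)) F) *ᵥ v) h0
  simp only [mulVec_mulVec, mulVec_zero] at h5
  rw [hG', ← Units.val_mul, mul_inv_cancel, Units.val_one, one_mulVec] at h5
  have f0 := congrFun h5 (Sum.inl 0)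
  have f1 := congrFun h5 (Sum.inl 1)
  simp at f0 f1
  rcases hrs with h | h
  · exact h f0
  · exact h f1
end CaseCB

section CaseC2
open Matrix

lemma mem_range_of_pow {F k : Type*} [Field F] [Fintype F] [Field k] (φ : F →+* k) (y : k)
    (h : y ^ Fintype.card F = y) : y ∈ φ.range := by
  open Polynomial in
  have h1 : ((X ^ Fintype.card F - X : F[X]).roots.map fun a => X - C a).prod
      = (X ^ Fintype.card F - X : F[X]) := by
    apply prod_multiset_X_sub_C_of_monic_of_roots_card_eq
    · apply monic_X_pow_sub
      rw [degree_X]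
      exact_mod_cast Fintype.one_lt_card
    · rw [FiniteField.roots_X_pow_card_sub_X, FiniteField.X_pow_card_sub_X_natDegree_eq]
      · rfl
      · exact Fintype.one_lt_card
  rw [FiniteField.roots_X_pow_card_sub_X] at h1
  have h2 : (Polynomial.eval₂RingHom φ y) (∏ a : F, (Polynomial.X - Polynomial.C a)) = 0 := by
    have := congrArg (Polynomial.eval₂RingHom φ y) h1
    rw [Finset.prod_eq_multiset_prod, this]
    simp [h]
  rw [map_prod] at h2
  obtain ⟨a, -, ha⟩ := Finset.prod_eq_zero_iff.1 h2
  simp only [Polynomial.coe_eval₂RingHom, Polynomial.eval₂_sub, Polynomial.eval₂_X, Polynomial.eval₂_C] at ha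
  exact ⟨a, (sub_eq_zero.1 ha).symm⟩

lemma pow_of_mem_range {F k : Type*} [Field F] [Fintype F] [Field k] (φ : F →+* k) (y : k)
    (h : y ∈ φ.range) : y ^ Fintype.card F = y := by
  obtain ⟨a, rfl⟩ := h
  rw [← map_pow, FiniteField.pow_card]

lemma frob_add {F k : Type*} [Field F] [Fintype F] [Field k] (p : ℕ) [Fact p.Prime] [CharP F p]
    [CharP k p] (y z : k) :
    (y + z) ^ Fintype.card F = y ^ Fintype.card F + z ^ Fintype.card F := by
  obtain ⟨n, -, hn⟩ := FiniteField.card F p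
  rw [hn, add_pow_char_pow]

theorem caseC2 {π : Set ℕ} (h2 : 2 ∈ π) (h3 : 3 ∈ π) {F : Type*} (m c : ℕ) (hc : c ≤ 1)
    [Field F] [Fintype F] (h20 : (2 : F) ≠ 0) (p : ℕ) [Fact p.Prime] [CharP F p] (hp : p ∉ π)
    {S : Subgroup (GL (Fin 2 ⊕ ((Fin 2 × Fin m) ⊕ Fin c)) F)} (hS : Core π S) (N : ℕ)
    (hNπ : IsPiNumber π N) (hN : 12 ≤ N) (hd : N ∣ Fintype.card F + 1) : False := by
  obtain ⟨φ⟩ := exists_phi (F := F) p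
  refine caseCB h2 h3 m c hc h20 p hp φ hS N hNπ (by omega) ?_
  intro ζ hζ
  have hN1 := hζ.pow_eq_one
  have e1 : ζ ^ (N + 1) = ζ := by rw [pow_succ, hN1, one_mul]
  have e2 : ζ ^ (N - 1) * ζ = 1 := by rw [← pow_succ, Nat.sub_add_cancel (by omega), hN1]
  have e3 : ζ ^ Fintype.card F * ζ = 1 := by
    rw [← pow_succ]; obtain ⟨r, hr⟩ := hd; rw [hr, pow_mul, hN1, one_pow]
  have h0 : ζ ≠ 0 := by rintro rfl; simp at e3
  have e4 : ζ ^ Fintype.card F = ζ ^ (N - 1) := mul_right_cancel₀ h0 (e3.trans e2.symm)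
  have e5 : (ζ ^ (N - 1)) ^ Fintype.card F = ζ := by
    have : (ζ ^ (N - 1)) ^ Fintype.card F * ζ ^ (N - 1) = ζ * ζ ^ (N - 1) := by
      rw [← e4, ← pow_mul, mul_comm ζ, e3, ← pow_add]
      rw [← mul_add_one, mul_comm, pow_mul, pow_succ, e3, one_pow]
    exact mul_right_cancel₀ (pow_ne_zero _ h0) this
  have hne : ζ ≠ ζ ^ (N - 1) := by
    intro h
    rw [← h, ← pow_two] at e2
    have := Nat.le_of_dvd (by norm_num) (hζ.dvd_of_pow_eq_one _ e2)
    omega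
  obtain ⟨t, ht⟩ := mem_range_of_pow φ (ζ + ζ ^ (N - 1)) (by
    rw [frob_add p, e4, e5, add_comm])
  refine ⟨t, 1, N + 1, N - 1, N - 1, N + 1, by omega, by omega, by omega, by omega, by omega,
    fun _ => ⟨N, by omega, by omega, hN1⟩, ?_, ?_, ?_, ?_, ?_, Or.inl rfl⟩
  · rw [ht, e1]
  · rw [map_one, e1, mul_comm, e2]
  · rwa [e1]
  · intro h
    rw [e1] at h
    exact hne ((pow_of_mem_range φ _ h).symm.trans e4)
  · intro h
    have := pow_of_mem_range φ _ h
    rw [e5] at this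
    exact hne this

theorem caseC68 {π : Set ℕ} (h2 : 2 ∈ π) (h3 : 3 ∈ π) {F : Type*}
    [Field F] [Fintype F] (h20 : (2 : F) ≠ 0) (p : ℕ) [Fact p.Prime] [CharP F p] (hp : p ∉ π)
    {S : Subgroup (GL (Fin 2 ⊕ ((Fin 2 × Fin 0) ⊕ Fin 0)) F)} (hS : Core π S)
    (hd : Fintype.card F % 16 = 7) : False := by
  obtain ⟨φ⟩ := exists_phi (F := F) p
  refine caseCB h2 h3 0 0 (by norm_num) h20 p hp φ hS 16 ?_ (by omega) ?_
  · exact (IsPiNumber.prime Nat.prime_two h2).pow 4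
  intro ζ hζ
  have hN1 := hζ.pow_eq_one
  have hq : ζ ^ Fintype.card F = ζ ^ 7 := by
    rw [← Nat.div_add_mod (Fintype.card F) 16, hd, pow_add, pow_mul, hN1, one_pow, one_mul]
  have e3 : (ζ ^ 3) ^ Fintype.card F = ζ ^ 5 := by
    rw [← pow_mul, mul_comm, pow_mul, hq]
    linear_combination ζ ^ 5 * hN1
  have e5 : (ζ ^ 5) ^ Fintype.card F = ζ ^ 3 := by
    rw [← pow_mul, mul_comm, pow_mul, hq]
    linear_combination (ζ ^ 19 + ζ ^ 3) * hN1
  have h0 : ζ ≠ 0 := by rintro rfl; simp at hN1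
  have hne : ζ ^ 3 ≠ ζ ^ 5 := by
    intro h
    have : ζ ^ 2 = 1 := mul_left_cancel₀ (pow_ne_zero 3 h0) (by linear_combination -h)
    have := Nat.le_of_dvd (by norm_num) (hζ.dvd_of_pow_eq_one _ this)
    omega
  have h8 : ζ ^ 8 = -1 := by
    have : (ζ ^ 8 - 1) * (ζ ^ 8 + 1) = 0 := by linear_combination hN1
    rcases mul_eq_zero.1 this with h | h
    · have := Nat.le_of_dvd (by norm_num) (hζ.dvd_of_pow_eq_one 8 (sub_eq_zero.1 h))
      omega
    · exact eq_neg_of_add_eq_zero_left h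
  obtain ⟨t, ht⟩ := mem_range_of_pow φ (ζ ^ 3 + ζ ^ 5) (by
    rw [frob_add p, e3, e5, add_comm])
  refine ⟨t, -1, 3, 5, 3, 5, by omega, by omega, by omega, by omega, by omega,
    fun h => absurd rfl h, ht, ?_, hne, ?_, ?_, Or.inr ⟨4, by norm_num⟩⟩
  · rw [map_neg, map_one, ← pow_add, h8]
  · intro h
    have := pow_of_mem_range φ _ h
    rw [e3] at this
    exact hne this.symm
  · intro h
    have := pow_of_mem_range φ _ h
    rw [e5] at this
    exact hne this
end CaseC2

section TraceLemma
open Matrix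

/-- Trace restrictions on two by two matrices of determinant one and finite order. -/
def Tr5 (π : Set ℕ) (F : Type*) [Field F] (E : Prop) : Prop :=
  ∀ (M : Matrix (Fin 2) (Fin 2) F) (m : ℕ), 0 < m → IsPiNumber π m → M ^ m = 1 → M.det = 1 →
    M = 1 ∨ M = -1 ∨ M.trace = 0 ∨ M.trace = 1 ∨ M.trace = -1 ∨ (E ∧ M.trace ^ 2 = 2)

lemma sq_two {F : Type*} [Field F] (M : Matrix (Fin 2) (Fin 2) F) (hd : M.det = 1) :
    M * M = M.trace • M - 1 := by
  rw [det_fin_two] at hd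
  rw [trace_fin_two]
  ext i j
  fin_cases i <;> fin_cases j <;> simp [Matrix.mul_apply, Fin.sum_univ_two] <;>
    first | ring1 | linear_combination -hd

lemma unip {F : Type*} [Field F] (M : Matrix (Fin 2) (Fin 2) F) (hd : M.det = 1) (ht : M.trace = 2)
    (m : ℕ) (hm : (m : F) ≠ 0) (h : M ^ m = 1) : M = 1 := by
  have h2 := sq_two M hd
  rw [ht] at h2
  have key : ∀ k : ℕ, M ^ k = 1 + (k : F) • (M - 1) := by
    intro k
    induction k with
    | zero => simp
    | succ k ih =>
      rw [pow_succ, ih, add_mul, one_mul, smul_mul_assoc, sub_mul, h2, one_mul]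
      push_cast
      module
  rw [key m] at h
  have : (m : F) • (M - 1) = 0 := by simpa using h
  exact sub_eq_zero.1 ((smul_eq_zero.1 this).resolve_left hm)

lemma trace_root {F : Type*} [Field F] [Fintype F] (h20 : (2 : F) ≠ 0) (p : ℕ) [Fact p.Prime] [CharP F p]
    (φ : F →+* AlgebraicClosure (ZMod p)) (M : Matrix (Fin 2) (Fin 2) F) (hd : M.det = 1) (m : ℕ)
    (h : M ^ m = 1) :
    ∃ τ : AlgebraicClosure (ZMod p), τ ^ m = 1 ∧ φ M.trace * τ = τ ^ 2 + 1 ∧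
      (τ ^ (Fintype.card F - 1) = 1 ∨ τ ^ (Fintype.card F + 1) = 1) := by
  have h2k : (2 : AlgebraicClosure (ZMod p)) ≠ 0 := by
    intro h0; apply h20; apply φ.injective; rw [map_ofNat, map_zero]; exact h0
  obtain ⟨s, hs⟩ := IsAlgClosed.exists_pow_nat_eq ((φ M.trace) ^ 2 - 4) (n := 2) (by norm_num)
  set T := φ M.trace with hT
  obtain ⟨τ, hτ⟩ : ∃ τ, 2 * τ = T + s := ⟨(T + s) / 2, by field_simp⟩
  have e1 : T * τ = τ ^ 2 + 1 := by
    have : (4 : AlgebraicClosure (ZMod p)) * (T * τ - (τ ^ 2 + 1)) = 0 := by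
      linear_combination (2 * T - 2 * τ - (T + s)) * hτ - hs
    have h4 : (4 : AlgebraicClosure (ZMod p)) ≠ 0 := by
      have : (4 : AlgebraicClosure (ZMod p)) = 2 * 2 := by norm_num
      rw [this]; exact mul_ne_zero h2k h2k
    exact sub_eq_zero.1 ((mul_eq_zero.1 this).resolve_left h4)
  have h0 : τ ≠ 0 := by rintro rfl; simp at e1
  refine ⟨τ, ?_, e1, ?_⟩
  · set Mφ : Matrix (Fin 2) (Fin 2) (AlgebraicClosure (ZMod p)) := φ.mapMatrix M with hMφ
    have hdet : (Mφ - τ • (1 : Matrix (Fin 2) (Fin 2) (AlgebraicClosure (ZMod p)))).det = 0 := by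
      have hd' : Mφ.det = 1 := by rw [hMφ, ← RingHom.map_det, hd, map_one]
      have ht' : Mφ.trace = T := by
        rw [hT, trace_fin_two, trace_fin_two, map_add]; rfl
      rw [det_fin_two] at hd' ⊢
      rw [trace_fin_two] at ht'
      simp
      linear_combination hd' - e1 - τ * ht'
    obtain ⟨v, hv, hvv⟩ := exists_mulVec_eq_zero_iff.2 hdet
    rw [sub_mulVec, smul_mulVec, one_mulVec, sub_eq_zero] at hvv
    have hk : ∀ k : ℕ, (Mφ ^ k) *ᵥ v = τ ^ k • v := by
      intro k
      induction k with
      | zero => simp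
      | succ k ih => rw [pow_succ, ← mulVec_mulVec, hvv, mulVec_smul, ih, smul_smul, pow_succ, mul_comm]
    have hm := hk m
    rw [hMφ, ← map_pow, h, map_one, one_mulVec] at hm
    have : (1 - τ ^ m) • v = 0 := by rw [sub_smul, one_smul, ← hm, sub_self]
    exact (sub_eq_zero.1 ((smul_eq_zero.1 this).resolve_right hv)).symm
  · have hTq : T ^ Fintype.card F = T := pow_of_mem_range φ _ ⟨_, rfl⟩
    have e2 := congrArg (fun y => y ^ Fintype.card F) e1
    simp only [mul_pow, frob_add (F := F) p, one_pow, hTq] at e2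
    rw [← pow_mul, mul_comm 2, pow_mul] at e2
    have e3 : (τ ^ Fintype.card F - τ) * (τ ^ Fintype.card F * τ - 1) = 0 := by
      linear_combination τ * e2 - (τ ^ Fintype.card F) * e1 - 2 * (τ * e2 - (τ ^ Fintype.card F) * e1)
    have hq : 0 < Fintype.card F := Fintype.card_pos
    rcases mul_eq_zero.1 e3 with h | h
    · left
      apply mul_right_cancel₀ h0
      rw [← pow_succ, Nat.sub_add_cancel hq, one_mul]; exact sub_eq_zero.1 h
    · right
      rw [pow_succ]; exact sub_eq_zero.1 h

theorem tr5 {π : Set ℕ} {F : Type*} [Field F] [Fintype F] (h20 : (2 : F) ≠ 0) (p : ℕ) [Fact p.Prime]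
    [CharP F p] (hp : p ∉ π) (E : Prop)
    (hord : ∀ r, IsPiNumber π r → (r ∣ Fintype.card F - 1 ∨ r ∣ Fintype.card F + 1) →
      r ∣ 4 ∨ r ∣ 6 ∨ (E ∧ r ∣ 8)) : Tr5 π F E := by
  intro M m hm hmπ hM hd
  obtain ⟨φ⟩ := exists_phi (F := F) p
  have hmF : (m : F) ≠ 0 := by
    rw [Ne, CharP.cast_eq_zero_iff F p]
    exact fun h => hp (hmπ p Fact.out h)
  have h2F : ((2 * m : ℕ) : F) ≠ 0 := by push_cast; exact mul_ne_zero h20 hmF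
  have hm1 : M.trace = 2 → M = 1 := fun ht => unip M hd ht m hmF hM
  have hm2 : M.trace = -2 → M = -1 := by
    intro ht
    have := unip (-M) (by rw [det_neg, hd]; simp) (by rw [trace_neg, ht, neg_neg]) (2 * m) h2F
      (by rw [pow_mul, neg_sq, ← pow_mul, mul_comm, pow_mul, hM, one_pow])
    rw [← this, neg_neg]
  obtain ⟨τ, h1, h2, h3⟩ := trace_root h20 p φ M hd m hM
  have h0 : τ ≠ 0 := by rintro rfl; simp at h2
  have hr := hord (orderOf τ) (hmπ.of_dvd (orderOf_dvd_of_pow_eq_one h1))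
    (h3.imp orderOf_dvd_of_pow_eq_one orderOf_dvd_of_pow_eq_one)
  have hinj : ∀ c : F, φ M.trace * τ = φ c * τ → M.trace = c := fun c hc =>
    φ.injective (mul_right_cancel₀ h0 hc)
  have c1 : τ - 1 = 0 → M = 1 := by
    intro h; apply hm1; apply hinj; rw [h2, map_ofNat]
    linear_combination (τ - 1) * h
  have c2 : τ + 1 = 0 → M = -1 := by
    intro h; apply hm2; apply hinj; rw [h2, map_neg, map_ofNat]
    linear_combination (τ + 1) * h
  have c3 : τ ^ 2 + 1 = 0 → M.trace = 0 := by
    intro h; apply hinj; rw [h2, map_zero]; linear_combination h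
  rcases hr with hr | hr | ⟨hE, hr⟩
  · have h4 := orderOf_dvd_iff_pow_eq_one.1 hr
    have : (τ - 1) * ((τ + 1) * (τ ^ 2 + 1)) = 0 := by linear_combination h4
    rcases mul_eq_zero.1 this with h | h
    · exact Or.inl (c1 h)
    rcases mul_eq_zero.1 h with h | h
    · exact Or.inr (Or.inl (c2 h))
    · exact Or.inr (Or.inr (Or.inl (c3 h)))
  · have h4 := orderOf_dvd_iff_pow_eq_one.1 hr
    have : (τ - 1) * ((τ + 1) * ((τ ^ 2 + τ + 1) * (τ ^ 2 - τ + 1))) = 0 := by linear_combination h4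
    rcases mul_eq_zero.1 this with h | h
    · exact Or.inl (c1 h)
    rcases mul_eq_zero.1 h with h | h
    · exact Or.inr (Or.inl (c2 h))
    rcases mul_eq_zero.1 h with h | h
    · right; right; right; right; left
      apply hinj; rw [h2, map_neg, map_one]; linear_combination h
    · right; right; right; left
      apply hinj; rw [h2, map_one]; linear_combination h
  · have h4 := orderOf_dvd_iff_pow_eq_one.1 hr
    have : (τ - 1) * ((τ + 1) * ((τ ^ 2 + 1) * (τ ^ 4 + 1))) = 0 := by linear_combination h4
    rcases mul_eq_zero.1 this with h | h
    · exact Or.inl (c1 h)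
    rcases mul_eq_zero.1 h with h | h
    · exact Or.inr (Or.inl (c2 h))
    rcases mul_eq_zero.1 h with h | h
    · exact Or.inr (Or.inr (Or.inl (c3 h)))
    · right; right; right; right; right
      refine ⟨hE, φ.injective ?_⟩
      rw [map_pow, map_ofNat]
      apply mul_right_cancel₀ (pow_ne_zero 2 h0)
      rw [← mul_pow, h2]
      linear_combination h
end TraceLemma

section Refl
open Matrix
set_option linter.unusedSectionVars false
variable {ι F : Type*} [Fintype ι] [DecidableEq ι] [Field F]

/-- The reflection with eigenvalue `ε`, centre `v` and axis `f`. -/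
def rfm (ε : F) (v f : ι → F) : Matrix ι ι F := 1 + (ε - 1) • vecMulVec v f

lemma rfm_mulVec (ε : F) (v f w : ι → F) :
    rfm ε v f *ᵥ w = w + ((ε - 1) * (f ⬝ᵥ w)) • v := by
  rw [rfm, add_mulVec, one_mulVec, smul_mulVec, vecMulVec_mulVec]
  congr 1
  rw [mul_smul]
  congr 1
  ext i
  simp [mul_comm]

lemma rfm_mul (ε δ : F) (v f : ι → F) (h : f ⬝ᵥ v = 1) :
    rfm ε v f * rfm δ v f = rfm (ε * δ) v f := by
  have h2 : vecMulVec v f * vecMulVec v f = vecMulVec v f := by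
    rw [vecMulVec_mul_vecMulVec, h]; simp
  simp only [rfm, add_mul, mul_add, one_mul, mul_one, smul_mul_assoc, mul_smul_comm, h2]
  module

lemma rfm_one (v f : ι → F) : rfm 1 v f = 1 := by simp [rfm]

lemma rfm_inv (R : GL ι F) (ε : F) (h0 : ε ≠ 0) (v f : ι → F) (h : f ⬝ᵥ v = 1)
    (hR : (R : Matrix ι ι F) = rfm ε v f) : ((R⁻¹ : GL ι F) : Matrix ι ι F) = rfm ε⁻¹ v f := by
  have h1 : (R : Matrix ι ι F) * rfm ε⁻¹ v f = 1 := by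
    rw [hR, rfm_mul _ _ _ _ h, mul_inv_cancel₀ h0, rfm_one]
  exact (Units.inv_eq_of_mul_eq_one_right h1)

lemma rfm_conj (k : GL ι F) (ε : F) (v f : ι → F) :
    (k : Matrix ι ι F) * rfm ε v f * ((k⁻¹ : GL ι F) : Matrix ι ι F) =
      rfm ε ((k : Matrix ι ι F) *ᵥ v) (f ᵥ* ((k⁻¹ : GL ι F) : Matrix ι ι F)) := by
  have : (k : Matrix ι ι F) * ((k⁻¹ : GL ι F) : Matrix ι ι F) = 1 := by
    rw [← Units.val_mul, mul_inv_cancel, Units.val_one]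
  rw [rfm, rfm, mul_add, add_mul, mul_one, this, mul_smul_comm, smul_mul_assoc, mul_vecMulVec,
    vecMulVec_mul]

lemma conj_dot (k : GL ι F) (v f : ι → F) :
    (f ᵥ* ((k⁻¹ : GL ι F) : Matrix ι ι F)) ⬝ᵥ ((k : Matrix ι ι F) *ᵥ v) = f ⬝ᵥ v := by
  rw [← dotProduct_mulVec, mulVec_mulVec, ← Units.val_mul, inv_mul_cancel, Units.val_one, one_mulVec]

/-- The matrix with columns `v` and `w`. -/
def cols (v w : ι → F) : Matrix ι (Fin 2) F := of fun i => ![v i, w i]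

lemma acts_of (X : Matrix ι ι F) (v w : ι → F) (M : Matrix (Fin 2) (Fin 2) F)
    (h0 : X *ᵥ v = M 0 0 • v + M 1 0 • w) (h1 : X *ᵥ w = M 0 1 • v + M 1 1 • w) :
    X * cols v w = cols v w * M := by
  ext i j
  fin_cases j
  · have := congrFun h0 i
    simp [mulVec, dotProduct] at this
    simp [cols, Matrix.mul_apply, Fin.sum_univ_two, this, mul_comm]
  · have := congrFun h1 i
    simp [mulVec, dotProduct] at this
    simp [cols, Matrix.mul_apply, Fin.sum_univ_two, this, mul_comm]

lemma acts_mul {X Y : Matrix ι ι F} {P : Matrix ι (Fin 2) F} {M N : Matrix (Fin 2) (Fin 2) F}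
    (h : X * P = P * M) (h' : Y * P = P * N) : (X * Y) * P = P * (M * N) := by
  rw [Matrix.mul_assoc, h', ← Matrix.mul_assoc, h, Matrix.mul_assoc]

lemma acts_pow {X : Matrix ι ι F} {P : Matrix ι (Fin 2) F} {M : Matrix (Fin 2) (Fin 2) F}
    (h : X * P = P * M) (m : ℕ) : X ^ m * P = P * M ^ m := by
  induction m with
  | zero => simp
  | succ k ih => rw [pow_succ, pow_succ]; exact acts_mul ih h

lemma cols_inj {v w : ι → F} (hli : ∀ r s : F, r • v + s • w = 0 → r = 0 ∧ s = 0)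
    {M N : Matrix (Fin 2) (Fin 2) F} (h : cols v w * M = cols v w * N) : M = N := by
  have key : ∀ j, M 0 j = N 0 j ∧ M 1 j = N 1 j := by
    intro j
    have := hli (M 0 j - N 0 j) (M 1 j - N 1 j) (by
      ext i
      have := congrFun (congrFun h i) j
      simp [cols, Matrix.mul_apply, Fin.sum_univ_two] at this
      simp
      linear_combination this)
    exact ⟨sub_eq_zero.1 this.1, sub_eq_zero.1 this.2⟩
  ext i j
  fin_cases i
  · exact (key j).1
  · exact (key j).2

lemma acts_pow_one {X : Matrix ι ι F} {v w : ι → F} {M : Matrix (Fin 2) (Fin 2) F}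
    (hli : ∀ r s : F, r • v + s • w = 0 → r = 0 ∧ s = 0)
    (h : X * cols v w = cols v w * M) (m : ℕ) (hX : X ^ m = 1) : M ^ m = 1 := by
  have := acts_pow h m
  rw [hX, Matrix.one_mul] at this
  exact (cols_inj hli (by rw [← this, Matrix.mul_one])).symm

lemma acts_rfm (ε : F) (v f w : ι → F) (h : f ⬝ᵥ v = 1) :
    rfm ε v f * cols v w = cols v w * !![ε, (ε - 1) * (f ⬝ᵥ w); 0, 1] := by
  apply acts_of
  · rw [rfm_mulVec, h]; simp; module
  · rw [rfm_mulVec]; simp; module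

lemma acts_rfm' (ε : F) (v g w : ι → F) (h : g ⬝ᵥ w = 1) :
    rfm ε w g * cols v w = cols v w * !![1, 0; (ε - 1) * (g ⬝ᵥ v), ε] := by
  apply acts_of
  · rw [rfm_mulVec]; simp
  · rw [rfm_mulVec, h]; simp; module

lemma pow_of_mem {S : Subgroup (GL ι F)} {X : GL ι F} (h : X ∈ S) :
    (X : Matrix ι ι F) ^ Nat.card S = 1 := by
  have := pow_card_eq_one' (x := (⟨X, h⟩ : S))
  have h2 : X ^ Nat.card S = 1 := congrArg Subtype.val this
  rw [← Units.val_pow_eq_pow_val, h2, Units.val_one]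

/-- Admissible traces. -/
def OKt (E : Prop) (x : F) : Prop := x = 0 ∨ x = 1 ∨ x = -1 ∨ (E ∧ x ^ 2 = 2)

theorem pair_gen [Finite F] {π : Set ℕ} {E : Prop} (hT : Tr5 π F E) (h20 : (2 : F) ≠ 0)
    {S : Subgroup (GL ι F)} (hS : IsPiNumber π (Nat.card S)) (ε : F) (N : ℕ) (hN : 0 < N)
    (hNπ : IsPiNumber π N) (hε : ε ^ N = 1) (h1 : ε ≠ 1) (h1' : ε ≠ -1)
    (R R' : GL ι F) (hRS : R ∈ S) (hRS' : R' ∈ S) (v f w g : ι → F) (hf : f ⬝ᵥ v = 1)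
    (hg : g ⬝ᵥ w = 1) (hR : (R : Matrix ι ι F) = rfm ε v f) (hR' : (R' : Matrix ι ι F) = rfm ε w g)
    (hli : ∀ r s : F, r • v + s • w = 0 → r = 0 ∧ s = 0) :
    OKt E (ε + ε⁻¹ + (2 - ε - ε⁻¹) * ((f ⬝ᵥ w) * (g ⬝ᵥ v))) ∧
    ((f ⬝ᵥ w = 0 ∧ g ⬝ᵥ v = 0) ∨ OKt E (2 - (2 - ε - ε⁻¹) * ((f ⬝ᵥ w) * (g ⬝ᵥ v)))) := by
  have h0 : ε ≠ 0 := by rintro rfl; simp [hN.ne'] at hε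
  have hS0 : 0 < Nat.card S := Nat.card_pos
  have hRi := rfm_inv R' ε h0 w g hg hR'
  constructor
  · have hA := acts_mul (acts_rfm ε v f w hf) (acts_rfm' ε⁻¹ v g w hg)
    rw [← hR, ← hRi, ← Units.val_mul] at hA
    have hp := acts_pow_one hli hA _ (pow_of_mem (mul_mem hRS (inv_mem hRS')))
    have hdet : (!![ε, (ε - 1) * (f ⬝ᵥ w); 0, 1] * !![1, 0; (ε⁻¹ - 1) * (g ⬝ᵥ v), ε⁻¹]).det = 1 := by
      rw [det_mul, det_fin_two_of, det_fin_two_of]; field_simp; ring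
    have htr : (!![ε, (ε - 1) * (f ⬝ᵥ w); 0, 1] * !![1, 0; (ε⁻¹ - 1) * (g ⬝ᵥ v), ε⁻¹]).trace
      = ε + ε⁻¹ + (2 - ε - ε⁻¹) * ((f ⬝ᵥ w) * (g ⬝ᵥ v)) := by
      rw [trace_fin_two]; simp; field_simp; ring
    have h11 : (!![ε, (ε - 1) * (f ⬝ᵥ w); 0, 1] * !![1, 0; (ε⁻¹ - 1) * (g ⬝ᵥ v), ε⁻¹]) 1 1 = ε⁻¹ := by
      simp
    rcases hT _ _ hS0 hS hp hdet with h | h | h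
    · rw [h] at h11; simp at h11
      exact absurd h11 h1
    · rw [h] at h11; simp at h11
      exact absurd (by rw [← inv_inv ε, ← h11]; norm_num) h1'
    · rw [htr] at h
      exact h
  · have hA := acts_mul (acts_rfm ε v f w hf) (acts_rfm' ε v g w hg)
    rw [← hR, ← hR', ← Units.val_mul] at hA
    have hp := acts_pow_one hli hA _ (pow_of_mem (mul_mem hRS hRS'))
    set M := (!![ε, (ε - 1) * (f ⬝ᵥ w); 0, 1] * !![1, 0; (ε - 1) * (g ⬝ᵥ v), ε]) with hM
    have hp' : (ε⁻¹ • M) ^ (N * Nat.card S) = 1 := by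
      rw [smul_pow, pow_mul, mul_comm, pow_mul, inv_pow, hε, hp]; simp
    have hdet : (ε⁻¹ • M).det = 1 := by
      rw [det_smul, hM, det_mul, det_fin_two_of, det_fin_two_of]; simp; field_simp
    have htr : (ε⁻¹ • M).trace = 2 - (2 - ε - ε⁻¹) * ((f ⬝ᵥ w) * (g ⬝ᵥ v)) := by
      rw [trace_smul, trace_fin_two, hM]; simp; field_simp; ring
    have h11 : (ε⁻¹ • M) 1 1 = 1 := by
      rw [hM]; simp [h0]
    have h01 : (ε⁻¹ • M) 0 1 = (ε - 1) * (f ⬝ᵥ w) := by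
      rw [hM]; simp; field_simp
    have h10 : (ε⁻¹ • M) 1 0 = ε⁻¹ * ((ε - 1) * (g ⬝ᵥ v)) := by
      rw [hM]; simp
    rcases hT _ _ (Nat.mul_pos hN hS0) (hNπ.mul hS) hp' hdet with h | h | h
    · left
      rw [h] at h01 h10
      have h1s := sub_ne_zero.2 h1
      simp [h0, h1s] at h01 h10
      exact ⟨h01, h10⟩
    · rw [h] at h11; simp at h11
      exact absurd (by linear_combination -h11) h20
    · right
      rw [htr] at h
      exact h

lemma pair_dep [Finite F] {π : Set ℕ} (p : ℕ) [Fact p.Prime] [CharP F p] (hp : p ∉ π)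
    {S : Subgroup (GL ι F)} (hS : IsPiNumber π (Nat.card S)) (ε : F) (h0 : ε ≠ 0) (h1 : ε ≠ 1)
    (R R' : GL ι F) (hRS : R ∈ S) (hRS' : R' ∈ S) (v f w g : ι → F) (hf : f ⬝ᵥ v = 1)
    (hg : g ⬝ᵥ w = 1) (hR : (R : Matrix ι ι F) = rfm ε v f) (hR' : (R' : Matrix ι ι F) = rfm ε w g)
    (c : F) (hc : w = c • v) : R = R' ∧ (f ⬝ᵥ w) * (g ⬝ᵥ v) = 1 := by
  have hm : ((Nat.card S : ℕ) : F) ≠ 0 := by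
    rw [Ne, CharP.cast_eq_zero_iff F p]
    exact fun h => hp (hS p Fact.out h)
  have hgc : c * (g ⬝ᵥ v) = 1 := by rw [← hg, hc, dotProduct_smul, smul_eq_mul]
  have hR2 : (R' : Matrix ι ι F) = rfm ε v (c • g) := by
    rw [hR', hc, rfm, rfm, smul_vecMulVec, vecMulVec_smul]
  have hg2 : (c • g) ⬝ᵥ v = 1 := by rw [smul_dotProduct, smul_eq_mul, hgc]
  have hRi := rfm_inv R' ε h0 v (c • g) hg2 hR2
  have hU : ((R * R'⁻¹ : GL ι F) : Matrix ι ι F) = 1 + (ε - 1) • vecMulVec v (f - c • g) := by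
    rw [Units.val_mul, hR, hRi]
    have h2 : vecMulVec v f * vecMulVec v (c • g) = vecMulVec v (c • g) := by
      rw [vecMulVec_mul_vecMulVec, hf]; simp
    have h3 : ε * ε⁻¹ = 1 := mul_inv_cancel₀ h0
    have h4 : vecMulVec v (f - c • g) = vecMulVec v f - vecMulVec v (c • g) := by
      ext i j; simp [vecMulVec_apply, mul_sub]; ring
    rw [h4]
    simp only [rfm, add_mul, mul_add, one_mul, mul_one, smul_mul_assoc, mul_smul_comm, h2]
    rw [← sub_eq_zero]
    have : (ε * ε⁻¹ - 1) • vecMulVec v (c • g) = 0 := by rw [h3]; simp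
    rw [← this]
    module
  have hfg : (f - c • g) ⬝ᵥ v = 0 := by rw [sub_dotProduct, hf, hg2, sub_self]
  have hk : ∀ k : ℕ, (1 + (ε - 1) • vecMulVec v (f - c • g)) ^ k
      = 1 + ((k : F) * (ε - 1)) • vecMulVec v (f - c • g) := by
    intro k
    induction k with
    | zero => simp
    | succ k ih =>
      have h5 : vecMulVec v (f - c • g) * vecMulVec v (f - c • g) = 0 := by
        rw [vecMulVec_mul_vecMulVec, hfg]; simp
      rw [pow_succ, ih, add_mul, mul_add, mul_add]
      simp only [one_mul, mul_one, smul_mul_assoc, mul_smul_comm, h5, smul_zero]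
      push_cast
      module
  have h6 := pow_of_mem (mul_mem hRS (inv_mem hRS'))
  rw [hU, hk] at h6
  have h7 : ((Nat.card S : F) * (ε - 1)) • vecMulVec v (f - c • g) = 0 := by simpa using h6
  have h8 := (smul_eq_zero.1 h7).resolve_left (mul_ne_zero hm (sub_ne_zero.2 h1))
  constructor
  · rw [h8, smul_zero, add_zero] at hU
    have : R * R'⁻¹ = 1 := Units.ext hU
    exact mul_inv_eq_one.1 this
  · rw [hc, dotProduct_smul, hf]; simpa using hgc
end Refl

section Pairs
open Matrix
set_option linter.unusedSectionVars false
variable {ι F : Type*} [Fintype ι] [DecidableEq ι] [Field F]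

lemma dep_or (v f w : ι → F) (hf : f ⬝ᵥ v = 1) :
    (∃ c : F, w = c • v) ∨ (∀ r s : F, r • v + s • w = 0 → r = 0 ∧ s = 0) := by
  by_cases h : ∃ c : F, w = c • v
  · exact Or.inl h
  · right
    intro r s hrs
    have hs : s = 0 := by
      by_contra hs
      apply h
      refine ⟨-(s⁻¹ * r), ?_⟩
      have : s⁻¹ • (r • v + s • w) = 0 := by rw [hrs, smul_zero]
      rw [smul_add, smul_smul, smul_smul, inv_mul_cancel₀ hs, one_smul] at this
      rw [neg_smul]
      exact eq_neg_of_add_eq_zero_right this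
    subst hs
    rw [zero_smul, add_zero] at hrs
    have := congrArg (f ⬝ᵥ ·) hrs
    simp [dotProduct_smul, hf] at this
    exact ⟨this, rfl⟩

theorem pairC5 [Finite F] {π : Set ℕ} (h2π : 2 ∈ π) (p : ℕ) [Fact p.Prime] [CharP F p] (hp : p ∉ π)
    (hT : Tr5 π F False) (h20 : (2 : F) ≠ 0) (h30 : (3 : F) ≠ 0)
    {S : Subgroup (GL ι F)} (hS : IsPiNumber π (Nat.card S)) (ε : F) (hε : ε ^ 2 = -1)
    (R R' : GL ι F) (hRS : R ∈ S) (hRS' : R' ∈ S) (v f w g : ι → F) (hf : f ⬝ᵥ v = 1)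
    (hg : g ⬝ᵥ w = 1) (hR : (R : Matrix ι ι F) = rfm ε v f) (hR' : (R' : Matrix ι ι F) = rfm ε w g) :
    ((∃ c : F, w = c • v) ∧ R = R' ∧ (f ⬝ᵥ w) * (g ⬝ᵥ v) = 1) ∨ (f ⬝ᵥ w = 0 ∧ g ⬝ᵥ v = 0) ∨
      2 * ((f ⬝ᵥ w) * (g ⬝ᵥ v)) = 1 := by
  have h0 : ε ≠ 0 := by rintro rfl; simp at hε
  have h1 : ε ≠ 1 := by
    rintro rfl; exact h20 (by linear_combination hε)
  have h1' : ε ≠ -1 := by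
    rintro rfl; exact h20 (by linear_combination hε)
  rcases dep_or v f w hf with ⟨c, hc⟩ | hli
  · exact Or.inl ⟨⟨c, hc⟩, pair_dep p hp hS ε h0 h1 R R' hRS hRS' v f w g hf hg hR hR' c hc⟩
  · right
    have hi : ε⁻¹ = -ε := by
      apply inv_eq_of_mul_eq_one_right; linear_combination -hε
    obtain ⟨ha, hb⟩ := pair_gen hT h20 hS ε 4 (by norm_num)
      (by simpa using (IsPiNumber.prime (by norm_num : Nat.Prime 2) h2π).pow 2)
      (by linear_combination (ε ^ 2 - 1) * hε) h1 h1' R R' hRS hRS' v f w g hf hg hR hR' hli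
    rcases hb with hb | hb
    · exact Or.inl hb
    · right
      rw [hi] at ha hb
      set t := (f ⬝ᵥ w) * (g ⬝ᵥ v)
      unfold OKt at ha hb
      rcases ha with ha | ha | ha | ha
      · exfalso
        rcases hb with hb | hb | hb | hb
        · exact h20 (by linear_combination ha + hb)
        · exact one_ne_zero (α := F) (by linear_combination ha + hb)
        · exact h30 (by linear_combination ha + hb)
        · exact hb.1
      · linear_combination ha
      · exfalso
        rcases hb with hb | hb | hb | hb
        · exact h30 (by linear_combination ha + hb)
        · exact h20 (by linear_combination ha + hb)
        · exact (mul_ne_zero h20 h20) (by linear_combination ha + hb)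
        · exact hb.1
      · exact absurd ha.1 id

theorem pairC4 [Finite F] {π : Set ℕ} (h3π : 3 ∈ π) (p : ℕ) [Fact p.Prime] [CharP F p] (hp : p ∉ π)
    {E : Prop} (hT : Tr5 π F E) (h20 : (2 : F) ≠ 0) (h30 : (3 : F) ≠ 0)
    {S : Subgroup (GL ι F)} (hS : IsPiNumber π (Nat.card S)) (ε : F) (hε : ε ^ 2 + ε + 1 = 0)
    (R R' : GL ι F) (hRS : R ∈ S) (hRS' : R' ∈ S) (v f w g : ι → F) (hf : f ⬝ᵥ v = 1)
    (hg : g ⬝ᵥ w = 1) (hR : (R : Matrix ι ι F) = rfm ε v f) (hR' : (R' : Matrix ι ι F) = rfm ε w g) :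
    (R = R' ∧ (f ⬝ᵥ w) * (g ⬝ᵥ v) = 1) ∨ (f ⬝ᵥ w = 0 ∧ g ⬝ᵥ v = 0) ∨
      3 * ((f ⬝ᵥ w) * (g ⬝ᵥ v)) = 1 ∨ 3 * ((f ⬝ᵥ w) * (g ⬝ᵥ v)) = 2 := by
  have h10 : (1 : F) ≠ 0 := one_ne_zero
  have h0 : ε ≠ 0 := by rintro rfl; simp at hε
  have h1 : ε ≠ 1 := by
    rintro rfl; exact h30 (by linear_combination hε)
  have h1' : ε ≠ -1 := by
    rintro rfl; exact h10 (by linear_combination hε)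
  rcases dep_or v f w hf with ⟨c, hc⟩ | hli
  · exact Or.inl (pair_dep p hp hS ε h0 h1 R R' hRS hRS' v f w g hf hg hR hR' c hc)
  · right
    have hi : ε⁻¹ = -1 - ε := by
      apply inv_eq_of_mul_eq_one_right; linear_combination -hε
    obtain ⟨ha, hb⟩ := pair_gen hT h20 hS ε 3 (by norm_num)
      (IsPiNumber.prime (by norm_num : Nat.Prime 3) h3π)
      (by linear_combination (ε - 1) * hε) h1 h1' R R' hRS hRS' v f w g hf hg hR hR' hli
    rcases hb with hb | hb
    · exact Or.inl hb
    · right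
      have hcomm : (7 : F) = 0 → 2 * (-1 + 3 * ((f ⬝ᵥ w) * (g ⬝ᵥ v))) = 1 → False := by
        intro h7 ht
        have hRi := rfm_inv R ε h0 v f hf hR
        have hRi' := rfm_inv R' ε h0 w g hg hR'
        have hA := acts_mul (acts_mul (acts_mul (acts_rfm ε v f w hf) (acts_rfm' ε v g w hg))
          (acts_rfm ε⁻¹ v f w hf)) (acts_rfm' ε⁻¹ v g w hg)
        rw [← hR, ← hR', ← hRi, ← hRi', ← Units.val_mul, ← Units.val_mul, ← Units.val_mul] at hA
        have hpw := acts_pow_one hli hA _ (pow_of_mem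
          (mul_mem (mul_mem (mul_mem hRS hRS') (inv_mem hRS)) (inv_mem hRS')))
        generalize f ⬝ᵥ w = a at *
        generalize g ⬝ᵥ v = b at *
        have hdet : (!![ε, (ε - 1) * a; 0, 1] * !![1, 0; (ε - 1) * b, ε] *
          !![ε⁻¹, (ε⁻¹ - 1) * a; 0, 1] * !![1, 0; (ε⁻¹ - 1) * b, ε⁻¹]).det = 1 := by
          simp only [det_mul, det_fin_two_of]; field_simp; ring
        have htr : (!![ε, (ε - 1) * a; 0, 1] * !![1, 0; (ε - 1) * b, ε] *
          !![ε⁻¹, (ε⁻¹ - 1) * a; 0, 1] * !![1, 0; (ε⁻¹ - 1) * b, ε⁻¹]).trace =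
          (2 - 3 * (a * b)) * (1 - 3 * (a * b)) := by
          rw [hi, trace_fin_two]; simp
          grind
        have htr2 : (2 - 3 * (a * b)) * (1 - 3 * (a * b)) = -2 := by
          grind
        rw [htr2] at htr
        rcases hT _ _ Nat.card_pos hS hpw hdet with h | h | h
        · rw [h] at htr; simp at htr; grind
        · have hm : ∀ A B A' B' : Matrix (Fin 2) (Fin 2) F, A' * A = 1 → B' * B = 1 →
              A * B * A' * B' = -1 → A * B = -(B * A) := by
            intro A B A' B' hA hB h
            calc A * B = A * B * A' * (B' * B) * A := by rw [hB, mul_one, mul_assoc _ A', hA, mul_one]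
              _ = (A * B * A' * B') * B * A := by simp only [mul_assoc]
              _ = _ := by rw [h]; simp
          have := hm _ _ _ _ (by
            rw [Matrix.mul_fin_two, Matrix.one_fin_two]; congr 3 <;> field_simp <;> grind) (by
            rw [Matrix.mul_fin_two, Matrix.one_fin_two]; congr 3 <;> field_simp <;> grind) h
          have h01 := congrFun (congrFun this 0) 1
          simp at h01
          have h9 : (ε - 1) * (ε + 1) * a = 0 := by linear_combination h01
          have h8 : a = 0 := by
            rcases mul_eq_zero.1 h9 with h9 | h9
            · rcases mul_eq_zero.1 h9 with h9 | h9
              · exact absurd (sub_eq_zero.1 h9) h1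
              · exact absurd (eq_neg_of_add_eq_zero_left h9) h1'
            · exact h9
          rw [h8] at ht
          exact h30 (by linear_combination -ht)
        · rw [htr] at h
          have h6 : (3 : F) ≠ 0 := h30
          rcases h with h | h | h | h
          · exact h20 (by linear_combination -h)
          · exact h30 (by linear_combination -h)
          · exact h10 (by linear_combination -h)
          · exact h20 (by linear_combination h.2)
      rw [hi] at ha hb
      generalize (f ⬝ᵥ w) * (g ⬝ᵥ v) = t at *
      unfold OKt at ha hb
      have h40 : (4 : F) ≠ 0 := by
        have := mul_ne_zero h20 h20; norm_num at this; exact this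
      rcases ha with ha | ha | ha | ha
      · left; linear_combination ha
      · right; linear_combination ha
      · exfalso
        rcases hb with hb | hb | hb | hb
        · exact h20 (by linear_combination hb + ha)
        · exact h10 (by linear_combination hb + ha)
        · exact h30 (by linear_combination hb + ha)
        · grind
      · exfalso
        rcases hb with hb | hb | hb | hb
        · grind
        · grind
        · grind
        · have h5 : 2 * (-1 + 3 * t) = 1 := by linear_combination ha.2 - hb.2
          exact hcomm (by linear_combination (2 * (-1 + 3 * t) + 1) * h5 - 4 * ha.2) h5
end Pairs

section CaseC5
open Matrix
set_option linter.unusedSectionVars false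

lemma dg_rfm {ι F : Type*} [Fintype ι] [DecidableEq ι] [Field F] (i : ι) (s : Fˣ) :
    ((dg ι F (Pi.mulSingle i s) : GL ι F) : Matrix ι ι F)
      = rfm (s : F) (Pi.single i 1) (Pi.single i 1) := by
  rw [dg_coe, rfm]
  ext a b
  by_cases hab : a = b
  · subst hab
    by_cases h : a = i
    · subst h; simp [vecMulVec_apply]
    · simp [vecMulVec_apply, Pi.mulSingle_apply, h]
  · rw [diagonal_apply_ne _ hab]
    simp only [Matrix.add_apply, one_apply_ne hab, Matrix.smul_apply, vecMulVec_apply, Pi.single_apply]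
    split_ifs with h1 h2
    · exact absurd (h1.trans h2.symm) hab
    all_goals simp

lemma conj_rfm {ι F : Type*} [Fintype ι] [DecidableEq ι] [Field F] (k r : GL ι F) (ε : F)
    (v f : ι → F) (hr : (r : Matrix ι ι F) = rfm ε v f) :
    ((k * r * k⁻¹ : GL ι F) : Matrix ι ι F) =
      rfm ε ((k : Matrix ι ι F) *ᵥ v) (f ᵥ* ((k⁻¹ : GL ι F) : Matrix ι ι F)) := by
  rw [← rfm_conj, ← hr]; rfl

lemma Core.refl {π : Set ℕ} {ι F : Type*} [Fintype ι] [DecidableEq ι] [Field F]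
    {S : Subgroup (GL ι F)} (hS : Core π S) (l : ℕ) (hl : l ∈ π) (hlp : l.Prime) (k : ℕ) (s : Fˣ)
    (hs : s ^ (l ^ k) = 1) :
    ∃ g : GL ι F, ∀ i, g * dg ι F (Pi.mulSingle i s) * g⁻¹ ∈ S := by
  let D : Subgroup (ι → Fˣ) :=
    { carrier := {u | u ^ (l ^ k) = 1}
      mul_mem' := by
        intro x y h1 h3
        show (x * y) ^ (l ^ k) = 1
        rw [mul_pow, h1, h3, one_mul]
      one_mem' := by simp
      inv_mem' := by
        intro x h1
        show x⁻¹ ^ (l ^ k) = 1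
        rw [inv_pow, h1, inv_one] }
  obtain ⟨g, hg⟩ := hS.2.2 l hl hlp (D.map (dg _ F)) (by
    rintro ⟨_, ⟨u, hu, rfl⟩⟩
    refine ⟨k, Subtype.ext ?_⟩
    show (dg _ F u) ^ (l ^ k) = 1
    rw [← map_pow, show u ^ (l ^ k) = 1 from hu, map_one])
  refine ⟨g, fun i => hg _ ⟨_, ?_, rfl⟩⟩
  show _ ^ (l ^ k) = 1
  rw [← Pi.mulSingle_pow, hs]; simp

/-- An element of order three. -/
def tri (F : Type*) [Field F] : SpecialLinearGroup (Fin 2) F := ⟨!![0, -1; 1, -1], by simp⟩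

/-- An element of order four inverting `tri`. -/
def trj {F : Type*} [Field F] (a c : F) (h : a ^ 2 - a * c + c ^ 2 = -1) :
    SpecialLinearGroup (Fin 2) F := ⟨!![a, c - a; c, -a], by simp; linear_combination -h⟩

lemma tri_coe {F : Type*} [Field F] :
    ((tri F : SpecialLinearGroup (Fin 2) F) : Matrix (Fin 2) (Fin 2) F) = !![0, -1; 1, -1] := rfl

lemma trj_coe {F : Type*} [Field F] (a c : F) (h : a ^ 2 - a * c + c ^ 2 = -1) :
    ((trj a c h : SpecialLinearGroup (Fin 2) F) : Matrix (Fin 2) (Fin 2) F)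
      = !![a, c - a; c, -a] := rfl

lemma tri_cube {F : Type*} [Field F] : tri F ^ 3 = 1 := by
  apply sl_ext
  rw [Matrix.SpecialLinearGroup.coe_pow, tri_coe]
  ext i j
  fin_cases i <;> fin_cases j <;> simp [pow_succ]

lemma trj_sq {F : Type*} [Field F] (a c : F) (h : a ^ 2 - a * c + c ^ 2 = -1) :
    trj a c h * trj a c h = -1 := by
  apply sl_ext
  rw [Matrix.SpecialLinearGroup.coe_mul, trj_coe, Matrix.SpecialLinearGroup.coe_neg,
    Matrix.SpecialLinearGroup.coe_one]
  ext i j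
  fin_cases i <;> fin_cases j <;> simp <;> first | linear_combination h | ring1

lemma trj_four {F : Type*} [Field F] (a c : F) (h : a ^ 2 - a * c + c ^ 2 = -1) :
    trj a c h ^ 4 = 1 := by
  have : trj a c h ^ 4 = (trj a c h * trj a c h) * (trj a c h * trj a c h) := by
    simp only [pow_succ, pow_zero, one_mul, mul_assoc]
  rw [this, trj_sq]; simp

lemma trj_tri {F : Type*} [Field F] (a c : F) (h : a ^ 2 - a * c + c ^ 2 = -1) :
    trj a c h * tri F = (tri F)⁻¹ * trj a c h := by
  apply sl_ext
  rw [Matrix.SpecialLinearGroup.coe_mul, Matrix.SpecialLinearGroup.coe_mul, Matrix.SpecialLinearGroup.coe_inv, tri_coe, trj_coe,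
    adjugate_fin_two_of]
  ext i j
  fin_cases i <;> fin_cases j <;> simp <;> ring1

lemma trK {π : Set ℕ} (h2 : 2 ∈ π) (h3 : 3 ∈ π) {G F : Type*} [Group G] [Finite G] [Field F]
    (e : SpecialLinearGroup (Fin 2) F →* G) (a c : F) (h : a ^ 2 - a * c + c ^ 2 = -1) :
    ∃ K : Subgroup G, IsPiNumber π (Nat.card K) ∧ e (tri F) ∈ K ∧ e (trj a c h) ∈ K ∧
      ∀ D : Subgroup G, e (tri F) ∈ D → e (trj a c h) ∈ D → K ≤ D := by
  refine grp_two (e (tri F)) (e (trj a c h)) 3 4 (IsPiNumber.prime (by norm_num) h3)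
    ((IsPiNumber.prime Nat.prime_two h2).pow 2) ?_ ?_ ?_
  · rw [← map_pow, tri_cube, map_one]
  · rw [← map_pow, trj_four, map_one]
  · rw [← map_mul, trj_tri, map_mul, map_inv]

lemma Core.stdK {π : Set ℕ} (h2 : 2 ∈ π) (h3 : 3 ∈ π) {κ F : Type*} [Fintype κ] [DecidableEq κ]
    [Field F] [Finite F] (a c : F) (hac : a ^ 2 - a * c + c ^ 2 = -1)
    {S : Subgroup (GL (Fin 2 ⊕ κ) F)} (h : Core π S) :
    ∃ S' : Subgroup (GL (Fin 2 ⊕ κ) F), Core π S' ∧ emb2 κ (tri F) ∈ S' ∧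
      emb2 κ (trj a c hac) ∈ S' := by
  obtain ⟨K, hK, hI, hJ, hD⟩ := trK h2 h3 (emb2 κ) a c hac
  obtain ⟨S', h1, h5⟩ := h.std K hK (by
    intro k hk
    have : K ≤ (emb2 κ).range := hD _ ⟨_, rfl⟩ ⟨_, rfl⟩
    obtain ⟨A, rfl⟩ := this hk
    exact emb2_det κ A)
  exact ⟨S', h1, h5 hI, h5 hJ⟩

lemma emb2_dot {κ F : Type*} [Fintype κ] [DecidableEq κ] [Field F]
    (A : SpecialLinearGroup (Fin 2) F) (v f : Fin 2 ⊕ κ → F) :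
    f ⬝ᵥ ((emb2 κ A : GL (Fin 2 ⊕ κ) F) : Matrix (Fin 2 ⊕ κ) (Fin 2 ⊕ κ) F) *ᵥ v =
      (f ∘ Sum.inl) ⬝ᵥ ((A : Matrix (Fin 2) (Fin 2) F) *ᵥ (v ∘ Sum.inl))
        + (f ∘ Sum.inr) ⬝ᵥ (v ∘ Sum.inr) := by
  rw [emb2_coe, fromBlocks_mulVec]
  conv_lhs => rw [← Sum.elim_comp_inl_inr f]
  rw [sumElim_dotProduct_sumElim]
  simp

lemma emb2_inl {κ F : Type*} [Fintype κ] [DecidableEq κ] [Field F]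
    (A : SpecialLinearGroup (Fin 2) F) (v : Fin 2 ⊕ κ → F) (i : Fin 2) :
    (((emb2 κ A : GL (Fin 2 ⊕ κ) F) : Matrix (Fin 2 ⊕ κ) (Fin 2 ⊕ κ) F) *ᵥ v) (Sum.inl i) =
      ((A : Matrix (Fin 2) (Fin 2) F) *ᵥ (v ∘ Sum.inl)) i := by
  rw [emb2_coe, fromBlocks_mulVec]
  simp

lemma emb2_inr {κ F : Type*} [Fintype κ] [DecidableEq κ] [Field F]
    (A : SpecialLinearGroup (Fin 2) F) (v : Fin 2 ⊕ κ → F) (i : κ) :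
    (((emb2 κ A : GL (Fin 2 ⊕ κ) F) : Matrix (Fin 2 ⊕ κ) (Fin 2 ⊕ κ) F) *ᵥ v) (Sum.inr i) =
      v (Sum.inr i) := by
  rw [emb2_coe, fromBlocks_mulVec]
  simp

theorem caseC5 {π : Set ℕ} (h2 : 2 ∈ π) (h3 : 3 ∈ π) {κ F : Type*} [Fintype κ] [DecidableEq κ]
    [Field F] [Fintype F] (h20 : (2 : F) ≠ 0) (h30 : (3 : F) ≠ 0) (p : ℕ) [Fact p.Prime] [CharP F p]
    (hp : p ∉ π) {S : Subgroup (GL (Fin 2 ⊕ κ) F)} (hS : Core π S) (hT : Tr5 π F False)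
    (ε : F) (hε : ε ^ 2 = -1) (hw : ∀ x : F, x ^ 2 + x + 1 ≠ 0) (h2s : ∀ x : F, x ^ 2 ≠ 2) :
    False := by
  have hε0 : ε ≠ 0 := by rintro rfl; simp at hε
  have hac : ε ^ 2 - ε * 0 + 0 ^ 2 = -1 := by rw [hε]; ring
  obtain ⟨S, hS, hx, hy⟩ := hS.stdK h2 h3 ε 0 hac
  obtain ⟨g, hg⟩ := hS.refl 2 h2 Nat.prime_two 2 (Units.mk0 ε hε0) (by
    ext; simp; linear_combination (ε ^ 2 - 1) * hε)
  obtain ⟨i, hi⟩ : ∃ i, (g : Matrix (Fin 2 ⊕ κ) (Fin 2 ⊕ κ) F) (Sum.inl 0) i ≠ 0 := by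
    by_contra! h
    have h1 : (g : Matrix (Fin 2 ⊕ κ) (Fin 2 ⊕ κ) F) *
        ((g⁻¹ : GL (Fin 2 ⊕ κ) F) : Matrix (Fin 2 ⊕ κ) (Fin 2 ⊕ κ) F) = 1 := by
      rw [← Units.val_mul, mul_inv_cancel, Units.val_one]
    have h2 := congrFun (congrFun h1 (Sum.inl 0)) (Sum.inl 0)
    rw [Matrix.mul_apply, one_apply_eq] at h2
    rw [Finset.sum_eq_zero (fun j _ => by rw [h j, zero_mul])] at h2
    exact zero_ne_one h2
  set r := g * dg (Fin 2 ⊕ κ) F (Pi.mulSingle i (Units.mk0 ε hε0)) * g⁻¹ with hr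
  have hrS : r ∈ S := hg i
  have hr2 := conj_rfm g _ _ _ _ (dg_rfm i (Units.mk0 ε hε0))
  rw [← hr] at hr2
  have hfv := conj_dot g (Pi.single i 1) (Pi.single i (1 : F))
  have hv0 : ((g : Matrix (Fin 2 ⊕ κ) (Fin 2 ⊕ κ) F) *ᵥ Pi.single i 1) (Sum.inl 0) ≠ 0 := by
    simpa using hi
  clear_value r
  generalize (g : Matrix (Fin 2 ⊕ κ) (Fin 2 ⊕ κ) F) *ᵥ Pi.single i 1 = v at *
  generalize (Pi.single i (1 : F)) ᵥ* ((g⁻¹ : GL (Fin 2 ⊕ κ) F) : Matrix (Fin 2 ⊕ κ) (Fin 2 ⊕ κ) F)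
    = f at *
  simp only [single_dotProduct, Pi.single_eq_same, mul_one, Units.val_mk0] at hfv hr2
  -- the pair lemma applied to a conjugate by an element of the block subgroup
  have key : ∀ A : SpecialLinearGroup (Fin 2) F, emb2 κ A ∈ S →
      (∃ c : F, (A : Matrix (Fin 2) (Fin 2) F) *ᵥ (v ∘ Sum.inl) = c • (v ∘ Sum.inl) ∧
        v ∘ Sum.inr = c • (v ∘ Sum.inr)) ∨
      (f ⬝ᵥ (((emb2 κ A : GL (Fin 2 ⊕ κ) F) : Matrix (Fin 2 ⊕ κ) (Fin 2 ⊕ κ) F) *ᵥ v) = 0 ∧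
       f ⬝ᵥ (((emb2 κ A⁻¹ : GL (Fin 2 ⊕ κ) F) : Matrix (Fin 2 ⊕ κ) (Fin 2 ⊕ κ) F) *ᵥ v) = 0) ∨
      2 * ((f ⬝ᵥ (((emb2 κ A : GL (Fin 2 ⊕ κ) F) : Matrix (Fin 2 ⊕ κ) (Fin 2 ⊕ κ) F) *ᵥ v)) *
       (f ⬝ᵥ (((emb2 κ A⁻¹ : GL (Fin 2 ⊕ κ) F) : Matrix (Fin 2 ⊕ κ) (Fin 2 ⊕ κ) F) *ᵥ v))) = 1 := by
    intro A hA
    have hg2 : (f ᵥ* (((emb2 κ A)⁻¹ : GL (Fin 2 ⊕ κ) F) : Matrix (Fin 2 ⊕ κ) (Fin 2 ⊕ κ) F)) ⬝ᵥ v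
      = f ⬝ᵥ (((emb2 κ A⁻¹ : GL (Fin 2 ⊕ κ) F) : Matrix (Fin 2 ⊕ κ) (Fin 2 ⊕ κ) F) *ᵥ v) := by
      rw [← dotProduct_mulVec, map_inv]
    have := pairC5 h2 p hp hT h20 h30 hS.1 ε hε r _ hrS
      (mul_mem (mul_mem hA hrS) (inv_mem hA)) v f _ _ hfv (by rw [conj_dot, hfv]) hr2
      (conj_rfm (emb2 κ A) r ε v f hr2)
    rw [hg2] at this
    refine this.imp_left ?_
    rintro ⟨⟨c, hc⟩, -⟩
    refine ⟨c, ?_, ?_⟩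
    · ext l
      have := congrFun hc (Sum.inl l)
      rw [emb2_inl] at this
      simpa using this
    · ext l
      have := congrFun hc (Sum.inr l)
      rw [emb2_inr] at this
      simpa using this
  simp only [emb2_dot] at key
  set k := (f ∘ Sum.inr) ⬝ᵥ (v ∘ Sum.inr) with hk
  have hsum : (f ∘ Sum.inl) ⬝ᵥ (v ∘ Sum.inl) + k = 1 := by
    rw [hk, ← hfv]
    conv_rhs => rw [← Sum.elim_comp_inl_inr f, ← Sum.elim_comp_inl_inr v]
    rw [sumElim_dotProduct_sumElim]
  obtain ⟨u0, hu0⟩ : ∃ x, x = v (Sum.inl 0) := ⟨_, rfl⟩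
  obtain ⟨u1, hu1⟩ : ∃ x, x = v (Sum.inl 1) := ⟨_, rfl⟩
  obtain ⟨m0, hm0⟩ : ∃ x, x = f (Sum.inl 0) := ⟨_, rfl⟩
  obtain ⟨m1, hm1⟩ : ∃ x, x = f (Sum.inl 1) := ⟨_, rfl⟩
  have hu : v ∘ Sum.inl = ![u0, u1] := by
    ext l; fin_cases l <;> simp [hu0, hu1]
  have hm : f ∘ Sum.inl = ![m0, m1] := by
    ext l; fin_cases l <;> simp [hm0, hm1]
  rw [← hu0] at hv0
  rw [hu, hm] at key hsum
  simp [vec2_dotProduct] at hsum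
  have hz : emb2 κ (-1) ∈ S := by rw [← trj_sq ε 0 hac, map_mul]; exact mul_mem hy hy
  have hy1 : emb2 κ (trj ε 0 hac * tri F) ∈ S := by rw [map_mul]; exact mul_mem hy hx
  have hy2 : emb2 κ (trj ε 0 hac * tri F * tri F) ∈ S := by
    rw [map_mul]; exact mul_mem hy1 hx
  have e0 : ((trj ε 0 hac : SpecialLinearGroup (Fin 2) F) : Matrix (Fin 2) (Fin 2) F)
    = !![ε, -ε; 0, -ε] := by rw [trj_coe]; simp
  have e1 : ((trj ε 0 hac * tri F : SpecialLinearGroup (Fin 2) F) : Matrix (Fin 2) (Fin 2) F)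
    = !![-ε, 0; -ε, ε] := by
      rw [Matrix.SpecialLinearGroup.coe_mul, e0, tri_coe]; simp
  have e2 : ((trj ε 0 hac * tri F * tri F : SpecialLinearGroup (Fin 2) F) :
    Matrix (Fin 2) (Fin 2) F) = !![0, ε; ε, 0] := by
      rw [Matrix.SpecialLinearGroup.coe_mul, e1, tri_coe]; simp
  have sqm : ∀ A : SpecialLinearGroup (Fin 2) F, ∀ a b c d : F,
      (A : Matrix (Fin 2) (Fin 2) F) = !![a, b; c, d] →
      ((A⁻¹ : SpecialLinearGroup (Fin 2) F) : Matrix (Fin 2) (Fin 2) F) = !![d, -b; -c, a] := by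
    intro A a b c d h
    rw [Matrix.SpecialLinearGroup.coe_inv, h, adjugate_fin_two_of]
  have hm1'' : ((-1 : SpecialLinearGroup (Fin 2) F) : Matrix (Fin 2) (Fin 2) F)
      = !![-1, 0; 0, -1] := by
    rw [Matrix.SpecialLinearGroup.coe_neg, Matrix.SpecialLinearGroup.coe_one]
    ext i j
    fin_cases i <;> fin_cases j <;> simp
  have mv : ∀ a b c d x y : F, !![a, b; c, d] *ᵥ ![x, y] = ![a * x + b * y, c * x + d * y] := by
    intro a b c d x y
    ext l; fin_cases l <;> simp [mulVec, vec2_dotProduct]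
  have dv : ∀ a b x y : F, ![a, b] ⬝ᵥ ![x, y] = a * x + b * y := by
    intro a b x y; simp [vec2_dotProduct]
  have veq : ∀ a b x y c : F, ![a, b] = c • ![x, y] → a = c * x ∧ b = c * y := by
    intro a b x y c h
    exact ⟨by simpa using congrFun h 0, by simpa using congrFun h 1⟩
  have k0 := key _ hy
  have k1 := key _ hy1
  have k2 := key _ hy2
  have kz := key _ hz
  rw [sqm _ _ _ _ _ e0, e0] at k0
  rw [sqm _ _ _ _ _ e1, e1] at k1
  rw [sqm _ _ _ _ _ e2, e2] at k2
  rw [sqm _ _ _ _ _ hm1'', hm1''] at kz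
  simp only [mv, dv] at k0 k1 k2 kz
  clear key sqm
  have hkc : ∀ c : F, v ∘ Sum.inr = c • (v ∘ Sum.inr) → k = c * k := by
    intro c hc
    rw [hk]
    conv_lhs => rw [hc]
    rw [dotProduct_smul, smul_eq_mul]
  have hcases : 2 * k = 1 ∨ (k = 0 ∧ v ∘ Sum.inr = 0) := by
    rcases kz with ⟨c, hc, hc'⟩ | ⟨h, -⟩ | h
    · right
      have := (veq _ _ _ _ _ hc).1
      have hc1 : c = -1 := by
        have : (c + 1) * u0 = 0 := by linear_combination -this
        exact eq_neg_of_add_eq_zero_left ((mul_eq_zero.1 this).resolve_right hv0)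
      have hv : v ∘ Sum.inr = 0 := by
        ext l
        have := congrFun hc' l
        rw [hc1] at this
        simp at this
        have h2 : 2 * v (Sum.inr l) = 0 := by linear_combination this
        exact (mul_eq_zero.1 h2).resolve_left h20
      exact ⟨by rw [hk, hv, dotProduct_zero], hv⟩
    · left; linear_combination h + hsum
    · exfalso
      apply h2s (2 * (2 * k - 1))
      have h5 : m0 * u0 + m1 * u1 = 1 - k := by linear_combination hsum
      have h6 : m0 * (-1 * u0 + 0 * u1) + m1 * (0 * u0 + -1 * u1) + k = 2 * k - 1 := by
        linear_combination -h5
      have h7 : m0 * (-1 * u0 + -0 * u1) + m1 * (-0 * u0 + -1 * u1) + k = 2 * k - 1 := by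
        linear_combination -h5
      rw [h6, h7] at h
      linear_combination 2 * h
  have hε1 : ε ≠ 1 := by rintro rfl; exact h20 (by linear_combination hε)
  have hε2 : ε ≠ -1 := by rintro rfl; exact h20 (by linear_combination hε)
  rcases hcases with hk1 | ⟨hk0, hv⟩
  · have hk0 : k ≠ 0 := by intro h; rw [h] at hk1; simp at hk1
    have hc1 : ∀ c : F, v ∘ Sum.inr = c • (v ∘ Sum.inr) → c = 1 := by
      intro c hc
      exact mul_right_cancel₀ hk0 (by rw [← hkc c hc, one_mul])
    have gen : ∀ x X0 X1 : F, (X0 = u0 → X1 = u1 → False) →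
        ((∃ c : F, ![X0, X1] = c • ![u0, u1] ∧ v ∘ Sum.inr = c • v ∘ Sum.inr) ∨
        (x + k = 0 ∧ -x + k = 0) ∨ 2 * ((x + k) * (-x + k)) = 1) → 4 * x ^ 2 = -1 := by
      intro x X0 X1 hX h
      rcases h with ⟨c, hc, hc'⟩ | ⟨h, h'⟩ | h
      · rw [hc1 c hc'] at hc
        have := veq _ _ _ _ _ hc
        exact absurd (hX (by rw [this.1, one_mul]) (by rw [this.2, one_mul])) id
      · exact absurd (by linear_combination h + h') (mul_ne_zero h20 hk0)
      · linear_combination -2 * h + (2 * k + 1) * hk1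
    have q0 := gen (ε * (m0 * (u0 - u1) - m1 * u1)) (ε * u0 + -ε * u1) (0 * u0 + -ε * u1) (by
      intro h h'
      have h5 : (1 + ε) * u1 = 0 := by linear_combination -h'
      have h6 : u1 = 0 := (mul_eq_zero.1 h5).resolve_left (fun h => hε2 (by linear_combination h))
      rw [h6] at h
      have h7 : (ε - 1) * u0 = 0 := by linear_combination h
      exact hv0 ((mul_eq_zero.1 h7).resolve_left (sub_ne_zero.2 hε1))) (by
      convert k0 using 3 <;> ring_nf)
    have q1 := gen (ε * (-m0 * u0 + m1 * (u1 - u0))) (-ε * u0 + 0 * u1) (-ε * u0 + ε * u1) (by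
      intro h h'
      have h5 : (1 + ε) * u0 = 0 := by linear_combination -h
      exact hv0 ((mul_eq_zero.1 h5).resolve_left (fun h => hε2 (by linear_combination h)))) (by
      convert k1 using 3 <;> ring_nf)
    have q2 := gen (ε * (m0 * u1 + m1 * u0)) (0 * u0 + ε * u1) (ε * u0 + 0 * u1) (by
      intro h h'
      have h5 : (ε ^ 2 - 1) * u0 = 0 := by linear_combination h + ε * h'
      rw [hε] at h5
      have h6 : 2 * u0 = 0 := by linear_combination -h5
      exact (mul_ne_zero h20 hv0) h6) (by
      convert k2 using 3 <;> ring_nf)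
    have hs : ε * (m0 * u1 + m1 * u0) =
      - (ε * (m0 * (u0 - u1) - m1 * u1)) - (ε * (-m0 * u0 + m1 * (u1 - u0))) := by ring
    rw [hs] at q2
    generalize ε * (m0 * (u0 - u1) - m1 * u1) = x0 at *
    generalize ε * (-m0 * u0 + m1 * (u1 - u0)) = x1 at *
    have h8 : 8 * (x0 * x1) = 1 := by linear_combination q2 - q0 - q1
    exact h30 (by linear_combination (8 * (x0 * x1) + 1) * h8 - 16 * x1 ^ 2 * q0 + 4 * q1)
  · have gen : ∀ x X0 X1 : F,
        ((∃ c : F, ![X0, X1] = c • ![u0, u1] ∧ v ∘ Sum.inr = c • v ∘ Sum.inr) ∨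
        (x + k = 0 ∧ -x + k = 0) ∨ 2 * ((x + k) * (-x + k)) = 1) → X0 * u1 = X1 * u0 ∨ x = 0 := by
      intro x X0 X1 h
      rcases h with ⟨c, hc, hc'⟩ | ⟨h, h'⟩ | h
      · left
        have := veq _ _ _ _ _ hc
        rw [this.1, this.2]; ring
      · right; linear_combination h - hk0
      · exfalso
        rw [hk0] at h
        exact h2s (2 * ε * x) (by linear_combination 2 * h + 4 * x ^ 2 * hε)
    have q0 := gen (ε * (m0 * (u0 - u1) - m1 * u1)) (ε * u0 + -ε * u1) (0 * u0 + -ε * u1) (by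
      convert k0 using 3 <;> ring_nf)
    have q1 := gen (ε * (-m0 * u0 + m1 * (u1 - u0))) (-ε * u0 + 0 * u1) (-ε * u0 + ε * u1) (by
      convert k1 using 3 <;> ring_nf)
    have q2 := gen (ε * (m0 * u1 + m1 * u0)) (0 * u0 + ε * u1) (ε * u0 + 0 * u1) (by
      convert k2 using 3 <;> ring_nf)
    have q0' : u1 * (2 * u0 - u1) = 0 ∨ m0 * (u0 - u1) - m1 * u1 = 0 := by
      refine q0.imp (fun h => ?_) (fun h => (mul_eq_zero.1 h).resolve_left hε0)
      exact mul_left_cancel₀ hε0 (by linear_combination h)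
    have q1' : (u0 - 2 * u1) = 0 ∨ -m0 * u0 + m1 * (u1 - u0) = 0 := by
      refine q1.imp (fun h => ?_) (fun h => (mul_eq_zero.1 h).resolve_left hε0)
      exact mul_left_cancel₀ (mul_ne_zero hε0 hv0) (by linear_combination h)
    have q2' : u1 ^ 2 = u0 ^ 2 ∨ m0 * u1 + m1 * u0 = 0 := by
      refine q2.imp (fun h => ?_) (fun h => (mul_eq_zero.1 h).resolve_left hε0)
      exact mul_left_cancel₀ hε0 (by linear_combination h)
    have fin : m0 * (u0 - u1) - m1 * u1 = 0 → m0 * u1 + m1 * u0 = 0 → False := by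
      intro h h'
      have hne : u0 ^ 2 - u0 * u1 + u1 ^ 2 ≠ 0 := by
        intro h0
        by_cases hu : u1 = 0
        · rw [hu] at h0; apply hv0
          exact pow_eq_zero_iff two_ne_zero |>.1 (by linear_combination h0)
        · apply hw (-u0 / u1)
          field_simp
          linear_combination h0
      have a0 : m0 = 0 := (mul_eq_zero.1 (show m0 * (u0 ^ 2 - u0 * u1 + u1 ^ 2) = 0 by
        linear_combination u0 * h + u1 * h')).resolve_right hne
      have a1 : m1 = 0 := (mul_eq_zero.1 (show m1 * u0 = 0 by
        linear_combination h' - u1 * a0)).resolve_right hv0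
      rw [a0, a1, hk0] at hsum
      simp at hsum
    have e01 : ¬ (u1 * (2 * u0 - u1) = 0 ∧ (u0 - 2 * u1) = 0) := by
      rintro ⟨h, h'⟩
      have h5 : u0 = 2 * u1 := by linear_combination h'
      rw [h5] at h hv0
      exact h30 ((mul_eq_zero.1 (show 3 * (2 * u1) ^ 2 = 0 by linear_combination 4 * h)).resolve_right
        (pow_ne_zero 2 hv0))
    have e12 : ¬ ((u0 - 2 * u1) = 0 ∧ u1 ^ 2 = u0 ^ 2) := by
      rintro ⟨h', h⟩
      have h5 : u0 = 2 * u1 := by linear_combination h'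
      rw [h5] at h hv0
      exact h30 ((mul_eq_zero.1 (show 3 * (2 * u1) ^ 2 = 0 by linear_combination -4 * h)).resolve_right
        (pow_ne_zero 2 hv0))
    have e02 : ¬ (u1 * (2 * u0 - u1) = 0 ∧ u1 ^ 2 = u0 ^ 2) := by
      rintro ⟨h', h⟩
      have h6 : 2 * u1 = u0 := mul_left_cancel₀ hv0 (by linear_combination h' + h)
      exact e12 ⟨by rw [h6, sub_self], h⟩
    rcases q0' with a | a
    · rcases q1' with b | b
      · exact e01 ⟨a, b⟩
      · rcases q2' with c | c
        · exact e02 ⟨a, c⟩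
        · exact fin (by linear_combination -b - c) c
    · rcases q2' with c | c
      · rcases q1' with b | b
        · exact e12 ⟨b, c⟩
        · exact fin a (by linear_combination -b - a)
      · exact fin a c
end CaseC5

section CaseC4
open Matrix
set_option linter.unusedSectionVars false

/-- Admissible values of the pair invariant. -/
def TT {F : Type*} [Field F] (t : F) : Prop := t = 0 ∨ 3 * t = 1 ∨ 3 * t = 2 ∨ t = 1

/-- Normal pairs. -/
def NN {F : Type*} [Field F] (A B : F) : Prop :=
  (A + B = 0 ∨ A + B = 1) ∧ (A * B = 0 ∨ 9 * (A * B) = 1 ∨ 9 * (A * B) = 2 ∨ 3 * (A * B) = 1)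

/-- Exceptional pairs. -/
def EE {F : Type*} [Field F] (A B : F) : Prop :=
  (7 : F) = 0 ∧ ((A = 5 ∧ B = 6) ∨ (A = 6 ∧ B = 5))

lemma pureNE {F : Type*} [Field F] (h20 : (2 : F) ≠ 0) (h30 : (3 : F) ≠ 0) (h50 : (5 : F) ≠ 0)
    (h3s : ∀ x : F, x ^ 2 ≠ 3) (A B : F) (hx : TT ((1 - 2 * (A + B)) ^ 2))
    (hy : TT (1 - 3 * ((1 - A - B) * (A + B)) - 3 * (A * B)))
    (hz : TT (1 - (1 - A - B) * (A + B) - 3 * (A * B))) : NN A B ∨ EE A B := by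
  have h10 : (1 : F) ≠ 0 := one_ne_zero
  have h40 : (4 : F) ≠ 0 := by
    have := mul_ne_zero h20 h20; norm_num at this; exact this
  have h80 : (8 : F) ≠ 0 := by
    have := mul_ne_zero h20 h40; norm_num at this; exact this
  have h60 : (6 : F) ≠ 0 := by
    have := mul_ne_zero h20 h30; norm_num at this; exact this
  have h90 : (9 : F) ≠ 0 := by
    have := mul_ne_zero h30 h30; norm_num at this; exact this
  obtain ⟨u, hu⟩ : ∃ u, u = 1 - 2 * (A + B) := ⟨_, rfl⟩
  obtain ⟨P, hP⟩ : ∃ P, P = (1 - A - B) * (A + B) := ⟨_, rfl⟩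
  obtain ⟨Q, hQ⟩ : ∃ Q, Q = A * B := ⟨_, rfl⟩
  have huP : u ^ 2 = 1 - 4 * P := by rw [hu, hP]; ring
  have h3u := h3s (3 * u)
  rw [← hu] at hx
  rw [← hP, ← hQ] at hy hz
  unfold TT at hx hy hz
  have main : P = 0 ∨ (7 : F) = 0 ∧ u = 0 ∧ Q = 2 := by
    have hx1 : 3 * u ^ 2 ≠ 1 := fun h => h3u (by linear_combination 3 * h)
    have h7Q : (7 : F) = 0 → Q ≠ 5 ∨ u ≠ 0 := by
      intro h7
      by_contra! h
      refine h3s (A - B) ?_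
      have : A + B = 4 := by
        have := h.2
        rw [hu] at this
        linear_combination -4 * this + (A + B) * h7 * (-1)
      linear_combination (A + B + 4) * this + 4 * hQ - 4 * h.1 - h7
    rcases hx with hx | hx | hx | hx
    · have hu0 : u = 0 := pow_eq_zero_iff two_ne_zero |>.1 hx
      rcases hy with hy | hy | hy | hy <;> rcases hz with hz | hz | hz | hz <;> grind
    · exact absurd hx hx1
    · have h7 : (7 : F) ≠ 0 := fun h7 => h3s u (by linear_combination 5 * hx - (2 * u ^ 2 - 1) * h7)
      rcases hy with hy | hy | hy | hy <;> rcases hz with hz | hz | hz | hz <;> grind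
    · left
      exact (mul_eq_zero.1 (show 4 * P = 0 by linear_combination huP - hx)).resolve_left h40
  rcases main with hP0 | ⟨h7, hu0, hQ2⟩
  · left
    constructor
    · rw [hP0] at hP
      rcases mul_eq_zero.1 hP.symm with h | h
      · right; linear_combination -h
      · left; exact h
    · rw [hP0] at hy
      rw [← hQ]
      rcases hy with hy | hy | hy | hy
      · right; right; right; linear_combination -hy
      · right; right; left; linear_combination -hy
      · right; left; linear_combination -hy
      · left; exact (mul_eq_zero.1 (show 3 * Q = 0 by linear_combination -hy)).resolve_left h30
  · right
    refine ⟨h7, ?_⟩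
    have hs : B = 4 - A := by
      rw [hu] at hu0
      linear_combination -4 * hu0 - (A + B) * h7
    have : (A - 5) * (A - 6) = 0 := by
      rw [hs, hQ2] at hQ
      linear_combination hQ + (4 - A) * h7
    rcases mul_eq_zero.1 this with h | h
    · left; exact ⟨by linear_combination h, by rw [hs]; linear_combination -h - h7⟩
    · right; exact ⟨by linear_combination h, by rw [hs]; linear_combination -h - h7⟩

lemma pureTriple {F : Type*} [Field F] (h20 : (2 : F) ≠ 0) (h50 : (5 : F) ≠ 0)
    (A B C : F) (h1 : NN A B) (h2 : NN A C) (h3 : NN B C) : A * B = 0 := by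
  have half : ∀ X Y : F, 2 * X = 1 → 2 * Y = 1 → NN X Y → False := by
    intro X Y hX hY ⟨_, h⟩
    have h4 : 4 * (X * Y) = 1 := by linear_combination 2 * Y * hX + hY
    have h10 : (1 : F) ≠ 0 := one_ne_zero
    rcases h with h | h | h | h
    · exact h10 (by linear_combination 4 * h - h4)
    · exact h50 (by linear_combination 4 * h - 9 * h4)
    · exact h10 (by linear_combination 4 * h - 9 * h4)
    · exact h10 (by linear_combination -4 * h + 3 * h4)
  have z : ∀ X : F, 2 * X = 0 → X = 0 := fun X h => (mul_eq_zero.1 h).resolve_left h20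
  rcases h1.1 with a | a <;> rcases h2.1 with b | b <;> rcases h3.1 with c | c
  · rw [z A (by linear_combination a + b - c), zero_mul]
  · exact absurd (half B C (by linear_combination a + c - b) (by linear_combination b + c - a) h3) id
  · exact absurd (half A C (by linear_combination a + b - c) (by linear_combination b + c - a) h2) id
  · rw [z A (by linear_combination a + b - c), zero_mul]
  · exact absurd (half A B (by linear_combination a + b - c) (by linear_combination a + c - b) h1) id
  · rw [z A (by linear_combination a + b - c), zero_mul]
  · rw [z B (by linear_combination a + c - b), mul_zero]
  · exact absurd (half A B (by linear_combination a + b - c) (by linear_combination a + c - b) h1) id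

lemma pureE {F : Type*} [Field F] (h20 : (2 : F) ≠ 0) (h30 : (3 : F) ≠ 0) (A B C : F)
    (h1 : EE A B) (h2 : NN A C ∨ EE A C) (h3 : NN B C ∨ EE B C) : C = 2 ∧ A + B = 4 := by
  unfold NN EE at *
  have h10 : (1 : F) ≠ 0 := one_ne_zero
  have h40 : (4 : F) ≠ 0 := by
    have := mul_ne_zero h20 h20; norm_num at this; exact this
  have h60 : (6 : F) ≠ 0 := by
    have := mul_ne_zero h20 h30; norm_num at this; exact this
  obtain ⟨h7, h1⟩ := h1
  have h5 : (5 : F) ≠ 0 := fun h => h20 (by linear_combination h7 - h)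
  constructor
  · rcases h1 with ⟨rfl, rfl⟩ | ⟨rfl, rfl⟩ <;> rcases h2 with ⟨h2, -⟩ | ⟨-, h2⟩ <;>
      rcases h3 with ⟨h3, -⟩ | ⟨-, h3⟩ <;> grind
  · grind

lemma conj_val {ι F : Type*} [Fintype ι] [DecidableEq ι] [Field F] (d : ι → Fˣ) (v f : ι → F) :
    f ⬝ᵥ (((dg ι F d : GL ι F) : Matrix ι ι F) *ᵥ v) = ∑ i, (v i * f i) * (d i : F) ∧
    (f ᵥ* (((dg ι F d)⁻¹ : GL ι F) : Matrix ι ι F)) ⬝ᵥ v = ∑ i, (v i * f i) * ((d i)⁻¹ : Fˣ) := by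
  constructor
  · rw [dg_coe]
    simp only [dotProduct, mulVec_diagonal]
    exact Finset.sum_congr rfl fun i _ => by ring
  · rw [← map_inv, dg_coe]
    simp only [dotProduct, vecMul_diagonal]
    exact Finset.sum_congr rfl fun i _ => by simp only [Pi.inv_apply]; ring

lemma sum_two {ι F : Type*} [Fintype ι] [DecidableEq ι] [Field F] (α : ι → F) (i j : ι) (hij : i ≠ j)
    (x : Fˣ) : ∑ l, α l * (((Pi.mulSingle i x * Pi.mulSingle j x⁻¹ : ι → Fˣ) l : Fˣ) : F)
      = (∑ l, α l) + α i * ((x : F) - 1) + α j * ((x⁻¹ : Fˣ) - 1 : F) := by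
  have : ∀ l, α l * (((Pi.mulSingle i x * Pi.mulSingle j x⁻¹ : ι → Fˣ) l : Fˣ) : F)
      = α l + (if l = i then α l * ((x : F) - 1) else 0)
        + (if l = j then α l * ((x⁻¹ : Fˣ) - 1 : F) else 0) := by
    intro l
    by_cases h1 : l = i
    · subst h1
      simp [hij]; ring
    · by_cases h2 : l = j
      · subst h2
        simp [h1]; ring
      · simp [h1, h2]
  rw [Finset.sum_congr rfl (fun l _ => this l)]
  simp [Finset.sum_add_distrib]

lemma C4comm {π : Set ℕ} (h3 : 3 ∈ π) {ι F : Type*} [Fintype ι] [DecidableEq ι]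
    [Field F] [Fintype F] (h20 : (2 : F) ≠ 0) (h30 : (3 : F) ≠ 0) (h50 : (5 : F) ≠ 0)
    (hcard : 3 ≤ Fintype.card ι)
    (p : ℕ) [Fact p.Prime] [CharP F p]
    (hp : p ∉ π) {S : Subgroup (GL ι F)} (hS : IsPiNumber π (Nat.card S)) {E : Prop} (hT : Tr5 π F E)
    (w : Fˣ) (hw : (w : F) ^ 2 + w + 1 = 0) (h3s : ∀ x : F, x ^ 2 ≠ 3)
    (hY : ∀ d : ι → Fˣ, d ^ 6 = 1 → ∏ i, d i = 1 → dg ι F d ∈ S)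
    (R : GL ι F) (hR : R ∈ S) (v f : ι → F) (hf : f ⬝ᵥ v = 1) (hRv : (R : Matrix ι ι F) = rfm (w : F) v f)
    (i j : ι) (hij : i ≠ j) :
    Commute (dg ι F (Pi.mulSingle i w * Pi.mulSingle j w⁻¹)) R := by
  have h10 : (1 : F) ≠ 0 := one_ne_zero
  have hsum : ∑ l, v l * f l = 1 := by
    rw [← hf]; exact Finset.sum_congr rfl fun i _ => mul_comm _ _
  have hw3 : w ^ 3 = 1 := by ext; push_cast; linear_combination ((w : F) - 1) * hw
  have pr : ∀ i j : ι, i ≠ j → ∀ x : Fˣ, x ^ 6 = 1 →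
      TT ((1 + (v i * f i) * ((x : F) - 1) + (v j * f j) * ((x⁻¹ : Fˣ) - 1 : F)) *
        (1 + (v i * f i) * ((x⁻¹ : Fˣ) - 1 : F) + (v j * f j) * ((x : F) - 1))) ∧
      ((1 + (v i * f i) * ((x : F) - 1) + (v j * f j) * ((x⁻¹ : Fˣ) - 1 : F)) *
        (1 + (v i * f i) * ((x⁻¹ : Fˣ) - 1 : F) + (v j * f j) * ((x : F) - 1)) = 1 →
        Commute (dg ι F (Pi.mulSingle i x * Pi.mulSingle j x⁻¹)) R) := by
    intro i j hij x hx
    set d : ι → Fˣ := Pi.mulSingle i x * Pi.mulSingle j x⁻¹ with hd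
    have hdS : dg ι F d ∈ S := by
      apply hY
      · rw [hd, mul_pow, ← Pi.mulSingle_pow, ← Pi.mulSingle_pow, inv_pow, hx]; simp
      · rw [hd]
        simp only [Pi.mul_apply, Finset.prod_mul_distrib, Finset.prod_pi_mulSingle']
        simp
    have hc := conj_val d v f
    have hd' : d⁻¹ = Pi.mulSingle i x⁻¹ * Pi.mulSingle j (x⁻¹)⁻¹ := by
      rw [hd, mul_inv, ← Pi.mulSingle_inv, ← Pi.mulSingle_inv]
    have hc2 := sum_two (fun l => v l * f l) i j hij x
    have hc3 := sum_two (fun l => v l * f l) i j hij x⁻¹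
    rw [← hd, ← hc.1, hsum] at hc2
    rw [← hd', hsum, inv_inv] at hc3
    simp only [Pi.inv_apply] at hc3
    rw [← hc.2] at hc3
    have := pairC4 h3 p hp hT h20 h30 hS (w : F) hw R _ hR
      (mul_mem (mul_mem hdS hR) (inv_mem hdS)) v f _ _ hf (by rw [conj_dot, hf]) hRv
      (conj_rfm (dg ι F d) R w v f hRv)
    rw [hc2, hc3] at this
    constructor
    · rcases this with h | h | h | h
      · exact Or.inr (Or.inr (Or.inr h.2))
      · left; rw [h.1, zero_mul]
      · exact Or.inr (Or.inl h)
      · exact Or.inr (Or.inr (Or.inl h))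
    · intro ht
      rcases this with h | h | h | h
      · show dg ι F d * R = R * dg ι F d
        exact (eq_mul_inv_iff_mul_eq.1 h.1).symm
      · rw [h.1, zero_mul] at ht; exact absurd ht.symm h10
      · rw [ht] at h; exact absurd (by linear_combination h) h20
      · rw [ht] at h; exact absurd (by linear_combination h) h10
  have hwi : ((w⁻¹ : Fˣ) : F) = -1 - w := by
    rw [Units.val_inv_eq_inv_val]
    apply inv_eq_of_mul_eq_one_right; linear_combination -hw
  have ne : ∀ i j : ι, i ≠ j → NN (v i * f i) (v j * f j) ∨ EE (v i * f i) (v j * f j) := by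
    intro i j hij
    apply pureNE h20 h30 h50 h3s
    · convert (pr i j hij (-1) (by norm_num)).1 using 1
      simp; ring
    · convert (pr i j hij w (by rw [show 6 = 3 * 2 by norm_num, pow_mul, hw3, one_pow])).1 using 1
      rw [hwi]
      grind
    · convert (pr i j hij (-w) (by
        rw [neg_pow, show 6 = 3 * 2 by norm_num, pow_mul _ 3 2, pow_mul w, hw3]; norm_num)).1 using 1
      rw [inv_neg, Units.val_neg, Units.val_neg, hwi]
      grind
  have noE : ∀ i j : ι, i ≠ j → ¬ EE (v i * f i) (v j * f j) := by
    intro i j hij hE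
    have hl : ∀ l, l ≠ i → l ≠ j → v l * f l = 2 ∧ v i * f i + v j * f j = 4 := by
      intro l h1 h2
      exact pureE h20 h30 _ _ _ hE (ne i l h1.symm) (ne j l h2.symm)
    have h7 := hE.1
    obtain ⟨l, hli, hlj⟩ : ∃ l, l ≠ i ∧ l ≠ j := by
      have h0 : ({i, j} : Finset ι).card < Fintype.card ι :=
        lt_of_le_of_lt Finset.card_le_two (by omega)
      obtain ⟨l, hl⟩ := Finset.exists_mem_notMem_of_card_lt_card (s := {i, j}) (t := Finset.univ)
        (by simpa using h0)
      simp at hl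
      exact ⟨l, by tauto⟩
    by_cases h : ∃ m, m ≠ i ∧ m ≠ j ∧ m ≠ l
    · obtain ⟨m, h1, h2, h3⟩ := h
      have := ne m l h3
      rw [(hl l hli hlj).1, (hl m h1 h2).1] at this
      have h5 : (4 : F) ≠ 0 := by
        have := mul_ne_zero h20 h20; norm_num at this; exact this
      rcases this with ⟨h | h, -⟩ | ⟨-, h | h⟩
      · exact h5 (by linear_combination h)
      · exact h30 (by linear_combination h)
      · exact h30 (by linear_combination -h.1)
      · exact h30 (by linear_combination -h.2)
    · push Not at h
      have hu : (Finset.univ : Finset ι) = {i, j, l} := by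
        ext m
        simp
        by_contra! hh
        exact hh.2.2 (h m hh.1 hh.2.1)
      rw [hu, Finset.sum_insert (by simp [hij, hli.symm]), Finset.sum_insert (by simp [hlj.symm]),
        Finset.sum_singleton, (hl l hli hlj).1, ← add_assoc, (hl l hli hlj).2] at hsum
      exact h20 (by linear_combination h7 - hsum)
  have hN : ∀ i j : ι, i ≠ j → NN (v i * f i) (v j * f j) := fun i j h =>
    (ne i j h).resolve_right (noE i j h)
  obtain ⟨l, hli, hlj⟩ : ∃ l, l ≠ i ∧ l ≠ j := by
    have h0 : ({i, j} : Finset ι).card < Fintype.card ι :=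
      lt_of_le_of_lt Finset.card_le_two (by omega)
    obtain ⟨l, hl⟩ := Finset.exists_mem_notMem_of_card_lt_card (s := {i, j}) (t := Finset.univ)
      (by simpa using h0)
    simp at hl
    exact ⟨l, by tauto⟩
  have hQ := pureTriple h20 h50 _ _ _ (hN i j hij) (hN i l hli.symm) (hN j l hlj.symm)
  apply (pr i j hij w (by rw [show 6 = 3 * 2 by norm_num, pow_mul, hw3, one_pow])).2
  rw [hwi]
  have hP : (v i * f i + v j * f j) * (v i * f i + v j * f j - 1) = 0 := by
    rcases (hN i j hij).1 with h | h
    · rw [h]; ring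
    · rw [h]; ring
  generalize v i * f i = A at *
  generalize v j * f j = B at *
  grind

theorem caseC4 {π : Set ℕ} (h2 : 2 ∈ π) (h3 : 3 ∈ π) {κ F : Type*} [Fintype κ] [DecidableEq κ]
    [Field F] [Fintype F] (h20 : (2 : F) ≠ 0) (h30 : (3 : F) ≠ 0) (h50 : (5 : F) ≠ 0)
    (hcard : 1 ≤ Fintype.card κ) (p : ℕ) [Fact p.Prime] [CharP F p]
    (hp : p ∉ π) {S : Subgroup (GL (Fin 2 ⊕ κ) F)} (hS : Core π S) {E : Prop} (hT : Tr5 π F E)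
    (w : F) (hw : w ^ 2 + w + 1 = 0) (h3s : ∀ x : F, x ^ 2 ≠ 3) : False := by
  have : NeZero (2 : F) := ⟨h20⟩
  obtain ⟨a, b, hab⟩ := exists_ab (F := F)
  obtain ⟨φ⟩ := exists_phi (F := F) p
  obtain ⟨S, hS, hI, hJ, hW⟩ := hS.stdL h2 h3 h20 a b hab
  have hw0 : w ≠ 0 := by rintro rfl; simp at hw
  obtain ⟨s, hs⟩ : ∃ s : Fˣ, (s : F) = w := ⟨Units.mk0 w hw0, rfl⟩
  have hw' : (s : F) ^ 2 + s + 1 = 0 := by rw [hs]; exact hw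
  have hs3 : s ^ 3 = 1 := by ext; push_cast; linear_combination ((s : F) - 1) * hw'
  have hs1 : s ≠ 1 := by
    rintro rfl
    exact h30 (by push_cast at hw'; linear_combination hw')
  let Y : Subgroup ((Fin 2 ⊕ κ) → Fˣ) :=
    { carrier := {u | u ^ 6 = 1 ∧ ∏ i, u i = 1}
      mul_mem' := by
        rintro x y ⟨h1, h3⟩ ⟨h5, h6⟩
        refine ⟨by rw [mul_pow, h1, h5, one_mul], ?_⟩
        simp only [Pi.mul_apply, Finset.prod_mul_distrib, h3, h6, one_mul]
      one_mem' := by simp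
      inv_mem' := by
        rintro x ⟨h1, h3⟩
        refine ⟨by rw [inv_pow, h1, inv_one], ?_⟩
        simp only [Pi.inv_apply, Finset.prod_inv_distrib, h3, inv_one] }
  obtain ⟨g, hg⟩ := hS.2.1 (Y.map (dg _ F)) (by
    apply piN_of_elts
    rintro _ ⟨u, hu, rfl⟩
    refine ⟨6, (IsPiNumber.prime Nat.prime_two h2).mul (IsPiNumber.prime Nat.prime_three h3), ?_⟩
    rw [← map_pow, hu.1, map_one]) (by
    rintro _ ⟨u, hu, rfl⟩
    rw [dg_det, hu.2]; rfl)
  set S1 := S.comap (MulAut.conj g).toMonoidHom with hS1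
  have hC1 : Core π S1 := hS.conj g
  have hY : ∀ d : (Fin 2 ⊕ κ) → Fˣ, d ^ 6 = 1 → ∏ i, d i = 1 → dg _ F d ∈ S1 := by
    intro d h1 h2
    rw [hS1, Subgroup.mem_comap]
    exact hg _ ⟨d, ⟨h1, h2⟩, rfl⟩
  -- reflections commute
  have hcomm : ∀ R R' : GL (Fin 2 ⊕ κ) F, R ∈ S → R' ∈ S → ∀ v f v' f' : Fin 2 ⊕ κ → F,
      f ⬝ᵥ v = 1 → f' ⬝ᵥ v' = 1 → (R : Matrix (Fin 2 ⊕ κ) (Fin 2 ⊕ κ) F) = rfm (s : F) v f →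
      (R' : Matrix (Fin 2 ⊕ κ) (Fin 2 ⊕ κ) F) = rfm (s : F) v' f' → Commute R R' := by
    intro R R' hR hR' v f v' f' hf hf' hRv hRv'
    have cc : ∀ R : GL (Fin 2 ⊕ κ) F, R ∈ S → ∀ v f : Fin 2 ⊕ κ → F, f ⬝ᵥ v = 1 →
        (R : Matrix (Fin 2 ⊕ κ) (Fin 2 ⊕ κ) F) = rfm (s : F) v f → ∀ i j, i ≠ j →
        Commute (g * dg _ F (Pi.mulSingle i s * Pi.mulSingle j s⁻¹) * g⁻¹) R := by
      intro R hR v f hf hRv i j hij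
      have h5 := C4comm h3 h20 h30 h50 (by simp; omega) p hp hC1.1 hT s hw' h3s hY (g⁻¹ * R * g⁻¹⁻¹) (by
        rw [hS1, Subgroup.mem_comap]
        show g * (g⁻¹ * R * g⁻¹⁻¹) * g⁻¹ ∈ S
        convert hR using 1; group) _ _ (by rw [conj_dot, hf]) (conj_rfm g⁻¹ R s v f hRv) i j hij
      have h6 := h5.map (MulAut.conj g).toMonoidHom
      have h7 : (MulAut.conj g).toMonoidHom (g⁻¹ * R * g⁻¹⁻¹) = R := by
        show g * (g⁻¹ * R * g⁻¹⁻¹) * g⁻¹ = R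
        group
      rw [h7] at h6
      exact h6
    refine dg_comm {d | ∃ i j, i ≠ j ∧ d = Pi.mulSingle i s * Pi.mulSingle j s⁻¹} ?_ g R R' ?_ ?_
    · intro i j hij
      refine ⟨_, ⟨i, j, hij, rfl⟩, ?_⟩
      simp [hij, hij.symm]
      intro h
      apply hs1
      have h8 : s * s = 1 := by nth_rewrite 1 [h]; simp
      have : s ^ 3 = s * s * s := by simp only [pow_succ, pow_zero, one_mul]
      rw [← hs3, this, h8, one_mul]
    · rintro _ ⟨i, j, hij, rfl⟩
      exact cc R hR v f hf hRv i j hij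
    · rintro _ ⟨i, j, hij, rfl⟩
      exact cc R' hR' v' f' hf' hRv' i j hij
  obtain ⟨g2, hg2⟩ := hS.refl 3 h3 Nat.prime_three 1 s (by rw [pow_one, hs3])
  have key : ∀ i, Commute (g2 * dg _ F (Pi.mulSingle i s) * g2⁻¹) (emb2 κ qI) ∧
      Commute (g2 * dg _ F (Pi.mulSingle i s) * g2⁻¹) (emb2 κ (qJ a b hab)) := by
    intro i
    have hr2 := conj_rfm g2 _ _ _ _ (dg_rfm i s)
    have hfv := conj_dot g2 (Pi.single i 1) (Pi.single i (1 : F))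
    rw [single_dotProduct, Pi.single_eq_same, mul_one] at hfv
    refine lemZ_GL p φ h20 3 ?_ S a b hab hI hJ hW _ (hg2 i) ?_ ?_
    · intro h
      have : p = 3 := (Nat.prime_dvd_prime_iff_eq Fact.out Nat.prime_three).1 h
      exact hp (this ▸ h3)
    · rw [conj_pow, ← map_pow, ← Pi.mulSingle_pow, hs3]; simp
    · intro h hh
      exact hcomm _ _ (hg2 i) (mul_mem (mul_mem hh (hg2 i)) (inv_mem hh)) _ _ _ _ hfv
        (by rw [conj_dot, hfv]) hr2 (conj_rfm h _ _ _ _ hr2)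
  apply q_ne (κ := κ) a b hab
  apply dg_comm {d | ∃ i, d = Pi.mulSingle i s} _ g2 _ _ (by rintro _ ⟨i, rfl⟩; exact (key i).1)
    (by rintro _ ⟨i, rfl⟩; exact (key i).2)
  intro i j hij
  refine ⟨_, ⟨i, rfl⟩, ?_⟩
  simp [Pi.mulSingle_apply, hij.symm]
  exact hs1
end CaseC4

section Case64
open Matrix
set_option linter.unusedSectionVars false

lemma emb2_surj {κ F : Type*} [Fintype κ] [DecidableEq κ] [IsEmpty κ] [Field F]
    (x : GL (Fin 2 ⊕ κ) F) (hx : (x : Matrix (Fin 2 ⊕ κ) (Fin 2 ⊕ κ) F).det = 1) :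
    ∃ A : SpecialLinearGroup (Fin 2) F, emb2 κ A = x := by
  have h : (x : Matrix (Fin 2 ⊕ κ) (Fin 2 ⊕ κ) F) =
      fromBlocks (x : Matrix (Fin 2 ⊕ κ) (Fin 2 ⊕ κ) F).toBlocks₁₁ 0 0 1 := by
    ext i j
    rcases i with i | i
    · rcases j with j | j
      · rfl
      · exact isEmptyElim j
    · exact isEmptyElim i
  refine ⟨⟨(x : Matrix (Fin 2 ⊕ κ) (Fin 2 ⊕ κ) F).toBlocks₁₁, ?_⟩, Units.ext ?_⟩
  · rw [h, det_fromBlocks_zero₂₁] at hx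
    simpa using hx
  · exact h.symm

lemma emb2_tr {κ F : Type*} [Fintype κ] [DecidableEq κ] [IsEmpty κ] [Field F]
    (A : SpecialLinearGroup (Fin 2) F) :
    ((emb2 κ A : GL (Fin 2 ⊕ κ) F) : Matrix (Fin 2 ⊕ κ) (Fin 2 ⊕ κ) F).trace
      = (A : Matrix (Fin 2) (Fin 2) F).trace := by
  rw [emb2_coe]; simp [trace, Fintype.sum_sum_type]

lemma tr_conj {ι F : Type*} [Fintype ι] [DecidableEq ι] [Field F] (g x : GL ι F) :
    ((g * x * g⁻¹ : GL ι F) : Matrix ι ι F).trace = (x : Matrix ι ι F).trace := by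
  show ((g : Matrix ι ι F) * (x : Matrix ι ι F) * ((g⁻¹ : GL ι F) : Matrix ι ι F)).trace = _
  rw [trace_mul_comm, ← mul_assoc, ← Units.val_mul, inv_mul_cancel, Units.val_one, one_mul]

theorem case64 {π : Set ℕ} (h2 : 2 ∈ π) (h3 : 3 ∈ π) {κ F : Type*} [Fintype κ] [DecidableEq κ]
    [IsEmpty κ] [Field F] [Fintype F] (h20 : (2 : F) ≠ 0) (h30 : (3 : F) ≠ 0)
    {S : Subgroup (GL (Fin 2 ⊕ κ) F)} (hS : Core π S) (hT : Tr5 π F False)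
    (a' c' : F) (hac : a' ^ 2 - a' * c' + c' ^ 2 = -1) : False := by
  have h10 : (1 : F) ≠ 0 := one_ne_zero
  have h40 : (4 : F) ≠ 0 := by
    have := mul_ne_zero h20 h20; norm_num at this; exact this
  obtain ⟨a, b, hab⟩ := exists_ab (F := F)
  obtain ⟨S, hS, hI, hJ, -⟩ := hS.stdL h2 h3 h20 a b hab
  obtain ⟨K, hK, hx, hy, hD⟩ := trK h2 h3 (emb2 κ) a' c' hac
  have hKd : ∀ k ∈ K, (k : Matrix (Fin 2 ⊕ κ) (Fin 2 ⊕ κ) F).det = 1 := by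
    intro k hk
    have : K ≤ (emb2 κ).range := hD _ ⟨_, rfl⟩ ⟨_, rfl⟩
    obtain ⟨A, rfl⟩ := this hk
    exact emb2_det κ A
  obtain ⟨g, hg⟩ := hS.2.1 K hK hKd
  have hKI : emb2 κ (qI * qJ a b hab) ∈ S := by rw [map_mul]; exact mul_mem hI hJ
  have htr : ∀ A : SpecialLinearGroup (Fin 2) F, emb2 κ A ∈ S → A = 1 ∨ A = -1 ∨
      (A : Matrix (Fin 2) (Fin 2) F).trace = 0 ∨ (A : Matrix (Fin 2) (Fin 2) F).trace = 1 ∨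
      (A : Matrix (Fin 2) (Fin 2) F).trace = -1 := by
    intro A hA
    have h1 : A ^ Nat.card S = 1 := by
      apply emb2_inj κ
      rw [map_pow, map_one]
      have := pow_card_eq_one' (x := (⟨_, hA⟩ : S))
      exact congrArg Subtype.val this
    have h5 := hT (A : Matrix (Fin 2) (Fin 2) F) (Nat.card S) Nat.card_pos hS.1 (by
      rw [← Matrix.SpecialLinearGroup.coe_pow, h1, Matrix.SpecialLinearGroup.coe_one]) A.2
    rcases h5 with h | h | h | h | h | h
    · left; exact sl_ext h
    · right; left; apply sl_ext; rw [h]; simp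
    · tauto
    · tauto
    · tauto
    · exact absurd h.1 id
  have lift : ∀ k ∈ K, ∃ B : SpecialLinearGroup (Fin 2) F, emb2 κ B = g * k * g⁻¹ := by
    intro k hk
    apply emb2_surj
    show ((g : Matrix (Fin 2 ⊕ κ) (Fin 2 ⊕ κ) F) * (k : Matrix (Fin 2 ⊕ κ) (Fin 2 ⊕ κ) F) *
      ((g⁻¹ : GL (Fin 2 ⊕ κ) F) : Matrix (Fin 2 ⊕ κ) (Fin 2 ⊕ κ) F)).det = 1
    rw [det_mul, det_mul, hKd k hk, mul_one, ← det_mul, ← Units.val_mul, mul_inv_cancel,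
      Units.val_one, det_one]
  obtain ⟨B, hB⟩ := lift _ hx
  obtain ⟨C, hC⟩ := lift _ hy
  have hBt : (B : Matrix (Fin 2) (Fin 2) F).trace = -1 := by
    rw [← emb2_tr (κ := κ), hB, tr_conj, emb2_tr, tri_coe, trace_fin_two]; simp
  have hCt : (C : Matrix (Fin 2) (Fin 2) F).trace = 0 := by
    rw [← emb2_tr (κ := κ), hC, tr_conj, emb2_tr, trj_coe, trace_fin_two]; simp
  have hCB : (((C : Matrix (Fin 2) (Fin 2) F)) * (B : Matrix (Fin 2) (Fin 2) F)).trace = 0 := by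
    rw [← Matrix.SpecialLinearGroup.coe_mul, ← emb2_tr (κ := κ), map_mul, hC, hB]
    have : g * emb2 κ (trj a' c' hac) * g⁻¹ * (g * emb2 κ (tri F) * g⁻¹) =
      g * emb2 κ (trj a' c' hac * tri F) * g⁻¹ := by rw [map_mul]; group
    rw [this, tr_conj, emb2_tr, Matrix.SpecialLinearGroup.coe_mul, trj_coe, tri_coe, trace_fin_two]
    simp
  have hBS : emb2 κ B ∈ S := by rw [hB]; exact hg _ hx
  have hCS : emb2 κ C ∈ S := by rw [hC]; exact hg _ hy
  have quad : ∀ A : SpecialLinearGroup (Fin 2) F,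
      (A : Matrix (Fin 2) (Fin 2) F).trace ^ 2 +
      (((A * qI : SpecialLinearGroup (Fin 2) F) : Matrix (Fin 2) (Fin 2) F)).trace ^ 2 +
      (((A * qJ a b hab : SpecialLinearGroup (Fin 2) F) : Matrix (Fin 2) (Fin 2) F)).trace ^ 2 +
      (((A * (qI * qJ a b hab) : SpecialLinearGroup (Fin 2) F) : Matrix (Fin 2) (Fin 2) F)).trace ^ 2
      = 4 := by
    intro A
    have hd := A.2
    rw [det_fin_two] at hd
    simp only [Matrix.SpecialLinearGroup.coe_mul, qI_coe, qJ_coe, trace_fin_two, Matrix.mul_apply,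
      Fin.sum_univ_two]
    simp
    generalize (A : Matrix (Fin 2) (Fin 2) F) 0 0 = x at *
    generalize (A : Matrix (Fin 2) (Fin 2) F) 0 1 = y at *
    generalize (A : Matrix (Fin 2) (Fin 2) F) 1 0 = z at *
    generalize (A : Matrix (Fin 2) (Fin 2) F) 1 1 = w at *
    linear_combination 4 * hd + ((x - w) ^ 2 + (y + z) ^ 2) * hab
  have hnegt : ∀ A : SpecialLinearGroup (Fin 2) F, ((-A : SpecialLinearGroup (Fin 2) F) :
      Matrix (Fin 2) (Fin 2) F).trace = -(A : Matrix (Fin 2) (Fin 2) F).trace := by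
    intro A; rw [Matrix.SpecialLinearGroup.coe_neg, trace_neg]
  -- the three units
  have units : ∀ U : SpecialLinearGroup (Fin 2) F,
      U = qI ∨ U = qJ a b hab ∨ U = qI * qJ a b hab → emb2 κ U ∈ S ∧ U * U = -1 ∧
      (U : Matrix (Fin 2) (Fin 2) F).trace = 0 := by
    rintro U (rfl | rfl | rfl)
    · exact ⟨hI, qI_sq, by rw [qI_coe, trace_fin_two]; simp⟩
    · exact ⟨hJ, qJ_sq a b hab, by rw [qJ_coe, trace_fin_two]; simp⟩
    · refine ⟨hKI, ?_, ?_⟩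
      · have := qJI a b hab
        have hIi : (qI : SpecialLinearGroup (Fin 2) F)⁻¹ = -qI := by
          apply inv_eq_of_mul_eq_one_right; rw [mul_neg, qI_sq, neg_neg]
        calc qI * qJ a b hab * (qI * qJ a b hab) = qI * (qJ a b hab * qI) * qJ a b hab := by
              simp only [mul_assoc]
          _ = qJ a b hab * qJ a b hab := by rw [this]; group
          _ = -1 := qJ_sq a b hab
      · rw [Matrix.SpecialLinearGroup.coe_mul, qI_coe, qJ_coe, trace_fin_two]; simp
  have inv3 : ∀ A U : SpecialLinearGroup (Fin 2) F, U * U = -1 → A * U = 1 ∨ A * U = -1 →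
      A = U ∨ A = -U := by
    intro A U hU h
    have h5 : A = -(A * U * U) := by rw [mul_assoc, hU, mul_neg, mul_one, neg_neg]
    rcases h with h | h
    · right; rw [h5, h, one_mul]
    · left; rw [h5, h]; simp
  have sqB : ∀ U : SpecialLinearGroup (Fin 2) F,
      U = qI ∨ U = qJ a b hab ∨ U = qI * qJ a b hab →
      ((B * U : SpecialLinearGroup (Fin 2) F) : Matrix (Fin 2) (Fin 2) F).trace ^ 2 = 0 ∨
      ((B * U : SpecialLinearGroup (Fin 2) F) : Matrix (Fin 2) (Fin 2) F).trace ^ 2 = 1 := by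
    intro U hU
    obtain ⟨hUS, hUU, hUt⟩ := units U hU
    have hno : ¬ (B * U = 1 ∨ B * U = -1) := by
      intro h
      rcases inv3 B U hUU h with h | h
      · rw [h, hUt] at hBt; exact h10 (by linear_combination hBt)
      · rw [h, hnegt, hUt] at hBt; exact h10 (by linear_combination hBt)
    rcases htr _ (by rw [map_mul]; exact mul_mem hBS hUS : emb2 κ (B * U) ∈ S) with h | h | h | h | h
    · exact absurd (Or.inl h) hno
    · exact absurd (Or.inr h) hno
    · left; rw [h]; ring
    · right; rw [h]; ring
    · right; rw [h]; ring
  have oneB : ∀ U : SpecialLinearGroup (Fin 2) F,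
      U = qI ∨ U = qJ a b hab ∨ U = qI * qJ a b hab →
      ((B * U : SpecialLinearGroup (Fin 2) F) : Matrix (Fin 2) (Fin 2) F).trace ≠ 0 := by
    have q := quad B
    rw [hBt] at q
    have s1 := sqB _ (Or.inl rfl)
    have s2 := sqB _ (Or.inr (Or.inl rfl))
    have s3 := sqB _ (Or.inr (Or.inr rfl))
    intro U hU h0
    rcases hU with rfl | rfl | rfl <;> rw [h0] at q <;>
      rcases s1 with s1 | s1 <;> rcases s2 with s2 | s2 <;> rcases s3 with s3 | s3 <;>
      grind
  have hCU : ∃ U : SpecialLinearGroup (Fin 2) F,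
      (U = qI ∨ U = qJ a b hab ∨ U = qI * qJ a b hab) ∧ (C = U ∨ C = -U) := by
    by_contra! hno
    have q := quad C
    rw [hCt] at q
    have sq : ∀ U : SpecialLinearGroup (Fin 2) F,
      U = qI ∨ U = qJ a b hab ∨ U = qI * qJ a b hab →
      ((C * U : SpecialLinearGroup (Fin 2) F) : Matrix (Fin 2) (Fin 2) F).trace ^ 2 = 0 ∨
      ((C * U : SpecialLinearGroup (Fin 2) F) : Matrix (Fin 2) (Fin 2) F).trace ^ 2 = 1 := by
      intro U hU
      obtain ⟨hUS, hUU, hUt⟩ := units U hU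
      have hno : ¬ (C * U = 1 ∨ C * U = -1) := by
        intro h
        rcases inv3 C U hUU h with h | h
        · exact (hno U hU).1 h
        · exact (hno U hU).2 h
      rcases htr _ (by rw [map_mul]; exact mul_mem hCS hUS : emb2 κ (C * U) ∈ S) with
        h | h | h | h | h
      · exact absurd (Or.inl h) hno
      · exact absurd (Or.inr h) hno
      · left; rw [h]; ring
      · right; rw [h]; ring
      · right; rw [h]; ring
    rcases sq _ (Or.inl rfl) with s1 | s1 <;> rcases sq _ (Or.inr (Or.inl rfl)) with s2 | s2 <;>
      rcases sq _ (Or.inr (Or.inr rfl)) with s3 | s3 <;> rw [s1, s2, s3] at q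
    · exact h40 (by linear_combination -q)
    · exact h30 (by linear_combination -q)
    · exact h30 (by linear_combination -q)
    · exact h20 (by linear_combination -q)
    · exact h30 (by linear_combination -q)
    · exact h20 (by linear_combination -q)
    · exact h20 (by linear_combination -q)
    · exact h10 (by linear_combination -q)
  obtain ⟨U, hU, hCU⟩ := hCU
  apply oneB U hU
  rw [Matrix.SpecialLinearGroup.coe_mul, trace_mul_comm]
  rcases hCU with h | h
  · rw [h] at hCB; exact hCB
  · rw [h, Matrix.SpecialLinearGroup.coe_neg, neg_mul, trace_neg] at hCB
    exact neg_eq_zero.1 hCB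
end Case64

section Assembly
open Matrix

lemma exists_piPart (π : Set ℕ) (N : ℕ) (hN : N ≠ 0) : ∃ d, d ∣ N ∧ IsPiNumber π d ∧
    ∀ m, IsPiNumber π m → m ∣ N → m ∣ d := by
  classical
  obtain ⟨d, hd, hmax⟩ := (N.divisors.filter (fun m => IsPiNumber π m)).exists_max_image id
    ⟨1, by simp [hN, IsPiNumber.one]⟩
  simp only [Finset.mem_filter, Nat.mem_divisors, id] at hd hmax
  refine ⟨d, hd.1.1, hd.2, fun m hm hmN => ?_⟩
  have hl : Nat.lcm m d ≤ d := hmax _ ⟨⟨Nat.lcm_dvd hmN hd.1.1, hN⟩,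
    (hm.mul hd.2).of_dvd (Nat.lcm_dvd_mul m d)⟩
  have hd0 : 0 < d := Nat.pos_of_dvd_of_pos hd.1.1 (Nat.pos_of_ne_zero hN)
  have h1 : Nat.lcm m d = d := le_antisymm hl
    (Nat.le_of_dvd (Nat.lcm_pos (Nat.pos_of_dvd_of_pos hmN (Nat.pos_of_ne_zero hN)) hd0)
      (Nat.dvd_lcm_right m d))
  rw [← h1]; exact Nat.dvd_lcm_left m d

lemma piPart_compl {π : Set ℕ} {N d : ℕ} (hN : N ≠ 0) (hd : d ∣ N) (hdπ : IsPiNumber π d)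
    (hm : ∀ m, IsPiNumber π m → m ∣ N → m ∣ d) : ∀ r ∈ π, r.Prime → ¬ r ∣ N / d := by
  intro r hr hrp hdvd
  have hd0 : 0 < d := Nat.pos_of_dvd_of_pos hd (Nat.pos_of_ne_zero hN)
  have h1 : d * r ∣ N := by
    rw [← Nat.mul_div_cancel' hd]; exact Nat.mul_dvd_mul_left d hdvd
  have h2 := Nat.le_of_dvd hd0 (hm _ (hdπ.mul (IsPiNumber.prime hrp hr)) h1)
  have := hrp.two_le
  nlinarith

theorem coreFalse {π : Set ℕ} (h2 : 2 ∈ π) (h3 : 3 ∈ π) {F : Type*} (m c : ℕ) (hc : c ≤ 1)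
    [Field F] [Fintype F] (hodd : Odd (Fintype.card F)) (p : ℕ) [Fact p.Prime] [CharP F p]
    (hp : p ∉ π)
    {S : Subgroup (GL (Fin 2 ⊕ ((Fin 2 × Fin m) ⊕ Fin c)) F)} (hS : Core π S) : False := by
  have cast0 : ∀ r ∈ π, r.Prime → (r : F) ≠ 0 := by
    intro r hr hrp h
    rw [CharP.cast_eq_zero_iff F p, Nat.prime_dvd_prime_iff_eq Fact.out hrp] at h
    exact hp (h ▸ hr)
  have h20 : (2 : F) ≠ 0 := by exact_mod_cast cast0 2 h2 Nat.prime_two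
  have h30 : (3 : F) ≠ 0 := by exact_mod_cast cast0 3 h3 Nat.prime_three
  have hq1 : 1 < Fintype.card F := Fintype.one_lt_card
  have hnc : Nat.card F = Fintype.card F := Nat.card_eq_fintype_card
  have h3q : ¬ 3 ∣ Fintype.card F := by
    obtain ⟨k, hk1, hk2⟩ := FiniteField.card F p
    rw [hk2]
    intro h
    have := (Nat.prime_dvd_prime_iff_eq Nat.prime_three Fact.out).1 (Nat.prime_three.dvd_of_dvd_pow h)
    exact hp (this ▸ h3)
  obtain ⟨d, hdq, hdπ, hdm⟩ := exists_piPart π (Fintype.card F - 1) (by omega)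
  obtain ⟨e, heq, heπ, hem⟩ := exists_piPart π (Fintype.card F + 1) (by omega)
  have p2 := IsPiNumber.prime Nat.prime_two h2
  have p3 := IsPiNumber.prime Nat.prime_three h3
  have p4 : IsPiNumber π 4 := p2.mul p2
  have p8 : IsPiNumber π 8 := p4.mul p2
  have p16 : IsPiNumber π 16 := p4.mul p4
  have p6 : IsPiNumber π 6 := p2.mul p3
  have p12 : IsPiNumber π 12 := p4.mul p3
  have hd0 : 0 < d := Nat.pos_of_dvd_of_pos hdq (by omega)
  have he0 : 0 < e := Nat.pos_of_dvd_of_pos heq (by omega)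
  have hd12 : d < 12 := by
    by_contra! h
    exact caseC1 h2 h3 h20 p hp hS d hdπ h (by rw [hnc]; exact hdq)
  have he12 : e < 12 := by
    by_contra! h
    exact caseC2 h2 h3 m c hc h20 p hp hS e heπ h heq
  generalize hqe : Fintype.card F = q at *
  obtain ⟨k, hk⟩ := hodd
  by_cases h41 : q % 4 = 1
  · have h4d : 4 ∣ d := hdm 4 p4 (by omega)
    by_cases h31 : q % 3 = 1
    · have := hdm 12 p12 (by omega)
      omega
    have h6e : 6 ∣ e := hem 6 p6 (by omega)
    by_cases h8 : 8 ∣ q - 1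
    · exact caseC3 h2 h3 h20 p hp hS (by rw [hnc]; exact h8)
    have hd4 : d = 4 := by
      have : ¬ 8 ∣ d := fun h => h8 (h.trans hdq)
      omega
    have he6 : e = 6 := by omega
    subst hd4 he6
    have hT : Tr5 π F False := by
      apply tr5 h20 p hp
      rintro r hr (h | h)
      · exact Or.inl (hdm r hr (hqe ▸ h))
      · exact Or.inr (Or.inl (hem r hr (hqe ▸ h)))
    have hsq : IsSquare (-1 : F) := FiniteField.isSquare_neg_one_iff.2 (by omega)
    obtain ⟨ε, hε⟩ := hsq
    refine caseC5 h2 h3 h20 h30 p hp hS hT ε (by rw [hε]; ring) ?_ ?_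
    · intro x hx
      have hx1 : x ≠ 1 := by rintro rfl; apply h30; linear_combination hx
      have hx0 : x ≠ 0 := by rintro rfl; simp at hx
      have hx3 : x ^ 3 = 1 := by linear_combination (x - 1) * hx
      have ho : orderOf x = 3 := orderOf_eq_prime hx3 hx1
      have := orderOf_dvd_of_pow_eq_one (FiniteField.pow_card_sub_one_eq_one x hx0)
      rw [ho, hqe] at this
      omega
    · intro x hx
      have : IsSquare (2 : F) := ⟨x, by rw [← hx]; ring⟩
      rw [FiniteField.isSquare_two_iff] at this
      omega
  · have h4e : 4 ∣ e := hem 4 p4 (by omega)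
    by_cases h32 : q % 3 = 2
    · have := hem 12 p12 (by omega)
      omega
    have h6d : 6 ∣ d := hdm 6 p6 (by omega)
    have hd6 : d = 6 := by omega
    subst hd6
    have hnsq : ¬ IsSquare (-1 : F) := by
      rw [FiniteField.isSquare_neg_one_iff]; omega
    obtain ⟨w, hw⟩ : ∃ w : F, w ^ 2 + w + 1 = 0 := by
      classical
      have : Fact (Nat.Prime 3) := ⟨Nat.prime_three⟩
      obtain ⟨u, hu⟩ := exists_prime_orderOf_dvd_card (G := Fˣ) 3 (by
        rw [Fintype.card_units]; omega)
      have hu3 : (u : F) ^ 3 = 1 := by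
        have := pow_orderOf_eq_one u
        rw [hu] at this
        rw [← Units.val_pow_eq_pow_val, this, Units.val_one]
      have hu1 : (u : F) - 1 ≠ 0 := by
        intro h
        have : u = 1 := Units.ext (sub_eq_zero.1 h)
        rw [this, orderOf_one] at hu
        omega
      refine ⟨u, ?_⟩
      apply mul_left_cancel₀ hu1
      linear_combination hu3
    have hr2 : (2 * w + 1) ^ 2 = -3 := by linear_combination 4 * hw
    have hr0 : 2 * w + 1 ≠ 0 := by
      intro h; rw [h] at hr2; apply h30; linear_combination hr2
    by_cases hn : 1 ≤ Fintype.card ((Fin 2 × Fin m) ⊕ Fin c)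
    · have hT : Tr5 π F True := by
        apply tr5 h20 p hp
        rintro r hr (h | h)
        · exact Or.inr (Or.inl (hdm r hr (hqe ▸ h)))
        · have h5 := hem r hr (hqe ▸ h)
          have : e = 4 ∨ e = 8 := by omega
          rcases this with rfl | rfl
          · exact Or.inl h5
          · exact Or.inr (Or.inr ⟨trivial, h5⟩)
      refine caseC4 h2 h3 h20 h30 ?_ hn p hp hS hT w hw ?_
      · intro h5; exact hnsq ⟨2, by linear_combination -h5⟩
      · intro x hx
        have hx0 : x ≠ 0 := by
          rintro rfl; apply h30; linear_combination -hx
        refine hnsq ⟨(2 * w + 1) / x, ?_⟩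
        rw [div_mul_div_comm, ← pow_two, ← pow_two, hr2, hx, neg_div, div_self h30]
    · simp only [Fintype.card_sum, Fintype.card_prod, Fintype.card_fin] at hn
      obtain rfl : m = 0 := by omega
      obtain rfl : c = 0 := by omega
      by_cases he8 : e = 8
      · subst he8
        have h16 : ¬ 16 ∣ q + 1 := by
          intro h
          have := hem 16 p16 h
          omega
        exact caseC68 h2 h3 h20 p hp hS (by omega)
      · have he4 : e = 4 := by omega
        subst he4
        have hT : Tr5 π F False := by
          apply tr5 h20 p hp
          rintro r hr (h | h)
          · exact Or.inr (Or.inl (hdm r hr (hqe ▸ h)))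
          · exact Or.inl (hem r hr (hqe ▸ h))
        refine case64 h2 h3 h20 h30 hS hT (1 / (2 * w + 1)) (2 / (2 * w + 1)) ?_
        field_simp
        linear_combination hr2
end Assembly

section StepF
open Matrix

lemma stepF {π : Set ℕ} {Γ C : Type*} [Group Γ] [Finite Γ] [CommGroup C] [Finite C] [IsCyclic C]
    (f : Γ →* C) (hf : Function.Surjective f) (A : Subgroup Γ)
    (hA : IsPiNumber π (Nat.card A)) (hAk : A ≤ f.ker) (k : ℕ)
    (hk : Nat.card f.ker = Nat.card A * k) (hkπ : ∀ r ∈ π, r.Prime → ¬ r ∣ k)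
    (hD : ∀ K : Subgroup Γ, IsPiNumber π (Nat.card K) → K ≤ f.ker →
      ∃ g ∈ f.ker, ∀ x ∈ K, g * x * g⁻¹ ∈ A) :
    ∃ S : Subgroup Γ, A ≤ S ∧ IsPiNumber π (Nat.card S) ∧ ∀ r ∈ π, r.Prime → ¬ r ∣ S.index := by
  obtain ⟨t, ht⟩ := IsCyclic.exists_generator (α := C)
  obtain ⟨γ, hγ⟩ := hf t
  obtain ⟨g, hgk, hg⟩ := hD (A.map (MulAut.conj γ).toMonoidHom) (by
      rw [Subgroup.card_map_of_injective (MulAut.conj γ).injective]; exact hA) (by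
      rintro _ ⟨a, ha, rfl⟩
      have : f a = 1 := hAk ha
      simp [MonoidHom.mem_ker, this])
  set ν := g * γ with hν
  have hνA : ∀ a ∈ A, ν * a * ν⁻¹ ∈ A := by
    intro a ha
    have := hg (γ * a * γ⁻¹) ⟨a, ha, rfl⟩
    have e : ν * a * ν⁻¹ = g * (γ * a * γ⁻¹) * g⁻¹ := by rw [hν]; group
    rw [e]; exact this
  have hfν : f ν = t := by rw [hν, map_mul, hγ, MonoidHom.mem_ker.1 hgk, one_mul]
  have hM0 : orderOf ν ≠ 0 := (orderOf_pos ν).ne'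
  obtain ⟨d, hd, hdπ, hdm⟩ := exists_piPart π (orderOf ν) hM0
  have hcompl := piPart_compl hM0 hd hdπ hdm
  set M := orderOf ν / d with hM
  have hSπ : IsPiNumber π (Nat.card (A ⊔ Subgroup.zpowers (ν ^ M) : Subgroup Γ)) := by
    apply piN_sup _ _ _ hA
    · apply piN_zpowers _ d hdπ
      rw [← pow_mul, hM, Nat.div_mul_cancel hd, pow_orderOf_eq_one]
    · intro b hb a ha
      exact norm_ext A ν hνA b ((Subgroup.zpowers_le.2 (pow_mem (Subgroup.mem_zpowers ν) M)) hb) a ha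
  refine ⟨A ⊔ Subgroup.zpowers (ν ^ M), le_sup_left, hSπ, ?_⟩
  set S := A ⊔ Subgroup.zpowers (ν ^ M) with hS
  have hAS : A ≤ S := le_sup_left
  set φ := f.comp S.subtype with hφ
  have c1 : Nat.card φ.ker * Nat.card φ.range = Nat.card S := by
    rw [← Subgroup.index_ker, Subgroup.card_mul_index]
  have c2 : Nat.card A ∣ Nat.card φ.ker := by
    rw [← Nat.card_congr (Subgroup.subgroupOfEquivOfLe hAS).toEquiv]
    apply Subgroup.card_dvd_of_le
    intro x hx
    exact hAk hx
  have c3 : Nat.card C ∣ Nat.card φ.range * M := by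
    have h1 : t ^ M ∈ φ.range := by
      refine ⟨⟨ν ^ M, (le_sup_right : _ ≤ S) (Subgroup.mem_zpowers _)⟩, ?_⟩
      show f (ν ^ M) = _
      rw [map_pow, hfν]
    have h2 : orderOf (t ^ M) ∣ Nat.card φ.range := by
      rw [← Nat.card_zpowers]
      exact Subgroup.card_dvd_of_le (Subgroup.zpowers_le.2 h1)
    rw [← orderOf_eq_card_of_forall_mem_zpowers ht]
    apply orderOf_dvd_of_pow_eq_one
    rw [mul_comm, pow_mul]
    exact orderOf_dvd_iff_pow_eq_one.1 h2
  have c4 : Nat.card Γ = Nat.card A * k * Nat.card C := by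
    rw [← Subgroup.card_mul_index f.ker, hk, Subgroup.index_ker, MonoidHom.range_eq_top.2 hf,
      Subgroup.card_top]
  have c5 : Nat.card S * S.index ∣ Nat.card S * (M * k) := by
    rw [Subgroup.card_mul_index, c4, ← c1]
    have := mul_dvd_mul (mul_dvd_mul c2 c3) (dvd_refl k)
    calc _ = Nat.card A * Nat.card C * k := by ring
      _ ∣ _ := this
      _ = _ := by ring
  have c6 : S.index ∣ M * k := Nat.dvd_of_mul_dvd_mul_left Nat.card_pos c5
  intro r hr hrp hd
  rcases hrp.dvd_mul.1 (hd.trans c6) with h | h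
  · exact hcompl r hr hrp h
  · exact hkπ r hr hrp h

lemma sylow_fix {Γ : Type*} [Group Γ] [Finite Γ] (S : Subgroup Γ) (r : ℕ) (hr : r.Prime)
    (h : ¬ r ∣ S.index) (K : Subgroup Γ) (hK : IsPGroup r K) : ∃ g : Γ, ∀ k ∈ K, g * k * g⁻¹ ∈ S := by
  have : Fact r.Prime := ⟨hr⟩
  obtain ⟨x, hx⟩ := hK.nonempty_fixed_point_of_prime_not_dvd_card (Γ ⧸ S) h
  obtain ⟨x, rfl⟩ := QuotientGroup.mk_surjective x
  refine ⟨x⁻¹, fun k hk => ?_⟩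
  have h1 : ((k * x : Γ) : Γ ⧸ S) = (x : Γ ⧸ S) := hx ⟨k, hk⟩
  have h2 := QuotientGroup.eq.1 h1.symm
  rw [inv_inv, mul_assoc]
  exact h2

lemma Core.reindex {π : Set ℕ} {ι ι' F : Type*} [Fintype ι] [DecidableEq ι] [Fintype ι']
    [DecidableEq ι'] [Field F] (e : ι ≃ ι') {S : Subgroup (GL ι F)} (hS : Core π S) :
    ∃ S' : Subgroup (GL ι' F), Core π S' := by
  let E : GL ι F ≃* GL ι' F := Units.mapEquiv (reindexAlgEquiv F F e).toRingEquiv.toMulEquiv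
  have hE : ∀ x : GL ι' F, ((E.symm x : GL ι F) : Matrix ι ι F).det =
      (x : Matrix ι' ι' F).det := by
    intro x
    show (Matrix.reindex e.symm e.symm (x : Matrix ι' ι' F)).det = _
    rw [det_reindex_self]
  have key : ∀ K : Subgroup (GL ι' F), (∃ g : GL ι F, ∀ k ∈ K.comap E.toMonoidHom, g * k * g⁻¹ ∈ S) →
      ∃ g : GL ι' F, ∀ k ∈ K, g * k * g⁻¹ ∈ S.map E.toMonoidHom := by
    rintro K ⟨g, hg⟩
    refine ⟨E g, fun k hk => ⟨g * E.symm k * g⁻¹, hg _ ?_, ?_⟩⟩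
    · show E (E.symm k) ∈ K
      rw [E.apply_symm_apply]; exact hk
    · show E _ = _
      simp
  have hcard : ∀ K : Subgroup (GL ι' F), Nat.card (K.comap E.toMonoidHom) = Nat.card K := by
    intro K
    exact Nat.card_congr (E.toEquiv.subtypeEquiv (fun a => Iff.rfl))
  refine ⟨S.map E.toMonoidHom, ?_, ?_, ?_⟩
  · have : Nat.card (S.map E.toMonoidHom) = Nat.card S :=
      Subgroup.card_map_of_injective (f := E.toMonoidHom) E.injective
    rw [this]; exact hS.1
  · intro K hK hd
    apply key
    apply hS.2.1 _ (by rw [hcard]; exact hK)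
    intro k hk
    rw [← hd _ hk, ← hE]
    congr 2
    exact (E.symm_apply_apply k).symm
  · intro r hr hrp K hK
    apply key
    apply hS.2.2 r hr hrp
    exact hK.comap_of_injective _ E.injective

theorem mainFalse {n : ℕ} (hn : 2 ≤ n) {F : Type*} [Field F] [Fintype F]
    (hqodd : Odd (Fintype.card F)) {π : Set ℕ} (h2 : 2 ∈ π) (h3 : 3 ∈ π) (hp : ringChar F ∉ π)
    (H : Subgroup (Matrix.SpecialLinearGroup (Fin n) F)) (hH : IsHallPi π H)
    (hD : ∀ K : Subgroup (Matrix.SpecialLinearGroup (Fin n) F), IsPiNumber π (Nat.card K) →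
      ∃ g, conjSub g K ≤ H) : False := by
  classical
  have hpp : Fact (ringChar F).Prime := ⟨CharP.char_is_prime F (ringChar F)⟩
  let T : SpecialLinearGroup (Fin n) F →* GL (Fin n) F := SpecialLinearGroup.toGL
  have hTi : Function.Injective T := by
    intro a b hab
    exact sl_ext (congrArg (fun x : GL (Fin n) F => (x : Matrix (Fin n) (Fin n) F)) hab)
  let f : GL (Fin n) F →* Fˣ := GeneralLinearGroup.det
  have hfdet : ∀ x, f x = 1 ↔ (x : Matrix (Fin n) (Fin n) F).det = 1 := by
    intro x
    rw [← Units.val_inj]; rfl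
  have hTr : T.range = f.ker := by
    ext x
    rw [MonoidHom.mem_ker, hfdet]
    constructor
    · rintro ⟨A, rfl⟩; exact A.2
    · intro h; exact ⟨⟨x, h⟩, Units.ext rfl⟩
  have hf : Function.Surjective f := by
    intro u
    have i0 : Fin n := ⟨0, by omega⟩
    refine ⟨dg _ F (Function.update (fun _ => 1) i0 u), ?_⟩
    apply Units.ext
    show (dg _ F (Function.update (fun _ => 1) i0 u) : Matrix (Fin n) (Fin n) F).det = u
    rw [dg_det, Finset.prod_update_of_mem (Finset.mem_univ _)]
    simp
  have hker : Nat.card f.ker = Nat.card (SpecialLinearGroup (Fin n) F) := by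
    rw [← hTr]; exact (Nat.card_congr (T.ofInjective hTi).toEquiv).symm
  have hcH : Nat.card (H.map T) = Nat.card H := Subgroup.card_map_of_injective hTi
  have hD' : ∀ K : Subgroup (GL (Fin n) F), IsPiNumber π (Nat.card K) → K ≤ f.ker →
      ∃ g ∈ f.ker, ∀ x ∈ K, g * x * g⁻¹ ∈ H.map T := by
    intro K hK hKf
    obtain ⟨g, hg⟩ := hD (K.comap T) (hK.of_dvd (Subgroup.card_comap_dvd_of_injective K T hTi))
    refine ⟨T g, hTr ▸ ⟨g, rfl⟩, fun x hx => ?_⟩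
    have : x ∈ T.range := hTr ▸ hKf hx
    obtain ⟨y, rfl⟩ := this
    refine ⟨g * y * g⁻¹, hg ⟨y, hx, rfl⟩, by simp⟩
  obtain ⟨S, hHS, hSπ, hSi⟩ := stepF f hf (H.map T) (by rw [hcH]; exact hH.1)
    (by rw [← hTr]; exact Subgroup.map_le_range T H) H.index
    (by rw [hcH, hker, Subgroup.card_mul_index]) hH.2 hD'
  have hcore : Core π S := by
    refine ⟨hSπ, ?_, ?_⟩
    · intro K hK hd
      obtain ⟨g, -, hg⟩ := hD' K hK (fun x hx => (hfdet x).2 (hd x hx))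
      exact ⟨g, fun k hk => hHS (hg k hk)⟩
    · intro r hr hrp K hK
      exact sylow_fix S r hrp (hSi r hr hrp) K hK
  have e : Fin n ≃ Fin 2 ⊕ ((Fin 2 × Fin ((n - 2) / 2)) ⊕ Fin ((n - 2) % 2)) := by
    apply Fintype.equivOfCardEq
    simp only [Fintype.card_sum, Fintype.card_prod, Fintype.card_fin]
    omega
  obtain ⟨S', hS'⟩ := hcore.reindex e
  exact coreFalse h2 h3 _ _ (by omega) hqodd (ringChar F) hp hS'
end StepF

/-- Let `n ≥ 2`, let `F` be a finite field of odd order and characteristic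
`p`, and let `π` be a set of primes with `2, 3 ∈ π` and `p ∉ π`. If `H` is a
`π`-Hall subgroup of `SLₙ(F)`, then there is a `π`-subgroup `K` of `SLₙ(F)` no
conjugate of which is contained in `H`; in particular `SLₙ(F)` does not
satisfy `D_π`. -/
theorem stmt_17 (n : ℕ) (hn : 2 ≤ n)
    (F : Type*) [Field F] [Fintype F] (hqodd : Odd (Fintype.card F))
    (π : Set ℕ) (h2 : 2 ∈ π) (h3 : 3 ∈ π) (hp : ringChar F ∉ π)
    (H : Subgroup (Matrix.SpecialLinearGroup (Fin n) F)) (hH : IsHallPi π H) :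
    (∃ K : Subgroup (Matrix.SpecialLinearGroup (Fin n) F),
      IsPiNumber π (Nat.card K) ∧
      ∀ g : Matrix.SpecialLinearGroup (Fin n) F, ¬ conjSub g K ≤ H) ∧
    ¬ DPi π (Matrix.SpecialLinearGroup (Fin n) F) := by
  have hfst : ∃ K : Subgroup (Matrix.SpecialLinearGroup (Fin n) F),
      IsPiNumber π (Nat.card K) ∧
      ∀ g : Matrix.SpecialLinearGroup (Fin n) F, ¬ conjSub g K ≤ H := by
    by_contra! hno
    exact mainFalse hn hqodd h2 h3 hp H hH hno
  refine ⟨hfst, fun hDpi => ?_⟩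
  obtain ⟨K, hK, hKH⟩ := hfst
  obtain ⟨H', hH', hKH'⟩ := hDpi.2 K hK
  obtain ⟨g, hg⟩ := hDpi.1.2 H' H hH' hH
  exact hKH g (hg ▸ Subgroup.map_mono hKH')
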